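/- Let B₀^{H,K} = {B₀^{H,K}(t), t ≥ 0} be a bifractional Brownian motion in ℝ with indices H ∈ (0,1) and K ∈ (0,1]. Then there exists a constant c ∈ (0,∞) such that, almost surely, liminf_{r → 0⁺} [ max_{t ∈ [0,r]} |B₀^{H,K}(t)| ] / [ r^{HK} (log log(1/r))^{−HK} ] = c. (Chung's law of the iterated logarithm at the origin.) -/

import Mathlib

open MeasureTheory ProbabilityTheory Filter Topology

/-- The bifractional covariance function
`R^{H,K}(s,t) = 2^{-K} [(t^{2H} + s^{2H})^K - |t-s|^{2HK}]`. -/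
noncomputable def Rbif (H K s t : ℝ) : ℝ :=
  (2 : ℝ) ^ (-K) * ((t ^ (2 * H) + s ^ (2 * H)) ^ K - |t - s| ^ (2 * H * K))

/-- `B` is a bifractional Brownian motion in `ℝ` with indices `H, K` on `(Ω, μ)`:
it has a.s. continuous sample paths on `[0,∞)`, and it is a centered Gaussian process
with covariance `R^{H,K}`, i.e. every finite real linear combination
`∑ i, a i * B (t i)` (with `t i ≥ 0`) is centered Gaussian with variance
`∑ i ∑ j, a i * a j * R^{H,K}(t i, t j)`. -/
def IsBifBM {Ω : Type*} [MeasurableSpace Ω] (μ : Measure Ω) (H K : ℝ)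
    (B : ℝ → Ω → ℝ) : Prop :=
  (∀ᵐ ω ∂μ, ContinuousOn (fun t => B t ω) (Set.Ici 0)) ∧
  ∀ (n : ℕ) (t : Fin n → ℝ), (∀ i, 0 ≤ t i) → ∀ a : Fin n → ℝ,
    Measure.map (fun ω => ∑ i, a i * B (t i) ω) μ =
      gaussianReal 0 (Real.toNNReal (∑ i, ∑ j, a i * a j * Rbif H K (t i) (t j)))

namespace BifChung

lemma bm_compact {K L : Set ℝ} (hK : IsCompact K) (hL : IsCompact L) (hKn : K.Nonempty)
    (hLn : L.Nonempty) {U : Set ℝ} (hU : ∀ x ∈ K, ∀ y ∈ L, x + y ∈ U) :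
    volume K + volume L ≤ volume U := by
  have ha : sSup K ∈ K := hK.sSup_mem hKn
  have hb : sInf L ∈ L := hL.sInf_mem hLn
  set a := sSup K
  set b := sInf L
  have h1 : volume ((fun x => x + (-b)) ⁻¹' K) = volume K := measure_preimage_add_right _ _ _
  have h2 : volume ((fun x => x + (-a)) ⁻¹' L) = volume L := measure_preimage_add_right _ _ _
  rw [← h1, ← h2]
  have hm : MeasurableSet ((fun x => x + (-a)) ⁻¹' L) :=
    (measurable_id.add_const _) hL.measurableSet
  have hd : AEDisjoint volume ((fun x => x + (-b)) ⁻¹' K) ((fun x => x + (-a)) ⁻¹' L) := by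
    refine measure_mono_null (t := {a + b}) ?_ (by simp)
    rintro x ⟨hx1, hx2⟩
    have e1 : x + -b ≤ a := le_csSup hK.bddAbove hx1
    have e2 : b ≤ x + -a := csInf_le hL.bddBelow hx2
    simp only [Set.mem_singleton_iff]
    linarith
  rw [← measure_union₀ hm.nullMeasurableSet hd]
  apply measure_mono
  rintro x (hx | hx)
  · have := hU _ hx _ hb
    simpa using this
  · have := hU _ ha _ hx
    simpa using this

lemma bm_meas {S T U : Set ℝ} (hS : MeasurableSet S) (hT : MeasurableSet T) (hSn : S.Nonempty)
    (hTn : T.Nonempty) (hU : ∀ x ∈ S, ∀ y ∈ T, x + y ∈ U) :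
    volume S + volume T ≤ volume U := by
  rw [hS.measure_eq_iSup_isCompact, hT.measure_eq_iSup_isCompact]
  simp only [ENNReal.iSup_add, ENNReal.add_iSup, iSup_le_iff]
  obtain ⟨s, hs⟩ := hSn
  obtain ⟨t, ht⟩ := hTn
  have key : ∀ K ⊆ S, IsCompact K → ∀ L ⊆ T, IsCompact L → volume K + volume L ≤ volume U := by
    intro K hK hKc L hL hLc
    have := bm_compact (K := insert s K) (L := insert t L) (U := U) (hKc.insert s) (hLc.insert t)
      ⟨s, by simp⟩ ⟨t, by simp⟩ (fun x hx y hy => hU x (Set.insert_subset hs hK hx) y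
        (Set.insert_subset ht hL hy))
    exact (add_le_add (measure_mono (by simp)) (measure_mono (by simp))).trans this
  intro L K
  by_cases h1 : K ⊆ S ∧ IsCompact K <;> by_cases h2 : L ⊆ T ∧ IsCompact L
  · simpa [h1.1, h1.2, h2.1, h2.2] using key K h1.1 h1.2 L h2.1 h2.2
  · have := key K h1.1 h1.2 ∅ (by simp) (by simp)
    have e : (⨆ (_ : L ⊆ T), ⨆ (_ : IsCompact L), volume L) = 0 := by
      simp only [iSup_eq_bot, ← bot_eq_zero]; tauto
    rw [e]; simpa [h1.1, h1.2] using this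
  · have := key ∅ (by simp) (by simp) L h2.1 h2.2
    have e : (⨆ (_ : K ⊆ S), ⨆ (_ : IsCompact K), volume K) = 0 := by
      simp only [iSup_eq_bot, ← bot_eq_zero]; tauto
    rw [e]; simpa [h2.1, h2.2] using this
  · have e : (⨆ (_ : K ⊆ S), ⨆ (_ : IsCompact K), volume K) = 0 := by
      simp only [iSup_eq_bot, ← bot_eq_zero]; tauto
    have e' : (⨆ (_ : L ⊆ T), ⨆ (_ : IsCompact L), volume L) = 0 := by
      simp only [iSup_eq_bot, ← bot_eq_zero]; tauto
    rw [e, e']; simp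

lemma bm_conv {S T U : Set ℝ} (hS : MeasurableSet S) (hT : MeasurableSet T) (hSn : S.Nonempty)
    (hTn : T.Nonempty) {l m : ℝ} (hl : 0 < l) (hm : 0 < m)
    (hU : ∀ x ∈ S, ∀ y ∈ T, l * x + m * y ∈ U) :
    ENNReal.ofReal l * volume S + ENNReal.ofReal m * volume T ≤ volume U := by
  have h1 : volume ((fun x => l⁻¹ * x) ⁻¹' S) = ENNReal.ofReal l * volume S := by
    rw [Real.volume_preimage_mul_left (by positivity)]; simp [abs_of_pos hl]
  have h2 : volume ((fun x => m⁻¹ * x) ⁻¹' T) = ENNReal.ofReal m * volume T := by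
    rw [Real.volume_preimage_mul_left (by positivity)]; simp [abs_of_pos hm]
  rw [← h1, ← h2]
  obtain ⟨s, hs⟩ := hSn
  obtain ⟨t, ht⟩ := hTn
  refine bm_meas ((measurable_const_mul _) hS) ((measurable_const_mul _) hT)
    ⟨l * s, by simpa [hl.ne'] using hs⟩ ⟨m * t, by simpa [hm.ne'] using ht⟩ ?_
  intro x hx y hy
  have := hU _ hx _ hy
  simpa [← mul_assoc, hl.ne', hm.ne'] using this

lemma lint_eq01 {F : ℝ → ℝ} (hF : Measurable F) (h0 : ∀ x, 0 ≤ F x) (h1 : ∀ x, F x ≤ 1) :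
    ∫⁻ x, ENNReal.ofReal (F x) = ∫⁻ t in Set.Ioo (0:ℝ) 1, volume {x | t < F x} := by
  rw [lintegral_eq_lintegral_meas_lt _ (Eventually.of_forall h0) hF.aemeasurable]
  have : Set.Ioi (0:ℝ) = Set.Ioo 0 1 ∪ Set.Ici 1 := by
    ext x; simp only [Set.mem_Ioi, Set.mem_union, Set.mem_Ioo, Set.mem_Ici]
    constructor
    · intro h; rcases lt_or_ge x 1 with h' | h'
      · left; exact ⟨h, h'⟩
      · right; exact h'
    · rintro (h | h) <;> linarith
  rw [this, lintegral_union measurableSet_Ici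
    (Set.disjoint_left.2 fun x hx hx' => by simp at hx hx'; linarith)]
  have h2 : ∫⁻ t in Set.Ici (1:ℝ), volume {x | t < F x} = 0 := by
    rw [setLIntegral_congr_fun measurableSet_Ici (g := fun _ => 0)]
    · simp
    · intro t ht
      have : {x | t < F x} = ∅ := by
        ext x; simp only [Set.mem_ofPred_eq, Set.mem_empty_iff_false, iff_false, not_lt]
        exact (h1 x).trans ht
      simp [this]
  rw [h2, add_zero]

lemma pl_norm {F G Hh : ℝ → ℝ} (hF : Measurable F) (hG : Measurable G) (hH : Measurable Hh)
    (F0 : ∀ x, 0 ≤ F x) (F1 : ∀ x, F x ≤ 1) (G0 : ∀ x, 0 ≤ G x) (G1 : ∀ x, G x ≤ 1)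
    (H0 : ∀ x, 0 ≤ Hh x)
    (Fs : ∀ t < 1, ∃ x, t < F x) (Gs : ∀ t < 1, ∃ x, t < G x)
    {l m : ℝ} (hl : 0 < l) (hm : 0 < m) (hlm : l + m = 1)
    (h : ∀ x y, F x ^ l * G y ^ m ≤ Hh (l * x + m * y)) :
    ENNReal.ofReal l * (∫⁻ x, ENNReal.ofReal (F x)) + ENNReal.ofReal m * (∫⁻ x, ENNReal.ofReal (G x))
      ≤ ∫⁻ x, ENNReal.ofReal (Hh x) := by
  rw [lint_eq01 hF F0 F1, lint_eq01 hG G0 G1,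
    lintegral_eq_lintegral_meas_lt _ (Eventually.of_forall H0) hH.aemeasurable]
  have hmeas : ∀ {F : ℝ → ℝ}, Measurable fun t => volume {x | t < F x} := by
    intro F
    exact Antitone.measurable (fun s t hst => measure_mono fun x hx => lt_of_le_of_lt hst hx)
  rw [← lintegral_const_mul _ hmeas, ← lintegral_const_mul _ hmeas,
    ← lintegral_add_left (hmeas.const_mul _)]
  refine le_trans ?_ (lintegral_mono_set (fun x hx => hx.1 : Set.Ioo (0:ℝ) 1 ⊆ Set.Ioi 0))
  refine setLIntegral_mono hmeas ?_
  rintro t ⟨ht0, ht1⟩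
  refine bm_conv (measurableSet_lt measurable_const hF) (measurableSet_lt measurable_const hG)
    (Fs t ht1) (Gs t ht1) hl hm ?_
  intro x hx y hy
  simp only [Set.mem_ofPred_eq] at hx hy ⊢
  refine lt_of_lt_of_le ?_ (h x y)
  calc t = t ^ l * t ^ m := by rw [← Real.rpow_add ht0, hlm, Real.rpow_one]
    _ < _ := by
      apply mul_lt_mul'' (Real.rpow_lt_rpow ht0.le hx hl) (Real.rpow_lt_rpow ht0.le hy hm) <;>
      positivity

/-- one dimensional Prekopa-Leindler -/
lemma pl_one {f g h : ℝ → ℝ} (hf : Integrable f) (hg : Integrable g) (hh : Integrable h)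
    (mf : Measurable f) (mg : Measurable g) (mh : Measurable h)
    (f0 : ∀ x, 0 ≤ f x) (g0 : ∀ x, 0 ≤ g x) (h0 : ∀ x, 0 ≤ h x) (fb : BddAbove (Set.range f))
    (gb : BddAbove (Set.range g))
    {l m : ℝ} (hl : 0 < l) (hm : 0 < m) (hlm : l + m = 1)
    (hyp : ∀ x y, f x ^ l * g y ^ m ≤ h (l * x + m * y)) :
    (∫ x, f x) ^ l * (∫ x, g x) ^ m ≤ ∫ x, h x := by
  have If : 0 ≤ ∫ x, f x := integral_nonneg f0
  have Ig : 0 ≤ ∫ x, g x := integral_nonneg g0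
  have Ih : 0 ≤ ∫ x, h x := integral_nonneg h0
  rcases If.eq_or_lt with h1 | h1
  · rw [← h1, Real.zero_rpow hl.ne', zero_mul]; exact Ih
  rcases Ig.eq_or_lt with h2 | h2
  · rw [← h2, Real.zero_rpow hm.ne', mul_zero]; exact Ih
  set A := sSup (Set.range f) with hA
  set B := sSup (Set.range g) with hB
  have fA : ∀ x, f x ≤ A := fun x => le_csSup fb ⟨x, rfl⟩
  have gB : ∀ x, g x ≤ B := fun x => le_csSup gb ⟨x, rfl⟩
  have A0 : 0 < A := by
    by_contra hc
    have : ∀ x, f x = 0 := fun x => le_antisymm ((fA x).trans (not_lt.1 hc)) (f0 x)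
    simp [this] at h1
  have B0 : 0 < B := by
    by_contra hc
    have : ∀ x, g x = 0 := fun x => le_antisymm ((gB x).trans (not_lt.1 hc)) (g0 x)
    simp [this] at h2
  have D0 : 0 < A ^ l * B ^ m := by positivity
  have key := pl_norm (F := fun x => f x / A) (G := fun x => g x / B)
    (Hh := fun x => h x / (A ^ l * B ^ m)) (mf.div_const _) (mg.div_const _) (mh.div_const _)
    (fun x => div_nonneg (f0 x) A0.le) (fun x => (div_le_one A0).2 (fA x))
    (fun x => div_nonneg (g0 x) B0.le) (fun x => (div_le_one B0).2 (gB x))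
    (fun x => div_nonneg (h0 x) D0.le)
    (fun t ht => by
      obtain ⟨_, ⟨x, rfl⟩, hx⟩ := exists_lt_of_lt_csSup (s := Set.range f) (b := t * A)
        (Set.range_nonempty f) (by rw [← hA]; nlinarith)
      exact ⟨x, (lt_div_iff₀ A0).2 hx⟩)
    (fun t ht => by
      obtain ⟨_, ⟨x, rfl⟩, hx⟩ := exists_lt_of_lt_csSup (s := Set.range g) (b := t * B)
        (Set.range_nonempty g) (by rw [← hB]; nlinarith)
      exact ⟨x, (lt_div_iff₀ B0).2 hx⟩) hl hm hlm
    (fun x y => by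
      rw [Real.div_rpow (f0 x) A0.le, Real.div_rpow (g0 y) B0.le, div_mul_div_comm]
      exact div_le_div_of_nonneg_right (hyp x y) D0.le)
  rw [← ofReal_integral_eq_lintegral_ofReal (hf.div_const _)
      (Eventually.of_forall fun x => div_nonneg (f0 x) A0.le),
    ← ofReal_integral_eq_lintegral_ofReal (hg.div_const _)
      (Eventually.of_forall fun x => div_nonneg (g0 x) B0.le),
    ← ofReal_integral_eq_lintegral_ofReal (hh.div_const _)
      (Eventually.of_forall fun x => div_nonneg (h0 x) D0.le),
    integral_div, integral_div, integral_div, ← ENNReal.ofReal_mul hl.le, ← ENNReal.ofReal_mul hm.le,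
    ← ENNReal.ofReal_add (by positivity) (by positivity),
    ENNReal.ofReal_le_ofReal_iff (by positivity)] at key
  have am := Real.geom_mean_le_arith_mean2_weighted hl.le hm.le (div_nonneg If A0.le)
    (div_nonneg Ig B0.le) hlm
  have := am.trans key
  rw [Real.div_rpow If A0.le, Real.div_rpow Ig B0.le, div_mul_div_comm,
    div_le_div_iff_of_pos_right D0] at this
  exact this

/-- log-concavity -/
def LC {V : Type*} [AddCommGroup V] [Module ℝ V] (F : V → ℝ) : Prop :=
  ∀ (v w : V) (l m : ℝ), 0 < l → 0 < m → l + m = 1 → F v ^ l * F w ^ m ≤ F (l • v + m • w)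

lemma pdf_lc (x y : ℝ) {l m : ℝ} (hl : 0 < l) (hm : 0 < m) (hlm : l + m = 1) :
    gaussianPDFReal 0 1 x ^ l * gaussianPDFReal 0 1 y ^ m ≤ gaussianPDFReal 0 1 (l * x + m * y) := by
  simp only [gaussianPDFReal_def, NNReal.coe_one, mul_one, sub_zero]
  have hc : (0:ℝ) < (√(2 * Real.pi))⁻¹ := by positivity
  rw [Real.mul_rpow hc.le (Real.exp_pos _).le, Real.mul_rpow hc.le (Real.exp_pos _).le,
    ← Real.exp_mul, ← Real.exp_mul, mul_mul_mul_comm, ← Real.rpow_add hc, hlm, Real.rpow_one,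
    ← Real.exp_add]
  gcongr
  have : m = 1 - l := by linarith
  subst this
  nlinarith [mul_nonneg (mul_nonneg hl.le hm.le) (sq_nonneg (x - y))]

lemma LC_int {V : Type*} [AddCommGroup V] [Module ℝ V] {F : V × ℝ → ℝ} (hF : LC F)
    (F0 : ∀ p, 0 ≤ F p) (F1 : ∀ p, F p ≤ 1) (mF : ∀ v, Measurable fun x => F (v, x)) :
    LC fun v => ∫ x, F (v, x) ∂(gaussianReal 0 1) := by
  intro v w l m hl hm hlm
  simp only [integral_gaussianReal_eq_integral_smul (one_ne_zero), smul_eq_mul]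
  have hp : ∀ v, Integrable fun x => gaussianPDFReal 0 1 x * F (v, x) := by
    intro v
    refine (integrable_gaussianPDFReal 0 1).mul_bdd (c := 1) (mF v).aestronglyMeasurable ?_
    exact Eventually.of_forall fun x => by rw [Real.norm_of_nonneg (F0 _)]; exact F1 _
  have hb : ∀ v, BddAbove (Set.range fun x => gaussianPDFReal 0 1 x * F (v, x)) := by
    intro v
    refine ⟨(√(2 * Real.pi))⁻¹, ?_⟩
    rintro _ ⟨x, rfl⟩
    have : gaussianPDFReal 0 1 x ≤ (√(2 * Real.pi))⁻¹ := by
      simp only [gaussianPDFReal_def, NNReal.coe_one, mul_one, sub_zero]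
      apply mul_le_of_le_one_right (by positivity)
      rw [Real.exp_le_one_iff]
      have := sq_nonneg x; linarith
    calc _ ≤ gaussianPDFReal 0 1 x * 1 :=
          mul_le_mul_of_nonneg_left (F1 _) (gaussianPDFReal_nonneg _ _ _)
      _ ≤ _ := by simpa using this
  have hn : ∀ v x, 0 ≤ gaussianPDFReal 0 1 x * F (v, x) := fun v x =>
    mul_nonneg (gaussianPDFReal_nonneg _ _ _) (F0 _)
  have hmm : ∀ v, Measurable fun x => gaussianPDFReal 0 1 x * F (v, x) := fun v =>
    (measurable_gaussianPDFReal 0 1).mul (mF v)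
  refine pl_one (hp v) (hp w) (hp _) (hmm v) (hmm w) (hmm _) (hn v) (hn w) (hn _) (hb v) (hb w)
    hl hm hlm ?_
  intro x y
  rw [Real.mul_rpow (gaussianPDFReal_nonneg _ _ _) (F0 _),
    Real.mul_rpow (gaussianPDFReal_nonneg _ _ _) (F0 _), mul_mul_mul_comm]
  have := hF (v, x) (w, y) l m hl hm hlm
  simp only [Prod.smul_mk, Prod.mk_add_mk, smul_eq_mul] at this
  exact mul_le_mul (pdf_lc x y hl hm hlm) this (mul_nonneg (Real.rpow_nonneg (F0 _) _)
    (Real.rpow_nonneg (F0 _) _)) (gaussianPDFReal_nonneg _ _ _)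

/-- standard Gaussian on `Fin n → ℝ` -/
noncomputable abbrev gam (n : ℕ) : Measure (Fin n → ℝ) := Measure.pi fun _ => gaussianReal 0 1

lemma LC_pi (n : ℕ) : ∀ {V : Type} [AddCommGroup V] [Module ℝ V] [MeasurableSpace V]
    {F : V × (Fin n → ℝ) → ℝ} (_ : LC F)
    (_ : ∀ p, 0 ≤ F p) (_ : ∀ p, F p ≤ 1) (_ : Measurable F),
    LC fun v => ∫ x, F (v, x) ∂(gam n) := by
  induction n with
  | zero =>
    intro V _ _ _ F hF F0 F1 mF v w l m hl hm hlm
    rw [gam, Measure.pi_of_empty (x := isEmptyElim)]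
    simp only [integral_dirac]
    have := hF (v, isEmptyElim) (w, isEmptyElim) l m hl hm hlm
    convert! this using 2
    simp only [Prod.smul_mk, Prod.mk_add_mk, Prod.mk.injEq, true_and]
    exact Subsingleton.elim _ _
  | succ n ih =>
    intro V _ _ _ F hF F0 F1 mF
    let F' : (V × ℝ) × (Fin n → ℝ) → ℝ := fun p => F (p.1.1, Fin.cons p.1.2 p.2)
    have mcons : Measurable fun p : ℝ × (Fin n → ℝ) => (Fin.cons p.1 p.2 : Fin (n+1) → ℝ) := by
      rw [measurable_pi_iff]
      intro i
      refine Fin.cases ?_ (fun j => ?_) i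
      · simpa using measurable_fst
      · simp only [Fin.cons_succ]; fun_prop
    have mF' : Measurable F' := by
      refine mF.comp (Measurable.prodMk (by fun_prop) ?_)
      exact mcons.comp (f := fun p : (V × ℝ) × (Fin n → ℝ) => (p.1.2, p.2)) (by fun_prop)
    have h1 := ih (F := F') (by
      rintro ⟨⟨v, x⟩, g⟩ ⟨⟨w, y⟩, g'⟩ l m hl hm hlm
      have := hF (v, Fin.cons x g) (w, Fin.cons y g') l m hl hm hlm
      refine this.trans (le_of_eq ?_)
      simp only [F', Prod.smul_mk, Prod.mk_add_mk]
      congr 2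
      ext i
      refine Fin.cases ?_ (fun j => ?_) i <;> simp) (fun _ => F0 _) (fun _ => F1 _) mF'
    have h2 := LC_int h1 (fun _ => integral_nonneg fun _ => F0 _) (fun p => by
        refine (integral_mono_of_nonneg (Eventually.of_forall fun _ => F0 _) (integrable_const 1)
          (Eventually.of_forall fun _ => F1 _)).trans ?_
        simp) (fun v => by
        have : StronglyMeasurable fun x : ℝ => ∫ g, F' ((v, x), g) ∂(gam n) := by
          refine StronglyMeasurable.integral_prod_right' (f := fun p : ℝ × (Fin n → ℝ) => F' ((v, p.1), p.2)) ?_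
          exact (mF'.comp (by fun_prop)).stronglyMeasurable
        exact this.measurable)
    convert! h2 using 2 with v
    have mp := (measurePreserving_piFinSuccAbove (fun _ : Fin (n+1) => gaussianReal 0 1) 0).symm
    rw [← mp.integral_comp (MeasurableEquiv.measurableEmbedding _)]
    rw [integral_prod]
    · simp [F', gam, MeasurableEquiv.piFinSuccAbove, Fin.insertNthEquiv]
    · refine Integrable.of_bound (C := 1) ?_ (Eventually.of_forall fun x => ?_)
      · refine (Measurable.comp (g := F) mF (Measurable.prodMk measurable_const ?_)).aestronglyMeasurable
        exact MeasurableEquiv.measurable _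
      · rw [Real.norm_of_nonneg (F0 _)]; exact F1 _

lemma LC_even_anti {f : ℝ → ℝ} (hf : LC f) (f0 : ∀ x, 0 ≤ f x) (ev : ∀ x, f (-x) = f x) {x y : ℝ}
    (h : |x| ≤ |y|) : f y ≤ f x := by
  wlog hy : 0 ≤ y generalizing y
  · have := this (y := -y) (by simpa using h) (by linarith)
    rwa [ev] at this
  rw [abs_of_nonneg hy, abs_le] at h
  rcases h.2.eq_or_lt with h1 | h1
  · rw [h1]
  rcases h.1.eq_or_lt with h2 | h2
  · rw [← h2, ev]
  have y0 : 0 < y := by linarith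
  have := hf y (-y) ((1 + x / y) / 2) ((1 - x / y) / 2)
    (by have : -1 < x / y := by rw [lt_div_iff₀ y0]; linarith
        linarith)
    (by have : x / y < 1 := by rw [div_lt_one y0]; linarith
        linarith) (by ring)
  rw [ev] at this
  rcases (f0 y).eq_or_lt with h3 | h3
  · rw [← h3]; exact f0 x
  rw [← Real.rpow_add h3] at this
  convert this using 1
  · rw [show (1 + x / y) / 2 + (1 - x / y) / 2 = 1 by ring, Real.rpow_one]
  · congr 1; simp only [smul_eq_mul]; field_simp; ring

end BifChung

namespace BifChung

/-- quadratic form -/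
noncomputable def qf {ι : Type*} [Fintype ι] (C : ι → ι → ℝ) (a : ι → ℝ) : ℝ :=
  ∑ i, ∑ j, a i * a j * C i j

/-- Gaussian vector via characteristic functions -/
def IsGV {Ω : Type*} [MeasurableSpace Ω] (μ : Measure Ω) {ι : Type*} [Fintype ι]
    (Y : ι → Ω → ℝ) (C : ι → ι → ℝ) : Prop :=
  (∀ i, Measurable (Y i)) ∧ (∀ i j, C i j = C j i) ∧
  ∀ a : ι → ℝ, ∫ ω, Complex.exp (((∑ i, a i * Y i ω : ℝ) : ℂ) * Complex.I) ∂μ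
    = ((Real.exp (-(qf C a) / 2) : ℝ) : ℂ)

lemma ext_cf {ι : Type*} [Fintype ι] {P Q : Measure (ι → ℝ)} [IsFiniteMeasure P] [IsFiniteMeasure Q]
    (h : ∀ a : ι → ℝ, ∫ x, Complex.exp (((∑ i, a i * x i : ℝ) : ℂ) * Complex.I) ∂P
      = ∫ x, Complex.exp (((∑ i, a i * x i : ℝ) : ℂ) * Complex.I) ∂Q) : P = Q := by
  classical
  apply Measure.ext_of_charFunDual
  ext L
  rw [charFunDual_apply, charFunDual_apply]
  have key : ∀ v : ι → ℝ, L v = ∑ i, L (Pi.single i 1) * v i := by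
    intro v
    conv_lhs => rw [← Finset.univ_sum_single v, map_sum]
    refine Finset.sum_congr rfl fun i _ => ?_
    rw [show Pi.single i (v i) = v i • (Pi.single i (1:ℝ) : ι → ℝ) by
      rw [← Pi.single_smul, smul_eq_mul, mul_one], map_smul, smul_eq_mul, mul_comm]
  have h1 := h fun i => L (Pi.single i 1)
  rw [integral_congr_ae (ae_of_all _ fun v => by rw [key v]), h1]
  exact integral_congr_ae (ae_of_all _ fun v => by beta_reduce; rw [key v])

variable {Ω Ω' : Type*} [MeasurableSpace Ω] [MeasurableSpace Ω'] {μ : Measure Ω} {μ' : Measure Ω'}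
  {ι κ : Type*} [Fintype ι] [Fintype κ]

lemma IsGV.meas {Y : ι → Ω → ℝ} {C : ι → ι → ℝ} (h : IsGV μ Y C) :
    Measurable fun ω i => Y i ω := measurable_pi_lambda _ h.1

lemma IsGV.law [IsFiniteMeasure μ] [IsFiniteMeasure μ'] {Y : ι → Ω → ℝ} {Y' : ι → Ω' → ℝ}
    {C : ι → ι → ℝ} (h : IsGV μ Y C) (h' : IsGV μ' Y' C) :
    μ.map (fun ω i => Y i ω) = μ'.map (fun ω i => Y' i ω) := by
  apply ext_cf
  intro a
  rw [integral_map h.meas.aemeasurable, integral_map h'.meas.aemeasurable, h.2.2, h'.2.2]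
  all_goals
    refine Continuous.aestronglyMeasurable ?_
    fun_prop

lemma IsGV.prob [IsFiniteMeasure μ] [IsFiniteMeasure μ'] {Y : ι → Ω → ℝ} {Y' : ι → Ω' → ℝ}
    {C : ι → ι → ℝ} (h : IsGV μ Y C) (h' : IsGV μ' Y' C) {S : Set (ι → ℝ)} (hS : MeasurableSet S) :
    μ.real {ω | (fun i => Y i ω) ∈ S} = μ'.real {ω | (fun i => Y' i ω) ∈ S} := by
  have := congrArg (fun m => m.real S) (h.law h')
  simp only [map_measureReal_apply h.meas hS, map_measureReal_apply h'.meas hS] at this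
  exact this

lemma IsGV.nonneg [IsProbabilityMeasure μ] {Y : ι → Ω → ℝ} {C : ι → ι → ℝ} (h : IsGV μ Y C)
    (a : ι → ℝ) : 0 ≤ qf C a := by
  have h1 := h.2.2 a
  have h2 : ‖∫ ω, Complex.exp (((∑ i, a i * Y i ω : ℝ) : ℂ) * Complex.I) ∂μ‖ ≤ 1 := by
    refine (norm_integral_le_of_norm_le_const (C := 1) (ae_of_all _ fun ω => ?_)).trans (by simp)
    rw [Complex.norm_exp_ofReal_mul_I]
  rw [h1, Complex.norm_real, Real.norm_of_nonneg (Real.exp_pos _).le, Real.exp_le_one_iff] at h2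
  linarith

lemma qf_lin (C : ι → ι → ℝ) (L : κ → ι → ℝ) (a : κ → ℝ) :
    qf (fun k l => ∑ i, ∑ j, L k i * L l j * C i j) a = qf C (fun i => ∑ k, a k * L k i) := by
  simp only [qf, Finset.mul_sum, Finset.sum_mul]
  rw [Finset.sum_congr rfl fun k _ => Finset.sum_comm]
  rw [Finset.sum_comm]
  refine Finset.sum_congr rfl fun i _ => ?_
  rw [Finset.sum_congr rfl fun k _ => Finset.sum_comm]
  rw [Finset.sum_comm]
  refine Finset.sum_congr rfl fun j _ => ?_
  rw [Finset.sum_comm]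
  refine Finset.sum_congr rfl fun k _ => Finset.sum_congr rfl fun l _ => ?_
  ring

lemma IsGV.lin {Y : ι → Ω → ℝ} {C : ι → ι → ℝ} (h : IsGV μ Y C) (L : κ → ι → ℝ) :
    IsGV μ (fun k ω => ∑ i, L k i * Y i ω) (fun k l => ∑ i, ∑ j, L k i * L l j * C i j) := by
  refine ⟨fun k => ?_, fun k l => ?_, fun a => ?_⟩
  · exact Finset.measurable_sum _ fun i _ => (h.1 i).const_mul _
  · beta_reduce
    rw [Finset.sum_comm]
    refine Finset.sum_congr rfl fun i _ => Finset.sum_congr rfl fun j _ => ?_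
    rw [h.2.1 i j]; ring
  · rw [qf_lin, ← h.2.2]
    congr 1 with ω
    congr 3
    simp only [Finset.mul_sum, Finset.sum_mul]
    rw [Finset.sum_comm]
    exact Finset.sum_congr rfl fun i _ => Finset.sum_congr rfl fun j _ => by ring

lemma IsGV.congrC {Y : ι → Ω → ℝ} {C C' : ι → ι → ℝ} (h : IsGV μ Y C) (e : ∀ i j, C i j = C' i j) :
    IsGV μ Y C' := by
  have : C = C' := by ext i j; exact e i j
  exact this ▸ h

lemma IsGV.reindex {Y : ι → Ω → ℝ} {C : ι → ι → ℝ} (h : IsGV μ Y C) (f : κ → ι) :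
    IsGV μ (fun k => Y (f k)) (fun k l => C (f k) (f l)) := by
  classical
  have := h.lin (fun k i => if i = f k then (1:ℝ) else 0)
  simpa using this

lemma IsGV.marg [IsProbabilityMeasure μ] {Y : ι → Ω → ℝ} {C : ι → ι → ℝ} (h : IsGV μ Y C) (i : ι) :
    μ.map (Y i) = gaussianReal 0 (Real.toNNReal (C i i)) ∧ 0 ≤ C i i := by
  classical
  have hq : ∀ t : ℝ, qf C (Pi.single i t) = t ^ 2 * C i i := by
    intro t
    rw [qf, Finset.sum_eq_single i, Finset.sum_eq_single i]
    · rw [Pi.single_eq_same]; ring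
    · intro j _ hj; simp [hj]
    · simp
    · intro j _ hj; simp [hj]
    · simp
  have h0 : 0 ≤ C i i := by have := h.nonneg (Pi.single i 1); rw [hq] at this; simpa using this
  refine ⟨?_, h0⟩
  have : IsProbabilityMeasure (μ.map (Y i)) := Measure.isProbabilityMeasure_map (h.1 i).aemeasurable
  apply Measure.ext_of_charFun
  ext t
  rw [charFun_gaussianReal, charFun_apply_real, integral_map (h.1 i).aemeasurable]
  · have := h.2.2 (Pi.single i t)
    rw [hq] at this
    have e : ∀ ω, ∑ j, (Pi.single i t : ι → ℝ) j * Y j ω = t * Y i ω := by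
      intro ω
      rw [Finset.sum_eq_single i] <;> simp +contextual
    simp only [e] at this
    push_cast at this
    rw [this, Real.coe_toNNReal _ h0]
    congr 1
    simp; ring
  · exact Continuous.aestronglyMeasurable (by fun_prop)

lemma exp_integrable [IsFiniteMeasure μ] {f : Ω → ℝ} (hf : Measurable f) :
    Integrable (fun ω => Complex.exp ((f ω : ℂ) * Complex.I)) μ := by
  refine Integrable.of_bound (C := 1) ?_ (ae_of_all _ fun ω => ?_)
  · exact (Complex.measurable_exp.comp ((Complex.measurable_ofReal.comp hf).mul_const _)).aestronglyMeasurable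
  · rw [Complex.norm_exp_ofReal_mul_I]

lemma qf_add (C C' : ι → ι → ℝ) (a : ι → ℝ) :
    qf (fun i j => C i j + C' i j) a = qf C a + qf C' a := by
  simp only [qf, mul_add, Finset.sum_add_distrib]

lemma IsGV.prodAdd [IsProbabilityMeasure μ] [IsProbabilityMeasure μ'] {Y : ι → Ω → ℝ}
    {Y' : ι → Ω' → ℝ} {C C' : ι → ι → ℝ} (h : IsGV μ Y C) (h' : IsGV μ' Y' C') :
    IsGV (μ.prod μ') (fun i p => Y i p.1 + Y' i p.2) (fun i j => C i j + C' i j) := by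
  refine ⟨fun i => ((h.1 i).comp measurable_fst).add ((h'.1 i).comp measurable_snd),
    fun i j => by beta_reduce; rw [h.2.1, h'.2.1], fun a => ?_⟩
  have e : ∀ p : Ω × Ω', Complex.exp (((∑ i, a i * (Y i p.1 + Y' i p.2) : ℝ) : ℂ) * Complex.I)
    = Complex.exp (((∑ i, a i * Y i p.1 : ℝ) : ℂ) * Complex.I) *
      Complex.exp (((∑ i, a i * Y' i p.2 : ℝ) : ℂ) * Complex.I) := by
    intro p
    rw [← Complex.exp_add]
    congr 1
    simp only [mul_add, Finset.sum_add_distrib]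
    push_cast
    ring
  simp only [e]
  rw [integral_prod_mul (fun ω => Complex.exp (((∑ i, a i * Y i ω : ℝ) : ℂ) * Complex.I))
    (fun ω => Complex.exp (((∑ i, a i * Y' i ω : ℝ) : ℂ) * Complex.I)), h.2.2, h'.2.2,
    qf_add, ← Complex.ofReal_mul, ← Real.exp_add]
  congr 2
  ring

lemma isGV_pi [DecidableEq ι] : IsGV (Measure.pi fun _ : ι => gaussianReal 0 1) (fun i x => x i)
    (fun i j => if i = j then 1 else 0) := by
  refine ⟨fun i => measurable_pi_apply i, fun i j => by simp [eq_comm], fun a => ?_⟩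
  have e : ∀ x : ι → ℝ, Complex.exp (((∑ i, a i * x i : ℝ) : ℂ) * Complex.I)
      = ∏ i, Complex.exp (((a i * x i : ℝ) : ℂ) * Complex.I) := by
    intro x
    rw [← Complex.exp_sum]
    congr 1
    push_cast
    rw [Finset.sum_mul]
  simp only [e]
  rw [integral_fintype_prod_eq_prod (fun i x => Complex.exp (((a i * x : ℝ) : ℂ) * Complex.I))]
  have e2 : ∀ i, ∫ x, Complex.exp (((a i * x : ℝ) : ℂ) * Complex.I) ∂(gaussianReal 0 1)
     = Complex.exp (-(a i)^2/2) := by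
    intro i
    have := charFun_gaussianReal (μ := 0) (v := 1) (a i)
    rw [charFun_apply_real] at this
    push_cast
    rw [this]
    congr 1
    simp
    ring
  simp only [e2]
  rw [← Complex.exp_sum]
  push_cast
  congr 1
  simp [qf, Finset.sum_div, Finset.sum_neg_distrib, sq, neg_div]

end BifChung

namespace BifChung

section
open scoped MatrixOrder
lemma psd_decomp {ι : Type*} [Fintype ι] {C : ι → ι → ℝ} (hs : ∀ i j, C i j = C j i)
    (hC : ∀ a, 0 ≤ qf C a) : ∃ B : ι → Fin (Fintype.card ι) → ℝ, ∀ i j, C i j = ∑ k, B i k * B j k := by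
  classical
  have hP : (Matrix.of C).PosSemidef := by
    rw [Matrix.posSemidef_iff_dotProduct_mulVec]
    refine ⟨?_, fun x => ?_⟩
    · ext i j
      simp [Matrix.conjTranspose_apply, hs i j]
    · have := hC x
      simp only [qf] at this
      simp only [dotProduct, Matrix.mulVec, Matrix.of_apply, Finset.mul_sum, Pi.star_apply, star_trivial]
      refine this.trans_eq (Finset.sum_congr rfl fun i _ => Finset.sum_congr rfl fun j _ => by ring)
  obtain ⟨B, hB⟩ := CStarAlgebra.nonneg_iff_eq_star_mul_self.mp hP.nonneg
  refine ⟨fun i k => B ((Fintype.equivFin ι).symm k) i, fun i j => ?_⟩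
  have := congrFun (congrFun hB i) j
  simp only [Matrix.of_apply, Matrix.mul_apply, Matrix.star_apply, star_trivial] at this
  rw [this]
  exact ((Fintype.equivFin ι).symm.sum_comp (fun k => B k i * B k j)).symm
end

variable {Ω : Type*} [MeasurableSpace Ω] {μ : Measure Ω} [IsProbabilityMeasure μ]
  {ι : Type*} [Fintype ι]

lemma isGV_one (c : ι → ℝ) : IsGV (gaussianReal 0 1) (fun i x => c i * x) (fun i j => c i * c j) := by
  refine ⟨fun i => measurable_id.const_mul _, fun i j => mul_comm _ _, fun a => ?_⟩
  have := charFun_gaussianReal (μ := 0) (v := 1) (∑ i, a i * c i)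
  rw [charFun_apply_real] at this
  have e : ∀ x : ℝ, ((∑ i, a i * (c i * x) : ℝ) : ℂ) = ((∑ i, a i * c i : ℝ) : ℂ) * (x : ℂ) := by
    intro x
    push_cast
    rw [Finset.sum_mul]
    exact Finset.sum_congr rfl fun i _ => by ring
  simp only [e]
  rw [this]
  push_cast
  congr 1
  have : qf (fun i j => c i * c j) a = (∑ i, a i * c i) ^ 2 := by
    rw [qf, sq, Finset.sum_mul_sum]
    exact Finset.sum_congr rfl fun i _ => Finset.sum_congr rfl fun j _ => by ring
  rw [this]
  push_cast
  ring

lemma LC_indicator {V : Type*} [AddCommGroup V] [Module ℝ V] {S : Set V} (hS : Convex ℝ S) :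
    LC (S.indicator fun _ => (1:ℝ)) := by
  intro v w l m hl hm hlm
  by_cases hv : v ∈ S
  · by_cases hw : w ∈ S
    · rw [Set.indicator_of_mem hv, Set.indicator_of_mem hw,
        Set.indicator_of_mem (hS hv hw hl.le hm.le hlm)]
      simp
    · rw [Set.indicator_of_notMem hw, Real.zero_rpow hm.ne', mul_zero]
      exact Set.indicator_nonneg (fun _ _ => zero_le_one) _
  · rw [Set.indicator_of_notMem hv, Real.zero_rpow hl.ne', zero_mul]
    exact Set.indicator_nonneg (fun _ _ => zero_le_one) _

lemma sidak_step {Y : ι → Ω → ℝ} {C : ι → ι → ℝ} (h : IsGV μ Y C) (i0 : ι) (a : ℝ) (b : ι → ℝ)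
    (s : Finset ι) :
    μ.real {ω | |Y i0 ω| ≤ a} * μ.real {ω | ∀ i ∈ s, |Y i ω| ≤ b i} ≤
      μ.real {ω | |Y i0 ω| ≤ a ∧ ∀ i ∈ s, |Y i ω| ≤ b i} := by
  classical
  set v := C i0 i0 with hv
  have v0 : 0 ≤ v := (h.marg i0).2
  set C' : ι → ι → ℝ := fun k l => C k l - C i0 k * C i0 l / v with hC'
  have hlin := h.lin (fun k i => (if i = k then (1:ℝ) else 0) - C i0 k / v * (if i = i0 then 1 else 0))
  have hcov : ∀ k l, (∑ i, ∑ j, ((if i = k then (1:ℝ) else 0) - C i0 k / v * (if i = i0 then 1 else 0))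
      * ((if j = l then (1:ℝ) else 0) - C i0 l / v * (if j = i0 then 1 else 0)) * C i j) = C' k l := by
    intro k l
    simp only [mul_sub, sub_mul, Finset.sum_sub_distrib, ite_mul, mul_ite, mul_one, mul_zero,
      one_mul, zero_mul, Finset.sum_ite_eq', Finset.mem_univ, if_true]
    rw [h.2.1 k i0, hC', ← hv]
    rcases eq_or_ne v 0 with h0 | h0
    · simp [h0]
    · field_simp
      ring
  have hlin' := hlin.congrC hcov
  obtain ⟨n, B, hB⟩ : ∃ (n : ℕ) (B : ι → Fin n → ℝ), ∀ i j, C' i j = ∑ k, B i k * B j k :=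
    ⟨_, psd_decomp hlin'.2.1 hlin'.nonneg⟩
  set c : ι → ℝ := fun i => C i0 i / v * √v with hc
  have hcc : ∀ i j, c i * c j + C' i j = C i j := by
    intro i j
    rcases eq_or_ne v 0 with h0 | h0
    · simp [hc, hC', h0]
    · have := Real.mul_self_sqrt v0
      simp only [hc, hC']
      field_simp
      rw [sq, this]
      ring
  have hrep : IsGV ((gaussianReal 0 1).prod (gam n)) (fun i p => c i * p.1 + ∑ k, B i k * p.2 k) C := by
    refine ((isGV_one c).prodAdd ((isGV_pi (ι := Fin n)).lin B)).congrC fun i j => ?_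
    rw [← hcc, hB]
    simp
  have hc0 : c i0 = √v := by
    rcases eq_or_ne v 0 with h0 | h0
    · simp [hc, h0]
    · simp only [hc, ← hv]; field_simp
  have hB0 : ∀ k, B i0 k = 0 := by
    have h1 : C' i0 i0 = 0 := by
      rcases eq_or_ne v 0 with h0 | h0
      · simp [hC', ← hv, h0]
      · simp only [hC', ← hv]; field_simp; ring
    rw [hB, Finset.sum_eq_zero_iff_of_nonneg fun k _ => mul_self_nonneg _] at h1
    intro k
    exact mul_self_eq_zero.1 (h1 k (Finset.mem_univ _))
  set S : Set (ι → ℝ) := {y | ∀ i ∈ s, |y i| ≤ b i} with hS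
  have mS : MeasurableSet S := by
    have : S = ⋂ i ∈ s, {y | |y i| ≤ b i} := by ext; simp [hS]
    rw [this]
    exact Finset.measurableSet_biInter _ fun i _ => measurableSet_le (by fun_prop) (by fun_prop)
  have mT : MeasurableSet {y : ι → ℝ | |y i0| ≤ a} := measurableSet_le (by fun_prop) (by fun_prop)
  have e1 := h.prob hrep mS
  have e2 := h.prob hrep mT
  have e3 := h.prob hrep (mT.inter mS)
  change μ.real {ω | |Y i0 ω| ≤ a} = _ at e2
  change μ.real {ω | ∀ i ∈ s, |Y i ω| ≤ b i} = _ at e1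
  change μ.real {ω | |Y i0 ω| ≤ a ∧ ∀ i ∈ s, |Y i ω| ≤ b i} = _ at e3
  rw [e1, e2, e3]
  set P := (gaussianReal 0 1).prod (gam n)
  -- the function f
  set S' : Set (ℝ × (Fin n → ℝ)) := {p | (fun i => c i * p.1 + ∑ k, B i k * p.2 k) ∈ S} with hS'
  have mS' : MeasurableSet S' := hrep.meas mS
  have cS' : Convex ℝ S' := by
    intro p hp q hq l m hl hm hlm i hi
    have h1 := abs_le.1 (hp i hi)
    have h2 := abs_le.1 (hq i hi)
    have e : c i * (l • p + m • q).1 + ∑ k, B i k * (l • p + m • q).2 k =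
      l * (c i * p.1 + ∑ k, B i k * p.2 k) + m * (c i * q.1 + ∑ k, B i k * q.2 k) := by
      simp only [Prod.fst_add, Prod.smul_fst, smul_eq_mul, Prod.snd_add, Prod.smul_snd, Pi.add_apply,
        Pi.smul_apply, mul_add, Finset.sum_add_distrib, Finset.mul_sum]
      have e1 : ∀ x, B i x * (l * p.2 x) = l * (B i x * p.2 x) := fun x => by ring
      have e2 : ∀ x, B i x * (m * q.2 x) = m * (B i x * q.2 x) := fun x => by ring
      simp only [e1, e2]
      ring
    beta_reduce
    rw [e, abs_le]
    have hb : l * b i + m * b i = b i := by rw [← add_mul, hlm, one_mul]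
    constructor
    · nlinarith [mul_le_mul_of_nonneg_left h1.1 hl, mul_le_mul_of_nonneg_left h2.1 hm]
    · nlinarith [mul_le_mul_of_nonneg_left h1.2 hl, mul_le_mul_of_nonneg_left h2.2 hm]
  set F : ℝ × (Fin n → ℝ) → ℝ := S'.indicator fun _ => 1 with hF
  have F0 : ∀ p, 0 ≤ F p := fun p => Set.indicator_nonneg (fun _ _ => zero_le_one) _
  have F1 : ∀ p, F p ≤ 1 := fun p => Set.indicator_le_self' (fun _ _ => zero_le_one) _
  have mF : Measurable F := measurable_const.indicator mS'
  have LCf := LC_pi n (LC_indicator cS') F0 F1 mF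
  set f : ℝ → ℝ := fun ζ => ∫ x, F (ζ, x) ∂(gam n) with hf
  have f0 : ∀ x, 0 ≤ f x := fun x => integral_nonneg fun _ => F0 _
  have f1 : ∀ x, f x ≤ 1 := by
    intro x
    have : f x ≤ ∫ _, (1:ℝ) ∂(gam n) := by
      refine integral_mono_of_nonneg (ae_of_all _ fun _ => F0 _) (integrable_const _) (ae_of_all _ fun _ => F1 _)
    simpa using this
  have mf : Measurable f := by
    have : StronglyMeasurable f := mF.stronglyMeasurable.integral_prod_right'
    exact this.measurable
  have hneg : (gam n).map (fun x => -x) = gam n := by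
    apply ext_cf
    intro a
    rw [integral_map (by fun_prop) (Continuous.aestronglyMeasurable (by fun_prop))]
    have h1 := (isGV_pi (ι := Fin n)).2.2 a
    have h2 := (isGV_pi (ι := Fin n)).2.2 (-a)
    rw [h1]
    simp only [Pi.neg_apply, neg_mul, mul_neg] at h2 ⊢
    rw [h2]
    simp [qf]
  have ev : ∀ x, f (-x) = f x := by
    intro x
    change ∫ y, F (-x, y) ∂(gam n) = ∫ y, F (x, y) ∂(gam n)
    conv_lhs => rw [← hneg]
    have mm : Measurable fun y => F (-x, y) := mF.comp (by fun_prop : Measurable fun y : Fin n → ℝ => ((-x : ℝ), y))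
    rw [integral_map measurable_neg.aemeasurable mm.aestronglyMeasurable]
    congr 1 with y
    have : ((-x, -y) ∈ S') ↔ ((x, y) ∈ S') := by
      simp only [hS', hS, Set.mem_ofPred_eq, Pi.neg_apply, mul_neg, Finset.sum_neg_distrib, ← neg_add, abs_neg]
    by_cases q : (x, y) ∈ S'
    · rw [hF, Set.indicator_of_mem q, Set.indicator_of_mem (this.2 q)]
    · rw [hF, Set.indicator_of_notMem q, Set.indicator_of_notMem (fun h => q (this.1 h))]
  have anti : ∀ x y, |x| ≤ |y| → f y ≤ f x := fun x y hxy => LC_even_anti LCf f0 ev hxy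
  set T : Set ℝ := {ζ | |√v * ζ| ≤ a} with hT
  have mTT : MeasurableSet T := measurableSet_le (by fun_prop) (by fun_prop)
  have hY0 : ∀ p : ℝ × (Fin n → ℝ), c i0 * p.1 + ∑ k, B i0 k * p.2 k = √v * p.1 := by
    intro p; simp [hB0, hc0]
  have g1 : P.real {ω | (fun i => c i * ω.1 + ∑ k, B i k * ω.2 k) ∈ S} = ∫ ζ, f ζ ∂(gaussianReal 0 1) := by
    change P.real S' = _
    rw [← integral_indicator_one mS']
    exact integral_prod F (Integrable.of_bound (C := 1) mF.aestronglyMeasurable (ae_of_all _ fun p => by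
      rw [Real.norm_of_nonneg (F0 p)]; exact F1 p))
  have g2 : P.real {ω | (fun i => c i * ω.1 + ∑ k, B i k * ω.2 k) ∈ {y : ι → ℝ | |y i0| ≤ a}}
      = (gaussianReal 0 1).real T := by
    have : {ω : ℝ × (Fin n → ℝ) | (fun i => c i * ω.1 + ∑ k, B i k * ω.2 k) ∈ {y : ι → ℝ | |y i0| ≤ a}}
      = T ×ˢ Set.univ := by
      ext p
      simp only [Set.mem_ofPred_eq, hY0, Set.mem_prod, Set.mem_univ, and_true, hT]
    rw [this, measureReal_prod_prod]
    simp
  have g3 : P.real {ω | (fun i => c i * ω.1 + ∑ k, B i k * ω.2 k) ∈ {y : ι → ℝ | |y i0| ≤ a} ∩ S}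
      = ∫ ζ, T.indicator f ζ ∂(gaussianReal 0 1) := by
    have : {ω : ℝ × (Fin n → ℝ) | (fun i => c i * ω.1 + ∑ k, B i k * ω.2 k) ∈ {y : ι → ℝ | |y i0| ≤ a} ∩ S}
      = (T ×ˢ Set.univ) ∩ S' := by
      ext p
      simp only [Set.mem_inter_iff, Set.mem_ofPred_eq, hY0, Set.mem_prod, Set.mem_univ, and_true, hT, hS']
    have mm : MeasurableSet ((T ×ˢ (Set.univ : Set (Fin n → ℝ))) ∩ S') := (mTT.prod MeasurableSet.univ).inter mS'
    rw [this, ← integral_indicator_one mm]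
    have ii : Integrable (((T ×ˢ (Set.univ : Set (Fin n → ℝ))) ∩ S').indicator (1 : ℝ × (Fin n → ℝ) → ℝ)) P :=
      (integrable_const (1:ℝ)).indicator mm
    rw [integral_prod _ ii]
    congr 1 with ζ
    by_cases hζ : ζ ∈ T
    · rw [Set.indicator_of_mem hζ]
      congr 1 with x
      simp [Set.indicator, hζ, hF]
    · rw [Set.indicator_of_notMem hζ]
      simp [Set.indicator, hζ]
  rw [g1, g2, g3]
  set p := (gaussianReal 0 1).real T
  have p0 : 0 ≤ p := measureReal_nonneg
  have p1 : p ≤ 1 := measureReal_le_one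
  have If : Integrable f (gaussianReal 0 1) := Integrable.of_bound (C := 1) mf.aestronglyMeasurable
    (ae_of_all _ fun x => by rw [Real.norm_of_nonneg (f0 x)]; exact f1 x)
  have hκ : ∃ κ, (∀ ζ ∈ T, κ ≤ f ζ) ∧ (∀ ζ, ζ ∉ T → f ζ ≤ κ) := by
    rcases lt_or_ge a 0 with ha | ha
    · refine ⟨1, fun ζ hζ => ?_, fun ζ _ => f1 _⟩
      have h1 : |√v * ζ| ≤ a := hζ
      exact absurd h1 (by have := abs_nonneg (√v * ζ); linarith)
    rcases v0.eq_or_lt with h0 | h0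
    · refine ⟨0, fun ζ _ => f0 _, fun ζ hζ => absurd ?_ hζ⟩
      simp [hT, ← h0, ha]
    · have sv : 0 < √v := Real.sqrt_pos.2 h0
      refine ⟨f (a / √v), fun ζ hζ => anti _ _ ?_, fun ζ hζ => anti _ _ ?_⟩
      · rw [abs_of_nonneg (div_nonneg ha sv.le), le_div_iff₀ sv]
        have : |√v * ζ| ≤ a := hζ
        rwa [abs_mul, abs_of_pos sv, mul_comm] at this
      · rw [abs_of_nonneg (div_nonneg ha sv.le), div_le_iff₀ sv]
        have : ¬ |√v * ζ| ≤ a := hζ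
        rw [abs_mul, abs_of_pos sv, mul_comm] at this
        linarith
  obtain ⟨κ, k1, k2⟩ := hκ
  have I1 : Integrable (T.indicator f) (gaussianReal 0 1) := If.indicator mTT
  have I2 : Integrable (T.indicator fun _ => (1:ℝ)) (gaussianReal 0 1) := (integrable_const _).indicator mTT
  have hp : ∫ ζ, (T.indicator fun _ => (1:ℝ)) ζ ∂(gaussianReal 0 1) = p := integral_indicator_one mTT
  have key : 0 ≤ ∫ ζ, (T.indicator f ζ - κ * T.indicator (fun _ => (1:ℝ)) ζ - (p * f ζ - p * κ)) ∂(gaussianReal 0 1) := by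
    refine integral_nonneg fun ζ => ?_
    change 0 ≤ T.indicator f ζ - κ * T.indicator (fun _ => (1:ℝ)) ζ - (p * f ζ - p * κ)
    by_cases hζ : ζ ∈ T
    · rw [Set.indicator_of_mem hζ, Set.indicator_of_mem hζ]
      nlinarith [mul_nonneg (sub_nonneg.2 p1) (sub_nonneg.2 (k1 ζ hζ))]
    · rw [Set.indicator_of_notMem hζ, Set.indicator_of_notMem hζ]
      nlinarith [mul_nonneg p0 (sub_nonneg.2 (k2 ζ hζ))]
  have I3 : Integrable (fun ζ => κ * T.indicator (fun _ => (1:ℝ)) ζ) (gaussianReal 0 1) := I2.const_mul κ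
  have I4 : Integrable (fun ζ => T.indicator f ζ - κ * T.indicator (fun _ => (1:ℝ)) ζ) (gaussianReal 0 1) :=
    I1.sub I3
  have I5 : Integrable (fun ζ => p * f ζ) (gaussianReal 0 1) := If.const_mul p
  have I6 : Integrable (fun ζ => p * f ζ - p * κ) (gaussianReal 0 1) := I5.sub (integrable_const _)
  rw [integral_sub I4 I6, integral_sub I1 I3, integral_sub I5 (integrable_const _),
    integral_const_mul, integral_const_mul, hp] at key
  simp only [integral_const, probReal_univ, smul_eq_mul, one_mul] at key
  linarith

lemma sidak {Y : ι → Ω → ℝ} {C : ι → ι → ℝ} (h : IsGV μ Y C) (b : ι → ℝ) (s : Finset ι) :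
    ∏ i ∈ s, μ.real {ω | |Y i ω| ≤ b i} ≤ μ.real {ω | ∀ i ∈ s, |Y i ω| ≤ b i} := by
  classical
  induction s using Finset.induction_on with
  | empty => simp
  | insert i s hi ih =>
    rw [Finset.prod_insert hi]
    refine (mul_le_mul_of_nonneg_left ih measureReal_nonneg).trans ((sidak_step h i (b i) b s).trans ?_)
    refine le_of_eq ?_
    congr 1 with ω
    simp
end BifChung

namespace BifChung

lemma R_symm (H K s t : ℝ) : Rbif H K s t = Rbif H K t s := by
  rw [Rbif, Rbif, abs_sub_comm, add_comm]

lemma R_nonneg {H K s t : ℝ} (hH : 0 < H) (hK : 0 < K) (hs : 0 ≤ s) (ht : 0 ≤ t) : 0 ≤ Rbif H K s t := by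
  refine mul_nonneg (Real.rpow_nonneg (by norm_num) _) (sub_nonneg.2 ?_)
  rw [Real.rpow_mul (abs_nonneg _)]
  refine Real.rpow_le_rpow (Real.rpow_nonneg (abs_nonneg _) _) ?_ hK.le
  have h1 : 0 ≤ t ^ (2 * H) := Real.rpow_nonneg ht _
  have h2 : 0 ≤ s ^ (2 * H) := Real.rpow_nonneg hs _
  rcases le_total s t with h | h
  · have : |t - s| ^ (2 * H) ≤ t ^ (2 * H) := Real.rpow_le_rpow (abs_nonneg _)
      (by rw [abs_of_nonneg] <;> linarith) (by linarith)
    linarith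
  · have : |t - s| ^ (2 * H) ≤ s ^ (2 * H) := Real.rpow_le_rpow (abs_nonneg _)
      (by rw [abs_of_nonpos] <;> linarith) (by linarith)
    linarith

lemma R_diag {H K t : ℝ} (hH : 0 < H) (hK : 0 < K) (ht : 0 ≤ t) : Rbif H K t t = t ^ (2 * H * K) := by
  have h1 : 0 ≤ t ^ (2 * H) := Real.rpow_nonneg ht _
  rw [Rbif, sub_self, abs_zero, Real.zero_rpow (by positivity), sub_zero, ← two_mul,
    Real.mul_rpow (by norm_num) h1, ← mul_assoc, ← Real.rpow_add (by norm_num), Real.rpow_mul ht (2 * H) K,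
    neg_add_cancel, Real.rpow_zero, one_mul]

lemma R_scale {H K a s t : ℝ} (ha : 0 < a) (hs : 0 ≤ s) (ht : 0 ≤ t) :
    Rbif H K (a * s) (a * t) = a ^ (2 * H * K) * Rbif H K s t := by
  have h1 : 0 ≤ t ^ (2 * H) := Real.rpow_nonneg ht _
  have h2 : 0 ≤ s ^ (2 * H) := Real.rpow_nonneg hs _
  rw [Rbif, Rbif, Real.mul_rpow ha.le ht, Real.mul_rpow ha.le hs, ← mul_add, ← mul_sub, abs_mul,
    abs_of_pos ha, Real.mul_rpow ha.le (abs_nonneg _), Real.mul_rpow (Real.rpow_nonneg ha.le _) (by positivity),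
    ← Real.rpow_mul ha.le]
  ring

/-- a measurable version of the process -/
def IsX {Ω : Type*} [MeasurableSpace Ω] (μ : Measure Ω) (H K : ℝ) (X : ℝ → Ω → ℝ) : Prop :=
  (∀ t, Measurable (X t)) ∧ ∀ {ι : Type} [Fintype ι] (t : ι → ℝ), (∀ i, 0 ≤ t i) →
    IsGV μ (fun i => X (t i)) (fun i j => Rbif H K (t i) (t j))

variable {Ω : Type*} [MeasurableSpace Ω] {μ : Measure Ω} [IsProbabilityMeasure μ]

lemma sec_moment {Z : Ω → ℝ} (hZ : AEMeasurable Z μ) {v : NNReal} (h : μ.map Z = gaussianReal 0 v) :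
    MemLp Z 2 μ ∧ ∫ ω, Z ω ^ 2 ∂μ = v := by
  have h1 : MemLp (id : ℝ → ℝ) 2 (gaussianReal 0 v) := memLp_id_gaussianReal 2
  have h2 := variance_id_gaussianReal (μ := 0) (v := v)
  rw [variance_of_integral_eq_zero aemeasurable_id integral_id_gaussianReal] at h2
  rw [← h] at h1 h2
  constructor
  · rw [memLp_map_measure_iff aestronglyMeasurable_id hZ] at h1
    exact h1
  · rw [integral_map hZ (by fun_prop)] at h2
    exact h2

lemma exists_version {H K : ℝ} (hH : 0 < H) (hK : 0 < K) {B : ℝ → Ω → ℝ} (hB : IsBifBM μ H K B) :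
    ∃ X : ℝ → Ω → ℝ, IsX μ H K X ∧ ∀ t, 0 ≤ t → X t =ᵐ[μ] B t := by
  have hae : ∀ t, 0 ≤ t → AEMeasurable (B t) μ := by
    intro t ht
    have := hB.2 1 (fun _ => t) (fun _ => ht) (fun _ => 1)
    simp only [Finset.univ_unique, Finset.sum_singleton, one_mul] at this
    refine AEMeasurable.of_map_ne_zero ?_
    rw [this]
    exact IsProbabilityMeasure.ne_zero _
  classical
  set X : ℝ → Ω → ℝ := fun t => if ht : 0 ≤ t then (hae t ht).mk (B t) else fun _ => 0 with hX
  have mX : ∀ t, Measurable (X t) := by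
    intro t
    by_cases ht : 0 ≤ t
    · simp only [hX, ht, dif_pos]; exact (hae t ht).measurable_mk
    · simp only [hX, ht, dif_neg, not_false_eq_true]; exact measurable_const
  have eX : ∀ t, 0 ≤ t → X t =ᵐ[μ] B t := by
    intro t ht
    simp only [hX, ht, dif_pos]
    exact (hae t ht).ae_eq_mk.symm
  have law : ∀ (n : ℕ) (t : Fin n → ℝ), (∀ i, 0 ≤ t i) → ∀ a : Fin n → ℝ,
    Measure.map (fun ω => ∑ i, a i * X (t i) ω) μ =
      gaussianReal 0 (Real.toNNReal (∑ i, ∑ j, a i * a j * Rbif H K (t i) (t j))) := by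
    intro n t ht a
    rw [← hB.2 n t ht a]
    refine Measure.map_congr ?_
    have : ∀ᵐ ω ∂μ, ∀ i, X (t i) ω = B (t i) ω := ae_all_iff.2 fun i => eX _ (ht i)
    filter_upwards [this] with ω hω
    simp [hω]
  have L2 : ∀ t, 0 ≤ t → MemLp (X t) 2 μ ∧ ∫ ω, X t ω ^ 2 ∂μ = Rbif H K t t := by
    intro t ht
    have h1 := law 1 (fun _ => t) (fun _ => ht) (fun _ => 1)
    simp only [Finset.univ_unique, Finset.sum_singleton, one_mul] at h1
    have h2 := sec_moment (mX t).aemeasurable h1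
    rw [Real.coe_toNNReal _ (R_nonneg hH hK ht ht)] at h2
    exact h2
  have cov : ∀ s t, 0 ≤ s → 0 ≤ t → ∫ ω, X s ω * X t ω ∂μ = Rbif H K s t := by
    intro s t hs ht
    have h1 := law 2 ![s, t] (by intro i; fin_cases i <;> simp [hs, ht]) (fun _ => 1)
    simp only [Fin.sum_univ_two, one_mul, Matrix.cons_val_zero, Matrix.cons_val_one] at h1
    have h2 := (sec_moment ((mX s).add (mX t)).aemeasurable h1).2
    rw [Real.coe_toNNReal _ (by have := R_nonneg hH hK ht ht; have := R_nonneg hH hK ht hs; have := R_nonneg hH hK hs hs; have := R_nonneg hH hK hs ht; linarith)] at h2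
    have i1 := (L2 s hs).1.integrable_sq
    have i2 := (L2 t ht).1.integrable_sq
    have i3 : Integrable (fun ω => X s ω * X t ω) μ := (L2 s hs).1.integrable_mul (L2 t ht).1
    have e : ∀ ω, (X s + X t) ω ^ 2 = X s ω ^ 2 + 2 * (X s ω * X t ω) + X t ω ^ 2 := by
      intro ω; simp only [Pi.add_apply]; ring
    simp only [e] at h2
    have i4 : Integrable (fun ω => X s ω ^ 2 + 2 * (X s ω * X t ω)) μ := i1.add (i3.const_mul 2)
    rw [integral_add i4 i2, integral_add i1 (i3.const_mul 2), integral_const_mul, (L2 s hs).2, (L2 t ht).2,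
      R_symm H K t s] at h2
    linarith
  refine ⟨X, ⟨mX, ?_⟩, eX⟩
  have main : ∀ (n : ℕ) (t : Fin n → ℝ), (∀ i, 0 ≤ t i) →
    IsGV μ (fun i => X (t i)) (fun i j => Rbif H K (t i) (t j)) := by
    intro n t ht
    refine ⟨fun i => mX _, fun i j => R_symm _ _ _ _, fun a => ?_⟩
    have hq : 0 ≤ ∑ i, ∑ j, a i * a j * Rbif H K (t i) (t j) := by
      have : ∫ ω, (∑ i, a i * X (t i) ω) ^ 2 ∂μ = ∑ i, ∑ j, a i * a j * Rbif H K (t i) (t j) := by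
        have e : ∀ ω, (∑ i, a i * X (t i) ω) ^ 2 = ∑ i, ∑ j, a i * a j * (X (t i) ω * X (t j) ω) := by
          intro ω
          rw [sq, Finset.sum_mul_sum]
          exact Finset.sum_congr rfl fun i _ => Finset.sum_congr rfl fun j _ => by ring
        simp only [e]
        have i3 : ∀ i j, Integrable (fun ω => a i * a j * (X (t i) ω * X (t j) ω)) μ := fun i j =>
          ((L2 _ (ht i)).1.integrable_mul (L2 _ (ht j)).1).const_mul _
        rw [integral_finsetSum _ fun i _ => integrable_finsetSum _ fun j _ => i3 i j]
        refine Finset.sum_congr rfl fun i _ => ?_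
        rw [integral_finsetSum _ fun j _ => i3 i j]
        refine Finset.sum_congr rfl fun j _ => ?_
        rw [integral_const_mul, cov _ _ (ht i) (ht j)]
      rw [← this]
      exact integral_nonneg fun _ => sq_nonneg _
    have h1 := charFun_gaussianReal (μ := 0) (v := Real.toNNReal (∑ i, ∑ j, a i * a j * Rbif H K (t i) (t j))) 1
    rw [← law n t ht a, charFun_apply_real, integral_map (by fun_prop) (Continuous.aestronglyMeasurable (by fun_prop)),
      Real.coe_toNNReal _ hq] at h1
    simp only [Complex.ofReal_one, one_mul, Complex.ofReal_zero, mul_zero, zero_mul, zero_sub, one_pow, mul_one] at h1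
    rw [h1, qf, Complex.ofReal_exp]
    congr 1
    push_cast
    ring
  intro ι _ t ht
  have := (main _ (t ∘ (Fintype.equivFin ι).symm) (fun i => ht _)).reindex (Fintype.equivFin ι)
  simpa using this

lemma IsX.gv {H K : ℝ} {X : ℝ → Ω → ℝ} (h : IsX μ H K X) {ι : Type} [Fintype ι] (t : ι → ℝ)
    (ht : ∀ i, 0 ≤ t i) : IsGV μ (fun i => X (t i)) (fun i j => Rbif H K (t i) (t j)) := h.2 t ht

end BifChung

namespace BifChung

lemma R_incr {H K s t : ℝ} (hH : 0 < H) (hK : 0 < K) (hK1 : K ≤ 1) (hs : 0 ≤ s) (ht : 0 ≤ t) :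
    Rbif H K t t + Rbif H K s s - 2 * Rbif H K s t ≤ 2 * |t - s| ^ (2 * H * K) := by
  rw [R_diag hH hK ht, R_diag hH hK hs, Rbif]
  have hx : 0 ≤ t ^ (2 * H) := Real.rpow_nonneg ht _
  have hy : 0 ≤ s ^ (2 * H) := Real.rpow_nonneg hs _
  rw [Real.rpow_mul ht, Real.rpow_mul hs]
  set x := t ^ (2 * H)
  set y := s ^ (2 * H)
  have hc := (Real.concaveOn_rpow hK.le hK1).2 (Set.mem_Ici.2 hx) (Set.mem_Ici.2 hy)
    (by norm_num : (0:ℝ) ≤ 1/2) (by norm_num : (0:ℝ) ≤ 1/2) (by norm_num)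
  simp only [smul_eq_mul] at hc
  rw [← mul_add, ← mul_add, Real.mul_rpow (by norm_num) (by positivity), one_div, Real.inv_rpow (by norm_num),
    ← Real.rpow_neg (by norm_num)] at hc
  have h2 : (2:ℝ) ^ (-K) ≤ 1 := Real.rpow_le_one_of_one_le_of_nonpos (by norm_num) (by linarith)
  have h3 : 0 ≤ |t - s| ^ (2 * H * K) := Real.rpow_nonneg (abs_nonneg _) _
  nlinarith

lemma R_decay0 {H K s t : ℝ} (hH : 0 < H) (hH1 : H < 1) (hK : 0 < K) (hK1 : K ≤ 1) (hs : 0 ≤ s) (ht : 0 < t)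
    (hst : s ≤ t) {g : ℝ} (hg0 : 0 < g) (hg1 : g ≤ 1) (hg : g ≤ 2 * (H * K)) :
    Rbif H K s t ≤ 3 * s ^ g * t ^ (2 * (H * K) - g) := by
  have hHK : H * K ≤ H := by nlinarith
  have hHK0 : 0 < H * K := mul_pos hH hK
  set u := s / t with hu
  have hu0 : 0 ≤ u := by positivity
  have hu1 : u ≤ 1 := (div_le_one ht).2 hst
  have hsu : s = t * u := by rw [hu]; field_simp
  have e := R_scale (H := H) (K := K) ht hu0 zero_le_one
  rw [← hsu, mul_one] at e
  have e2 : 3 * s ^ g * t ^ (2 * (H * K) - g) = t ^ (2 * H * K) * (3 * u ^ g) := by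
    rw [hsu, Real.mul_rpow ht.le hu0, mul_assoc 2 H K, show 2 * (H * K) = g + (2 * (H * K) - g) by ring,
      Real.rpow_add ht, show g + (2 * (H * K) - g) - g = 2 * (H * K) - g by ring]
    ring
  rw [e, e2]
  refine mul_le_mul_of_nonneg_left ?_ (Real.rpow_nonneg ht.le _)
  have h2 : (2:ℝ) ^ (-K) ≤ 1 := Real.rpow_le_one_of_one_le_of_nonpos (by norm_num) (by linarith)
  have hR := R_nonneg hH hK hu0 zero_le_one
  have h20 : 0 < (2:ℝ) ^ (-K) := Real.rpow_pos_of_pos (by norm_num) _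
  have a1 : ((1:ℝ) ^ (2 * H) + u ^ (2 * H)) ^ K ≤ 1 + u ^ (2 * H) := by
    rw [Real.one_rpow]
    have : 0 ≤ u ^ (2 * H) := Real.rpow_nonneg hu0 _
    calc (1 + u ^ (2 * H)) ^ K ≤ (1 + u ^ (2 * H)) ^ (1:ℝ) := Real.rpow_le_rpow_of_exponent_le (by linarith) hK1
      _ = _ := Real.rpow_one _
  have a2 : 1 - 2 * u ≤ |1 - u| ^ (2 * H * K) := by
    rw [abs_of_nonneg (by linarith)]
    rcases hu1.eq_or_lt with h | h
    · rw [h, sub_self, Real.zero_rpow (by positivity)]; norm_num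
    calc 1 - 2 * u ≤ (1 - u) ^ 2 := by nlinarith
      _ = (1 - u) ^ (2:ℝ) := by norm_cast
      _ ≤ _ := Real.rpow_le_rpow_of_exponent_ge (by linarith) (by linarith) (by nlinarith)
  have a3 : u ^ (2 * H) ≤ u ^ g := Real.rpow_le_rpow_of_exponent_ge_of_imp hu0 hu1 (by linarith) (fun _ h => absurd h (by positivity))
  have a4 : u ≤ u ^ g := by
    calc u = u ^ (1:ℝ) := (Real.rpow_one u).symm
      _ ≤ _ := Real.rpow_le_rpow_of_exponent_ge_of_imp hu0 hu1 hg1 (fun _ h => absurd h (by positivity))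
  rw [Rbif] at hR ⊢
  have : 0 ≤ ((1:ℝ) ^ (2 * H) + u ^ (2 * H)) ^ K - |1 - u| ^ (2 * H * K) := by
    by_contra hneg
    push Not at hneg
    nlinarith
  nlinarith

lemma R_decay {H K a b x y : ℝ} (hH : 0 < H) (hH1 : H < 1) (hK : 0 < K) (hK1 : K ≤ 1) (ha : 0 < a)
    (hab : a ≤ b) (hx : 0 ≤ x) (hxa : x ≤ a) (hy : 0 ≤ y) (hyb : y ≤ b)
    {g : ℝ} (hg0 : 0 < g) (hg1 : g ≤ 1) (hg : g ≤ 2 * (H * K)) :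
    |Rbif H K x y| ≤ 3 * a ^ g * b ^ (2 * (H * K) - g) := by
  rw [abs_of_nonneg (R_nonneg hH hK hx hy)]
  have hb : 0 < b := ha.trans_le hab
  rcases le_or_gt x y with h | h
  · rcases hy.eq_or_lt with h0 | h0
    · have : x = 0 := le_antisymm (h0 ▸ h) hx
      rw [this, ← h0, R_diag hH hK le_rfl, Real.zero_rpow (by positivity)]
      positivity
    refine (R_decay0 hH hH1 hK hK1 hx h0 h hg0 hg1 hg).trans ?_
    gcongr
  · have hx0 : 0 < x := hy.trans_lt h
    rw [R_symm]
    refine (R_decay0 hH hH1 hK hK1 hy hx0 h.le hg0 hg1 hg).trans ?_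
    gcongr
    · linarith
    · linarith

variable {Ω : Type*} [MeasurableSpace Ω] {μ : Measure Ω} [IsProbabilityMeasure μ]
  {ι : Type*} [Fintype ι]

lemma IsGV.tail {Y : ι → Ω → ℝ} {C : ι → ι → ℝ} (h : IsGV μ Y C) (i : ι) {σ x : ℝ} (hσ : 0 < σ)
    (hC : C i i ≤ σ ^ 2) (hx : 0 ≤ x) : μ.real {ω | σ * x < |Y i ω|} ≤ 2 * Real.exp (-x ^ 2 / 2) := by
  obtain ⟨hl, h0⟩ := h.marg i
  have sg : HasSubgaussianMGF (Y i) (Real.toNNReal (σ ^ 2)) μ := by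
    have e : ∀ t, mgf (Y i) μ t = Real.exp (C i i * t ^ 2 / 2) := by
      intro t
      rw [mgf_gaussianReal hl, Real.coe_toNNReal _ h0]
      simp
    constructor
    · intro t
      by_contra hn
      have := e t
      rw [mgf, integral_undef hn] at this
      exact absurd this (Real.exp_pos _).ne
    · intro t
      rw [e, Real.coe_toNNReal _ (sq_nonneg _)]
      apply Real.exp_le_exp.2
      have := mul_le_mul_of_nonneg_right hC (sq_nonneg t)
      linarith
  have e1 := sg.measure_ge_le (ε := σ * x) (by positivity)
  have e2 := sg.neg.measure_ge_le (ε := σ * x) (by positivity)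
  have e3 : -(σ * x) ^ 2 / (2 * (Real.toNNReal (σ ^ 2) : ℝ)) = -x ^ 2 / 2 := by
    rw [Real.coe_toNNReal _ (sq_nonneg _)]
    field_simp
  rw [e3] at e1 e2
  have : {ω | σ * x < |Y i ω|} ⊆ {ω | σ * x ≤ Y i ω} ∪ {ω | σ * x ≤ (-Y i) ω} := by
    intro ω hω
    have hω' : σ * x < |Y i ω| := hω
    rcases lt_abs.1 hω' with h | h
    · exact Or.inl h.le
    · exact Or.inr h.le
  calc _ ≤ _ := measureReal_mono this
    _ ≤ _ := measureReal_union_le _ _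
    _ ≤ _ := by linarith

lemma IsGV.small {Y : ι → Ω → ℝ} {C : ι → ι → ℝ} (h : IsGV μ Y C) (i : ι) {σ x : ℝ} (hσ : 0 < σ)
    (hC : C i i ≤ σ ^ 2) (hx : 0 ≤ x) (hx1 : x ≤ 1) : x / 4 ≤ μ.real {ω | |Y i ω| ≤ σ * x} := by
  obtain ⟨hl, h0⟩ := h.marg i
  have m1 : MeasurableSet {y : ℝ | |y| ≤ σ * x} := measurableSet_le (by fun_prop) (by fun_prop)
  have e1 : μ.real {ω | |Y i ω| ≤ σ * x} = (gaussianReal 0 (Real.toNNReal (C i i))).real {y | |y| ≤ σ * x} := by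
    rw [← hl, map_measureReal_apply (h.1 i) m1]
    rfl
  rw [e1]
  rcases h0.eq_or_lt with h0 | h0
  · rw [← h0, Real.toNNReal_zero, gaussianReal_zero_var, measureReal_def,
      Measure.dirac_apply_of_mem (by simp; positivity)]
    simp; linarith
  set v := C i i with hv
  have hvn : Real.toNNReal v ≠ 0 := by simpa using h0
  set s := √v with hs
  have s0 : 0 < s := Real.sqrt_pos.2 h0
  have ss : s ^ 2 = v := Real.sq_sqrt h0.le
  have sσ : s ≤ σ := by nlinarith [abs_le_of_sq_le_sq (by rw [ss]; exact hC : s ^ 2 ≤ σ ^ 2) hσ.le, abs_le.1 (abs_le_of_sq_le_sq (by rw [ss]; exact hC : s ^ 2 ≤ σ ^ 2) hσ.le)]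
  rw [measureReal_def, gaussianReal_apply_eq_integral _ hvn, ENNReal.toReal_ofReal
    (integral_nonneg fun _ => gaussianPDFReal_nonneg _ _ _)]
  have sub : Set.Icc (-(s * x)) (s * x) ⊆ {y | |y| ≤ σ * x} := by
    intro y hy
    have : s * x ≤ σ * x := by gcongr
    exact (abs_le.2 ⟨hy.1, hy.2⟩).trans this
  have step : ∫ y in Set.Icc (-(s * x)) (s * x), (1 / (s * 6) : ℝ) ≤
      ∫ y in {y | |y| ≤ σ * x}, gaussianPDFReal 0 (Real.toNNReal v) y := by
    calc _ ≤ ∫ y in Set.Icc (-(s * x)) (s * x), gaussianPDFReal 0 (Real.toNNReal v) y := by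
          refine setIntegral_mono_on (continuousOn_const.integrableOn_Icc) (integrable_gaussianPDFReal _ _).integrableOn measurableSet_Icc ?_
          intro y hy
          rw [gaussianPDFReal, Real.coe_toNNReal _ h0.le, sub_zero]
          have a1 : √(2 * Real.pi * v) ≤ 3 * s := by
            rw [show 2 * Real.pi * v = (2 * Real.pi) * v by ring, Real.sqrt_mul (by positivity), ← hs]
            gcongr
            rw [Real.sqrt_le_left (by norm_num)]
            have := Real.pi_lt_four
            linarith
          have a1' : 0 < √(2 * Real.pi * v) := Real.sqrt_pos.2 (by positivity)
          have a2 : (1/2:ℝ) ≤ Real.exp (-y ^ 2 / (2 * v)) := by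
            have hy2 : y ^ 2 ≤ v := by
              have : |y| ≤ s := (abs_le.2 ⟨hy.1, hy.2⟩).trans (by nlinarith)
              rw [← ss, ← sq_abs]
              gcongr
            have : -(1/2) ≤ -y ^ 2 / (2 * v) := by
              rw [le_div_iff₀ (by positivity)]
              linarith
            have := Real.add_one_le_exp (-y ^ 2 / (2 * v))
            linarith
          calc 1 / (s * 6) = (3 * s)⁻¹ * (1 / 2) := by field_simp; norm_num
            _ ≤ _ := by gcongr
      _ ≤ _ := setIntegral_mono_set (integrable_gaussianPDFReal _ _).integrableOn
          (ae_of_all _ fun _ => gaussianPDFReal_nonneg _ _ _) (HasSubset.Subset.eventuallyLE sub)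
  refine le_trans ?_ step
  rw [setIntegral_const, measureReal_def, Real.volume_Icc, ENNReal.toReal_ofReal (by nlinarith), smul_eq_mul]
  have : (s * x - -(s * x)) * (1 / (s * 6)) = x / 3 := by field_simp; ring
  rw [this]
  linarith
end BifChung

namespace BifChung

/-- second difference -/
def sd (δ : ℝ) (g : ℝ → ℝ) (a : ℝ) : ℝ := g (a + 2 * δ) - 2 * g (a + δ) + g a

lemma sd_bound {g g' g'' : ℝ → ℝ} {a δ B : ℝ} (hδ : 0 ≤ δ)
    (h1 : ∀ x ∈ Set.Icc a (a + 2 * δ), HasDerivAt g (g' x) x)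
    (h2 : ∀ x ∈ Set.Icc a (a + 2 * δ), HasDerivAt g' (g'' x) x)
    (hB : ∀ x ∈ Set.Icc a (a + 2 * δ), |g'' x| ≤ B) : |sd δ g a| ≤ B * δ ^ 2 := by
  have m1 : ∀ x ∈ Set.Icc a (a + δ), |g' (x + δ) - g' x| ≤ B * δ := by
    intro x hx
    have := Convex.norm_image_sub_le_of_norm_hasDerivWithin_le (f := g') (f' := g'') (C := B)
      (s := Set.Icc a (a + 2 * δ)) (x := x) (y := x + δ)
      (fun y hy => (h2 y hy).hasDerivWithinAt) (fun y hy => hB y hy) (convex_Icc _ _)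
      ⟨hx.1, by linarith [hx.2]⟩ ⟨by linarith [hx.1], by linarith [hx.2]⟩
    rw [Real.norm_eq_abs, Real.norm_eq_abs, add_sub_cancel_left, abs_of_nonneg hδ] at this
    exact this
  have := Convex.norm_image_sub_le_of_norm_hasDerivWithin_le (f := fun x => g (x + δ) - g x)
      (f' := fun x => g' (x + δ) - g' x) (C := B * δ)
      (s := Set.Icc a (a + δ)) (x := a) (y := a + δ)
      (fun y hy => by
        refine HasDerivAt.hasDerivWithinAt (HasDerivAt.sub ?_ ?_)
        · exact HasDerivAt.comp_add_const y δ (h1 (y + δ) ⟨by linarith [hy.1], by linarith [hy.2]⟩)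
        · exact h1 y ⟨hy.1, by linarith [hy.2]⟩) (fun y hy => m1 y hy) (convex_Icc _ _)
      ⟨le_rfl, by linarith⟩ ⟨by linarith, le_rfl⟩
  rw [Real.norm_eq_abs, Real.norm_eq_abs, add_sub_cancel_left, abs_of_nonneg hδ] at this
  rw [sd]
  calc _ = |g (a + δ + δ) - g (a + δ) - (g (a + δ) - g a)| := by congr 1; ring_nf
    _ ≤ _ := this
    _ = _ := by ring

lemma pw_d1 {p q c t : ℝ} (ht : 0 < t) (hc : 0 ≤ c) :
    HasDerivAt (fun t => (t ^ q + c) ^ p) (p * q * (t ^ q + c) ^ (p - 1) * t ^ (q - 1)) t := by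
  have h1 : HasDerivAt (fun t => t ^ q + c) (q * t ^ (q - 1)) t :=
    (Real.hasDerivAt_rpow_const (Or.inl ht.ne')).add_const c
  have hp : t ^ q + c ≠ 0 := by positivity
  have := h1.rpow_const (p := p) (Or.inl hp)
  convert! this using 1
  ring

lemma pw_d2 {p q c t : ℝ} (ht : 0 < t) (hc : 0 ≤ c) :
    HasDerivAt (fun t => p * q * (t ^ q + c) ^ (p - 1) * t ^ (q - 1))
      (p * q * (q * (p - 1)) * (t ^ (q - 1)) ^ 2 * (t ^ q + c) ^ (p - 2) +
        p * q * (q - 1) * t ^ (q - 2) * (t ^ q + c) ^ (p - 1)) t := by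
  have h1 := pw_d1 (p := p - 1) (q := q) ht hc
  have h2 : HasDerivAt (fun t : ℝ => t ^ (q - 1)) ((q - 1) * t ^ (q - 1 - 1)) t :=
    Real.hasDerivAt_rpow_const (Or.inl ht.ne')
  have := (h1.mul h2).const_mul (p * q)
  rw [show p - 1 - 1 = p - 2 by ring, show q - 1 - 1 = q - 2 by ring] at this
  convert! this using 1
  · ext t; simp only [Pi.mul_apply]; ring
  · ring

lemma rpow_le4 {t e : ℝ} (h1 : 1 ≤ t) (h3 : t ≤ 3) (he : e ≤ 1) : 0 ≤ t ^ e ∧ t ^ e ≤ 3 := by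
  refine ⟨Real.rpow_nonneg (by linarith) _, ?_⟩
  calc t ^ e ≤ t ^ (1:ℝ) := Real.rpow_le_rpow_of_exponent_le h1 he
    _ ≤ 3 := by simpa using h3

lemma rpow_le1 {t e : ℝ} (h1 : 1 ≤ t) (he : e ≤ 0) : 0 ≤ t ^ e ∧ t ^ e ≤ 1 :=
  ⟨Real.rpow_nonneg (by linarith) _, Real.rpow_le_one_of_one_le_of_nonpos h1 he⟩

/-- second derivative bound -/
lemma pw_sd {p q c t δ : ℝ} (hδ : 0 ≤ δ) (ht : 1 ≤ t) (ht3 : t + 2 * δ ≤ 3) (hc : 0 ≤ c) (hq : 0 < q) (hq2 : q ≤ 2)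
    (hp : -2 ≤ p) (hp1 : p ≤ 1) : |sd δ (fun t => (t ^ q + c) ^ p) t| ≤ 300 * δ ^ 2 := by
  refine sd_bound hδ (fun x hx => pw_d1 (by linarith [hx.1]) hc) (fun x hx => pw_d2 (by linarith [hx.1]) hc) ?_
  intro x hx
  have x1 : 1 ≤ x := by linarith [hx.1]
  have x3 : x ≤ 3 := by linarith [hx.2]
  obtain ⟨a1, a2⟩ := rpow_le4 x1 x3 (by linarith : q - 1 ≤ 1)
  obtain ⟨b1, b2⟩ := rpow_le1 x1 (by linarith : q - 2 ≤ 0)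
  have A1 : 1 ≤ x ^ q + c := by
    have := Real.one_le_rpow x1 hq.le
    linarith
  obtain ⟨c1, c2⟩ := rpow_le1 A1 (by linarith : p - 2 ≤ 0)
  obtain ⟨d1, d2⟩ := rpow_le1 A1 (by linarith : p - 1 ≤ 0)
  have e1 : |p * q * (q * (p - 1))| ≤ 24 := by
    have h1 : |p| ≤ 2 := abs_le.2 ⟨hp, by linarith⟩
    have h2 : |q| ≤ 2 := abs_le.2 ⟨by linarith, by linarith⟩
    have h3 : |p - 1| ≤ 3 := abs_le.2 ⟨by linarith, by linarith⟩
    rw [abs_mul, abs_mul, abs_mul]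
    calc |p| * |q| * (|q| * |p - 1|) ≤ 2 * 2 * (2 * 3) := by gcongr
      _ = 24 := by norm_num
  have e2 : |p * q * (q - 1)| ≤ 4 := by
    have h1 : |p| ≤ 2 := abs_le.2 ⟨hp, by linarith⟩
    have h2 : |q| ≤ 2 := abs_le.2 ⟨by linarith, by linarith⟩
    have h3 : |q - 1| ≤ 1 := abs_le.2 ⟨by linarith, by linarith⟩
    rw [abs_mul, abs_mul]
    calc |p| * |q| * |q - 1| ≤ 2 * 2 * 1 := by gcongr
      _ = 4 := by norm_num
  refine (abs_add_le _ _).trans ?_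
  rw [abs_mul, abs_mul _ ((x ^ (q - 1)) ^ 2), abs_mul _ ((x ^ q + c) ^ (p - 1)), abs_mul _ (x ^ (q - 2)), abs_of_nonneg c1, abs_of_nonneg d1,
    abs_of_nonneg b1, abs_of_nonneg (sq_nonneg (x ^ (q - 1)))]
  calc |p * q * (q * (p - 1))| * (x ^ (q - 1)) ^ 2 * (x ^ q + c) ^ (p - 2) +
      |p * q * (q - 1)| * x ^ (q - 2) * (x ^ q + c) ^ (p - 1) ≤ 24 * 3 ^ 2 * 1 + 4 * 1 * 1 := by gcongr
    _ ≤ 300 := by norm_num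

lemma HasDerivAt_sd {F F' : ℝ → ℝ → ℝ} {δ t s : ℝ} (h : ∀ u ∈ ({t, t + δ, t + 2 * δ} : Set ℝ),
    HasDerivAt (fun s => F s u) (F' s u) s) : HasDerivAt (fun s => sd δ (F s) t) (sd δ (F' s) t) s := by
  unfold sd
  exact ((h (t + 2 * δ) (by simp)).sub ((h (t + δ) (by simp)).const_mul 2)).add (h t (by simp))

/-- mixed smooth difference -/
lemma smooth_sd {q K s t δ : ℝ} (hδ : 0 ≤ δ) (ht : 1 ≤ t) (ht3 : t + 2 * δ ≤ 3) (hs : 1 ≤ s) (hs3 : s + 2 * δ ≤ 3)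
    (hq : 0 < q) (hq2 : q ≤ 2) (hK : 0 < K) (hK1 : K ≤ 1) :
    |sd δ (fun s => sd δ (fun t => (t ^ q + s ^ q) ^ K) t) s| ≤ 12000 * δ ^ 4 := by
  have key : ∀ u, u ∈ ({t, t + δ, t + 2 * δ} : Set ℝ) → 0 ≤ u := by
    rintro u (rfl | rfl | rfl) <;> linarith
  have := sd_bound (g := fun s => sd δ (fun t => (s ^ q + t ^ q) ^ K) t)
    (g' := fun s => sd δ (fun t => K * q * (s ^ q + t ^ q) ^ (K - 1) * s ^ (q - 1)) t)
    (g'' := fun s => sd δ (fun t => K * q * (q * (K - 1)) * (s ^ (q - 1)) ^ 2 * (s ^ q + t ^ q) ^ (K - 2) +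
        K * q * (q - 1) * s ^ (q - 2) * (s ^ q + t ^ q) ^ (K - 1)) t) (a := s) (B := 12000 * δ ^ 2) hδ ?_ ?_ ?_
  · have e : (fun s => sd δ (fun t => (t ^ q + s ^ q) ^ K) t) = (fun s => sd δ (fun t => (s ^ q + t ^ q) ^ K) t) := by
      ext s; congr 1; ext t; rw [add_comm]
    rw [e]
    calc _ ≤ _ := this
      _ = _ := by ring
  · intro x hx
    exact HasDerivAt_sd (F := fun s t => (s ^ q + t ^ q) ^ K) (F' := fun s t => K * q * (s ^ q + t ^ q) ^ (K - 1) * s ^ (q - 1)) fun u hu => pw_d1 (by linarith [hx.1]) (Real.rpow_nonneg (key u hu) _)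
  · intro x hx
    exact HasDerivAt_sd (F := fun s t => K * q * (s ^ q + t ^ q) ^ (K - 1) * s ^ (q - 1)) (F' := fun s t => K * q * (q * (K - 1)) * (s ^ (q - 1)) ^ 2 * (s ^ q + t ^ q) ^ (K - 2) + K * q * (q - 1) * s ^ (q - 2) * (s ^ q + t ^ q) ^ (K - 1)) fun u hu => pw_d2 (by linarith [hx.1]) (Real.rpow_nonneg (key u hu) _)
  · intro x hx
    have x1 : 1 ≤ x := by linarith [hx.1]
    have x3 : x ≤ 3 := by linarith [hx.2]
    obtain ⟨a1, a2⟩ := rpow_le4 x1 x3 (by linarith : q - 1 ≤ 1)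
    obtain ⟨b1, b2⟩ := rpow_le1 x1 (by linarith : q - 2 ≤ 0)
    have s1 := pw_sd (p := K - 2) (c := x ^ q) hδ ht ht3 (Real.rpow_nonneg (by linarith) _) hq hq2 (by linarith) (by linarith)
    have s2 := pw_sd (p := K - 1) (c := x ^ q) hδ ht ht3 (Real.rpow_nonneg (by linarith) _) hq hq2 (by linarith) (by linarith)
    have e : sd δ (fun t => K * q * (q * (K - 1)) * (x ^ (q - 1)) ^ 2 * (x ^ q + t ^ q) ^ (K - 2) +
        K * q * (q - 1) * x ^ (q - 2) * (x ^ q + t ^ q) ^ (K - 1)) t =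
        K * q * (q * (K - 1)) * (x ^ (q - 1)) ^ 2 * sd δ (fun t => (t ^ q + x ^ q) ^ (K - 2)) t +
        K * q * (q - 1) * x ^ (q - 2) * sd δ (fun t => (t ^ q + x ^ q) ^ (K - 1)) t := by
      simp only [sd, add_comm (x ^ q)]
      ring
    rw [e]
    have e1 : |K * q * (q * (K - 1))| ≤ 4 := by
      have h1 : |K| ≤ 1 := abs_le.2 ⟨by linarith, by linarith⟩
      have h2 : |q| ≤ 2 := abs_le.2 ⟨by linarith, by linarith⟩
      have h3 : |K - 1| ≤ 1 := abs_le.2 ⟨by linarith, by linarith⟩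
      rw [abs_mul, abs_mul, abs_mul]
      calc |K| * |q| * (|q| * |K - 1|) ≤ 1 * 2 * (2 * 1) := by gcongr
        _ = 4 := by norm_num
    have e2 : |K * q * (q - 1)| ≤ 2 := by
      have h1 : |K| ≤ 1 := abs_le.2 ⟨by linarith, by linarith⟩
      have h2 : |q| ≤ 2 := abs_le.2 ⟨by linarith, by linarith⟩
      have h3 : |q - 1| ≤ 1 := abs_le.2 ⟨by linarith, by linarith⟩
      rw [abs_mul, abs_mul]
      calc |K| * |q| * |q - 1| ≤ 1 * 2 * 1 := by gcongr
        _ = 2 := by norm_num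
    refine (abs_add_le _ _).trans ?_
    rw [abs_mul, abs_mul _ ((x ^ (q - 1)) ^ 2), abs_mul _ (sd δ (fun t => (t ^ q + x ^ q) ^ (K - 1)) t), abs_mul _ (x ^ (q - 2)),
      abs_of_nonneg b1, abs_of_nonneg (sq_nonneg (x ^ (q - 1)))]
    calc _ ≤ 4 * 3 ^ 2 * (300 * δ ^ 2) + 2 * 1 * (300 * δ ^ 2) := by gcongr
      _ ≤ _ := by nlinarith [sq_nonneg δ]

/-- fourth difference of a power -/
lemma pow_sd4 {w x : ℝ} (hw0 : 0 < w) (hw : w ≤ 2) (hx : 4 ≤ x) :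
    |sd 1 (fun y => sd 1 (fun z => z ^ w) y) (x - 2)| ≤ 48 / x ^ 2 := by
  have B4 : ∀ y, x - 2 ≤ y → |w * (w - 1) * (w - 2) * (w - 3) * y ^ (w - 4)| ≤ 48 / x ^ 2 := by
    intro y hy
    have y0 : 1 ≤ y := by linarith
    rw [abs_mul]
    have e1 : |w * (w - 1) * (w - 2) * (w - 3)| ≤ 12 := by
      have h1 : |w| ≤ 2 := abs_le.2 ⟨by linarith, by linarith⟩
      have h2 : |w - 1| ≤ 1 := abs_le.2 ⟨by linarith, by linarith⟩
      have h3 : |w - 2| ≤ 2 := abs_le.2 ⟨by linarith, by linarith⟩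
      have h4 : |w - 3| ≤ 3 := abs_le.2 ⟨by linarith, by linarith⟩
      rw [abs_mul, abs_mul, abs_mul]
      calc |w| * |w - 1| * |w - 2| * |w - 3| ≤ 2 * 1 * 2 * 3 := by gcongr
        _ = 12 := by norm_num
    have e2 : |y ^ (w - 4)| ≤ 4 / x ^ 2 := by
      rw [abs_of_nonneg (Real.rpow_nonneg (by linarith) _)]
      calc y ^ (w - 4) ≤ y ^ (-2 : ℝ) := Real.rpow_le_rpow_of_exponent_le y0 (by linarith)
        _ = (y ^ 2)⁻¹ := by rw [Real.rpow_neg (by linarith)]; norm_cast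
        _ ≤ ((x / 2) ^ 2)⁻¹ := by
            have : x / 2 ≤ y := by linarith
            gcongr
        _ = 4 / x ^ 2 := by field_simp; norm_num
    calc _ ≤ 12 * (4 / x ^ 2) := by gcongr
      _ = _ := by ring
  have d : ∀ (c e y : ℝ), 0 < y → HasDerivAt (fun y : ℝ => c * y ^ e) (c * e * y ^ (e - 1)) y := by
    intro c e y hy
    have := (Real.hasDerivAt_rpow_const (p := e) (Or.inl hy.ne')).const_mul c
    convert! this using 1; ring
  have := sd_bound (δ := 1) (g := fun y => sd 1 (fun z => z ^ w) y)
    (g' := fun y => sd 1 (fun z => w * z ^ (w - 1)) y)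
    (g'' := fun y => sd 1 (fun z => w * (w - 1) * z ^ (w - 2)) y) (a := x - 2) (B := 48 / x ^ 2) zero_le_one ?_ ?_ ?_
  · simpa using this
  · intro y hy
    have y0 : 0 < y := by linarith [hy.1]
    unfold sd
    have := d 1 w
    simp only [one_mul] at this
    exact (((this _ (by linarith)).comp_add_const y _).sub ((((this _ (by linarith)).comp_add_const y _)).const_mul 2)).add (this y y0)
  · intro y hy
    have y0 : 0 < y := by linarith [hy.1]
    unfold sd
    have := d w (w - 1)
    rw [show w - 1 - 1 = w - 2 by ring] at this
    exact (((this _ (by linarith)).comp_add_const y _).sub ((((this _ (by linarith)).comp_add_const y _)).const_mul 2)).add (this y y0)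
  · intro y hy
    have h3 := d (w * (w - 1)) (w - 2)
    rw [show w - 2 - 1 = w - 3 by ring] at h3
    have h4 := d (w * (w - 1) * (w - 2)) (w - 3)
    rw [show w - 3 - 1 = w - 4 by ring] at h4
    have := sd_bound (δ := 1) (a := y) (B := 48 / x ^ 2) zero_le_one (fun z hz => h3 z (by linarith [hy.1, hz.1]))
      (fun z hz => h4 z (by linarith [hy.1, hz.1])) (fun z hz => B4 z (by linarith [hy.1, hz.1]))
    simpa using this
end BifChung

namespace BifChung

lemma sum_inv_sq (N : ℕ) (i : Fin N) :
    ∑ j : Fin N, (if i = j then (0:ℝ) else 1 / ((j:ℝ) - i) ^ 2) ≤ 4 := by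
  classical
  have base : ∀ n : ℕ, ∑ k ∈ Finset.Ioo 0 n, ((k:ℝ) ^ 2)⁻¹ ≤ 2 := by
    intro n; have := sum_Ioo_inv_sq_le (α := ℝ) 0 n; simpa using this
  have split : ∀ j : Fin N, (if i = j then (0:ℝ) else 1 / ((j:ℝ) - i) ^ 2) =
      (if j < i then (((i.1 - j.1 : ℕ) : ℝ) ^ 2)⁻¹ else 0) + (if i < j then (((j.1 - i.1 : ℕ) : ℝ) ^ 2)⁻¹ else 0) := by
    intro j
    rcases lt_trichotomy i j with h | h | h
    · rw [if_neg h.ne, if_neg h.not_gt, if_pos h, Nat.cast_sub (Fin.lt_def.1 h).le]; simp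
    · simp [h]
    · rw [if_neg h.ne', if_neg h.not_gt, if_pos h, Nat.cast_sub (Fin.lt_def.1 h).le]
      rw [add_zero, one_div, ← neg_sub, neg_sq]
  simp only [split]
  rw [Finset.sum_add_distrib, ← Finset.sum_filter, ← Finset.sum_filter]
  have p1 : ∑ j with j < i, (((i.1 - j.1 : ℕ) : ℝ) ^ 2)⁻¹ ≤ 2 := by
    refine le_trans ?_ (base (N+1))
    rw [← Finset.sum_image (s := Finset.univ.filter fun j : Fin N => j < i) (g := fun j => i.1 - j.1) (f := fun k : ℕ => ((k:ℝ)^2)⁻¹)]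
    · refine Finset.sum_le_sum_of_subset_of_nonneg ?_ fun _ _ _ => by positivity
      intro k hk
      simp only [Finset.mem_image, Finset.mem_filter, Finset.mem_univ, true_and, Finset.mem_Ioo] at hk ⊢
      obtain ⟨j, hj, rfl⟩ := hk
      have := Fin.lt_def.1 hj
      omega
    · intro a ha b hb hab
      simp only [Finset.coe_filter, Finset.mem_univ, true_and, Set.mem_ofPred_eq] at ha hb
      have := Fin.lt_def.1 ha
      have := Fin.lt_def.1 hb
      ext; simp only at hab; omega
  have p2 : ∑ j with i < j, (((j.1 - i.1 : ℕ) : ℝ) ^ 2)⁻¹ ≤ 2 := by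
    refine le_trans ?_ (base (N+1))
    rw [← Finset.sum_image (s := Finset.univ.filter fun j : Fin N => i < j) (g := fun j => j.1 - i.1) (f := fun k : ℕ => ((k:ℝ)^2)⁻¹)]
    · refine Finset.sum_le_sum_of_subset_of_nonneg ?_ fun _ _ _ => by positivity
      intro k hk
      simp only [Finset.mem_image, Finset.mem_filter, Finset.mem_univ, true_and, Finset.mem_Ioo] at hk ⊢
      obtain ⟨j, hj, rfl⟩ := hk
      have := Fin.lt_def.1 hj
      omega
    · intro a ha b hb hab
      simp only [Finset.coe_filter, Finset.mem_univ, true_and, Set.mem_ofPred_eq] at ha hb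
      have := Fin.lt_def.1 ha
      have := Fin.lt_def.1 hb
      ext; simp only at hab; omega
  linarith

lemma diag_dom {ι : Type*} [Fintype ι] [DecidableEq ι] {C : ι → ι → ℝ} (hs : ∀ i j, C i j = C j i) {κ : ℝ}
    (h : ∀ i, ∑ j, (if i = j then 0 else |C i j|) ≤ C i i - κ) (a : ι → ℝ) :
    κ * ∑ i, a i ^ 2 ≤ qf C a := by
  set E : ι → ι → ℝ := fun i j => if i = j then 0 else |C i j| with hE
  have Es : ∀ i j, E i j = E j i := by intro i j; simp only [hE, eq_comm (a := i), hs i j]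
  have pt : ∀ i j, (if i = j then a i ^ 2 * C i i else 0) - a i ^ 2 / 2 * E i j - a j ^ 2 / 2 * E i j ≤ a i * a j * C i j := by
    intro i j
    by_cases hij : i = j
    · subst hij
      simp only [hE, if_true]
      nlinarith
    · simp only [hE, hij, if_false]
      rcases abs_cases (C i j) with ⟨h1, h2⟩ | ⟨h1, h2⟩ <;> rw [h1] <;>
        nlinarith [sq_nonneg (a i + a j), sq_nonneg (a i - a j)]
  have s1 : ∑ i, ∑ j, ((if i = j then a i ^ 2 * C i i else 0) - a i ^ 2 / 2 * E i j - a j ^ 2 / 2 * E i j)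
      = ∑ i, a i ^ 2 * (C i i - ∑ j, E i j) := by
    simp only [Finset.sum_sub_distrib, Finset.sum_ite_eq, Finset.mem_univ, if_true, mul_sub]
    rw [Finset.sum_comm (f := fun i j => a j ^ 2 / 2 * E i j)]
    simp only [fun i j => Es j i]
    rw [sub_sub, ← Finset.sum_add_distrib]
    congr 1
    refine Finset.sum_congr rfl fun i _ => ?_
    rw [Finset.mul_sum, ← Finset.sum_add_distrib]
    exact Finset.sum_congr rfl fun j _ => by ring
  calc κ * ∑ i, a i ^ 2 ≤ ∑ i, a i ^ 2 * (C i i - ∑ j, E i j) := by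
        rw [Finset.mul_sum]
        refine Finset.sum_le_sum fun i _ => ?_
        have := h i
        nlinarith [sq_nonneg (a i)]
    _ = _ := s1.symm
    _ ≤ _ := Finset.sum_le_sum fun i _ => Finset.sum_le_sum fun j _ => pt i j

/-- fourth central difference of `|y|^w` -/
noncomputable def fd (w y : ℝ) : ℝ :=
  |y + 2| ^ w - 4 * |y + 1| ^ w + 6 * |y| ^ w - 4 * |y - 1| ^ w + |y - 2| ^ w

lemma fd_even (w y : ℝ) : fd w (-y) = fd w y := by
  unfold fd
  rw [show -y + 2 = -(y - 2) by ring, show -y + 1 = -(y - 1) by ring, show -y - 1 = -(y + 1) by ring,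
    show -y - 2 = -(y + 2) by ring]
  simp only [abs_neg]
  ring

lemma fd_bound {w y : ℝ} (hw0 : 0 < w) (hw : w ≤ 2) (hy : 4 ≤ |y|) : |fd w y| ≤ 48 / y ^ 2 := by
  wlog h : 0 ≤ y generalizing y
  · have := this (y := -y) (by rwa [abs_neg]) (by linarith)
    rwa [fd_even, neg_sq] at this
  rw [abs_of_nonneg h] at hy
  have := pow_sd4 hw0 hw hy
  convert! this using 2
  unfold fd sd
  rw [abs_of_nonneg (by linarith : 0 ≤ y + 2), abs_of_nonneg (by linarith : 0 ≤ y + 1), abs_of_nonneg h,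
    abs_of_nonneg (by linarith : 0 ≤ y - 1), abs_of_nonneg (by linarith : 0 ≤ y - 2)]
  ring_nf

lemma fd_zero {w : ℝ} (hw : 0 < w) : fd w 0 = 2 * 2 ^ w - 8 := by
  unfold fd
  simp [Real.zero_rpow hw.ne']
  ring

lemma sdsd_R {H K s t δ : ℝ} (hδ : 0 < δ) :
    sd δ (fun s => sd δ (fun t => Rbif H K s t) t) s =
      2 ^ (-K) * (sd δ (fun s => sd δ (fun t => (t ^ (2 * H) + s ^ (2 * H)) ^ K) t) s -
        δ ^ (2 * H * K) * fd (2 * H * K) ((t - s) / δ)) := by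
  have e : ∀ c : ℝ, |t - s + c * δ| ^ (2 * H * K) = δ ^ (2 * H * K) * |(t - s) / δ + c| ^ (2 * H * K) := by
    intro c
    rw [← Real.mul_rpow hδ.le (abs_nonneg _), ← abs_of_pos hδ, ← abs_mul, abs_of_pos hδ]
    congr 2
    field_simp
  have e0 := e 0
  have e1 := e 1
  have e2 := e 2
  have f1 := e (-1)
  have f2 := e (-2)
  rw [← sub_eq_add_neg] at f1 f2
  simp only [zero_mul, add_zero] at e0
  unfold fd
  simp only [mul_sub, mul_add, mul_left_comm (δ ^ (2 * H * K))]
  rw [← e0, ← e1, ← e2, ← f1, ← f2]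
  simp only [sd, Rbif]
  ring_nf

end BifChung

namespace BifChung

section
variable {Ω : Type*} [MeasurableSpace Ω] {μ : Measure Ω} {ι κ : Type*} [Fintype ι] [Fintype κ]

lemma IsGV.smul {Y : ι → Ω → ℝ} {C : ι → ι → ℝ} (h : IsGV μ Y C) (c : ℝ) :
    IsGV μ (fun i ω => c * Y i ω) (fun i j => c ^ 2 * C i j) := by
  refine ⟨fun i => (h.1 i).const_mul c, fun i j => by beta_reduce; rw [h.2.1], fun a => ?_⟩
  have := h.2.2 fun i => a i * c
  simp only [mul_assoc] at this ⊢
  rw [this]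
  congr 4
  simp only [qf]
  exact Finset.sum_congr rfl fun i _ => Finset.sum_congr rfl fun j _ => by ring

lemma IsGV.blk {Y : ι × κ → Ω → ℝ} {C : ι × κ → ι × κ → ℝ} (h : IsGV μ Y C) (w : κ → ℝ) :
    IsGV μ (fun i ω => ∑ e, w e * Y (i, e) ω) (fun i j => ∑ e, ∑ f, w e * w f * C (i, e) (j, f)) := by
  refine ⟨fun i => Finset.measurable_sum _ fun e _ => (h.1 _).const_mul _, fun i j => ?_, fun a => ?_⟩
  · beta_reduce
    rw [Finset.sum_comm]
    exact Finset.sum_congr rfl fun e _ => Finset.sum_congr rfl fun f _ => by rw [h.2.1]; ring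
  · have := h.2.2 fun p => a p.1 * w p.2
    rw [show (∫ ω, Complex.exp (((∑ i, a i * ∑ e, w e * Y (i, e) ω : ℝ) : ℂ) * Complex.I) ∂μ) =
      ∫ ω, Complex.exp (((∑ i : ι × κ, a i.1 * w i.2 * Y i ω : ℝ) : ℂ) * Complex.I) ∂μ from ?_, this]
    · congr 4
      simp only [qf, Fintype.sum_prod_type, Finset.mul_sum]
      refine Finset.sum_congr rfl fun i _ => ?_
      rw [Finset.sum_comm]
      exact Finset.sum_congr rfl fun j _ => Finset.sum_congr rfl fun e _ => Finset.sum_congr rfl fun f _ => by ring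
    · congr 1; ext ω
      simp only [Fintype.sum_prod_type, Finset.mul_sum, mul_assoc]

lemma gauss_third : ∫ x, Real.exp (-4 * x ^ 2) ∂(gaussianReal 0 1) = 1 / 3 := by
  rw [integral_gaussianReal_eq_integral_smul (by norm_num)]
  simp only [gaussianPDFReal, smul_eq_mul, mul_assoc, ← Real.exp_add]
  rw [integral_const_mul]
  have : ∀ x : ℝ, -(x - 0) ^ 2 / (2 * ((1 : NNReal) : ℝ)) + -(4 * x ^ 2) = -(9/2) * x ^ 2 := by
    intro x; push_cast; ring
  simp only [neg_mul, this]
  have h2 := integral_gaussian (9/2)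
  simp only [neg_mul] at h2
  rw [h2, ← Real.sqrt_inv, ← Real.sqrt_mul (by positivity)]
  rw [show (2 * (Real.pi * ((1 : NNReal) : ℝ)))⁻¹ * (Real.pi / (9/2)) = (1/3) ^ 2 by
    push_cast
    field_simp; norm_num]
  rw [Real.sqrt_sq (by norm_num)]

lemma gv_small [IsProbabilityMeasure μ] {Y : ι → Ω → ℝ} {C : ι → ι → ℝ} (h : IsGV μ Y C) {ε : ℝ} (hε : 0 < ε)
    (hC : ∀ a : ι → ℝ, 8 * ε ^ 2 * ∑ i, a i ^ 2 ≤ qf C a) :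
    μ.real {ω | ∀ i, |Y i ω| ≤ ε} ≤ Real.exp (-(Fintype.card ι : ℝ) / 2) := by
  classical
  obtain ⟨N, hN⟩ : ∃ N : ℝ, N = (Fintype.card ι : ℝ) := ⟨_, rfl⟩
  rw [← hN]
  set P : Measure (ι → ℝ) := Measure.pi fun _ => gaussianReal 0 1
  have hP : IsGV P (fun i x => x i) _ := isGV_pi
  have mY : Measurable fun ω i => Y i ω := h.meas
  -- step 1
  have cf : ∀ ω, ∫ x, Complex.exp (((∑ i, (Y i ω / ε) * x i : ℝ) : ℂ) * Complex.I) ∂P =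
      ((Real.exp (-(∑ i, (Y i ω / ε) ^ 2) / 2) : ℝ) : ℂ) := by
    intro ω
    have := hP.2.2 fun i => Y i ω / ε
    rw [this]
    congr 4
    simp [qf, sq]
  have cf2 : ∀ x : ι → ℝ, ∫ ω, Complex.exp (((∑ i, (Y i ω / ε) * x i : ℝ) : ℂ) * Complex.I) ∂μ =
      ((Real.exp (-(qf C fun i => x i / ε) / 2) : ℝ) : ℂ) := by
    intro x
    rw [← h.2.2 fun i => x i / ε]
    congr 1; ext ω
    congr 4
    ext i; ring
  have int : Integrable (Function.uncurry fun ω (x : ι → ℝ) => Complex.exp (((∑ i, (Y i ω / ε) * x i : ℝ) : ℂ) * Complex.I)) (μ.prod P) := by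
    refine Integrable.of_bound (C := 1) ?_ (ae_of_all _ fun p => ?_)
    · refine Measurable.aestronglyMeasurable ?_
      refine Complex.measurable_exp.comp (Measurable.mul_const (Complex.measurable_ofReal.comp ?_) _)
      refine Finset.measurable_sum _ fun i _ => ?_
      exact (((h.1 i).comp measurable_fst).div_const _).mul ((measurable_pi_apply i).comp measurable_snd)
    · simp only [Function.uncurry]
      rw [Complex.norm_exp_ofReal_mul_I]
  have fub := integral_integral_swap int
  simp only [cf, cf2] at fub
  rw [integral_complex_ofReal, integral_complex_ofReal, Complex.ofReal_inj] at fub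
  -- step 2
  have up : ∫ x, Real.exp (-(qf C fun i => x i / ε) / 2) ∂P ≤ (1/3) ^ (Fintype.card ι) := by
    rw [← gauss_third, ← integral_fintype_prod_eq_pow (ι := ι) (μ := gaussianReal 0 1)]
    refine integral_mono_of_nonneg (ae_of_all _ fun x => (Real.exp_pos _).le) ?_ (ae_of_all _ fun x => ?_)
    · refine Integrable.of_bound (C := 1) ?_ (ae_of_all _ fun x => ?_)
      · exact Continuous.aestronglyMeasurable (by fun_prop)
      · rw [Real.norm_of_nonneg (Finset.prod_nonneg fun i _ => (Real.exp_pos _).le)]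
        refine Finset.prod_le_one (fun i _ => (Real.exp_pos _).le) fun i _ => Real.exp_le_one_iff.2 (by nlinarith [sq_nonneg (x i)])
    · beta_reduce
      rw [← Real.exp_sum]
      refine Real.exp_le_exp.2 ?_
      have := hC fun i => x i / ε
      have e : 8 * ε ^ 2 * ∑ i, (x i / ε) ^ 2 = 8 * ∑ i, x i ^ 2 := by
        rw [mul_assoc, Finset.mul_sum]
        congr 1
        exact Finset.sum_congr rfl fun i _ => by field_simp
      rw [e] at this
      rw [← Finset.mul_sum]
      linarith
  have low : Real.exp (-N / 2) * μ.real {ω | ∀ i, |Y i ω| ≤ ε} ≤ ∫ ω, Real.exp (-(∑ i, (Y i ω / ε) ^ 2) / 2) ∂μ := by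
    have mS : MeasurableSet {ω | ∀ i, |Y i ω| ≤ ε} := by
      rw [Set.setOf_forall]
      exact MeasurableSet.iInter fun i => measurableSet_le (h.1 i).abs measurable_const
    rw [mul_comm, ← smul_eq_mul, ← integral_indicator_const _ mS]
    refine integral_mono_of_nonneg (ae_of_all _ fun ω => ?_) ?_ (ae_of_all _ fun ω => ?_)
    · exact Set.indicator_nonneg (fun _ _ => (Real.exp_pos _).le) _
    · refine Integrable.of_bound (C := 1) ?_ (ae_of_all _ fun ω => ?_)
      · refine Measurable.aestronglyMeasurable ?_
        refine Real.measurable_exp.comp (Measurable.div_const (Measurable.neg ?_) _)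
        exact Finset.measurable_sum _ fun i _ => ((h.1 i).div_const _).pow_const 2
      · rw [Real.norm_of_nonneg (Real.exp_pos _).le]
        have : 0 ≤ ∑ i, (Y i ω / ε) ^ 2 := Finset.sum_nonneg fun i _ => sq_nonneg _
        exact Real.exp_le_one_iff.2 (by linarith)
    · refine Set.indicator_apply_le' (fun hω => ?_) fun _ => (Real.exp_pos _).le
      refine Real.exp_le_exp.2 ?_
      have h' : ∀ i, |Y i ω| ≤ ε := hω
      have : ∑ i, (Y i ω / ε) ^ 2 ≤ ∑ i : ι, 1 := by
        refine Finset.sum_le_sum fun i _ => ?_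
        rw [div_pow, div_le_one (by positivity)]
        exact sq_le_sq' (abs_le.1 (h' i)).1 (abs_le.1 (h' i)).2
      simp only [Finset.sum_const, Finset.card_univ, nsmul_eq_mul, mul_one] at this
      rw [← hN] at this
      linarith
  have third : ((1:ℝ)/3) ^ (Fintype.card ι) ≤ Real.exp (-N) := by
    rw [hN, Real.exp_neg, ← Real.exp_one_rpow, Real.rpow_natCast, one_div, inv_pow]
    have := Real.exp_one_lt_three.le
    gcongr
  have : Real.exp (-N / 2) * μ.real {ω | ∀ i, |Y i ω| ≤ ε} ≤ Real.exp (-N / 2) * Real.exp (-N / 2) := by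
    rw [← Real.exp_add, show -N / 2 + -N / 2 = -N by ring]
    exact low.trans (fub.le.trans (up.trans third))
  exact le_of_mul_le_mul_left this (Real.exp_pos _)
end

section
variable {Ω : Type*} [MeasurableSpace Ω] {μ : Measure Ω} [IsProbabilityMeasure μ] {H K : ℝ} {X : ℝ → Ω → ℝ}

lemma IsX.scaled (h : IsX μ H K X) {r : ℝ} (hr : 0 < r) : IsX μ H K (fun t ω => r ^ (-(H * K)) * X (r * t) ω) := by
  refine ⟨fun t => (h.1 _).const_mul _, fun t ht => ?_⟩
  have := (h.gv (fun i => r * t i) fun i => mul_nonneg hr.le (ht i)).smul (r ^ (-(H * K)))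
  convert! this using 3 with i j
  rw [R_scale hr (ht _) (ht _), ← mul_assoc, ← Real.rpow_natCast, ← Real.rpow_mul hr.le, ← Real.rpow_add hr]
  rw [show -(H * K) * ((2:ℕ):ℝ) + 2 * H * K = 0 by push_cast; ring, Real.rpow_zero, one_mul]

lemma IsX.sd_gv (h : IsX μ H K X) {ι : Type} [Fintype ι] (t : ι → ℝ) (ht : ∀ i, 0 ≤ t i) {δ : ℝ} (hδ : 0 ≤ δ) :
    IsGV μ (fun i ω => sd δ (fun s => X s ω) (t i))
      (fun i j => sd δ (fun s => sd δ (fun t => Rbif H K s t) (t j)) (t i)) := by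
  have := (h.gv (fun p : ι × Fin 3 => t p.1 + (p.2 : ℕ) * δ) fun p => add_nonneg (ht _) (by positivity)).blk ![1, -2, 1]
  convert! this using 3 with i ω i j
  · simp [Fin.sum_univ_three, sd]; ring
  · simp [Fin.sum_univ_three, sd]; ring
end
end BifChung

namespace BifChung
variable {Ω : Type*} [MeasurableSpace Ω] {μ : Measure Ω} [IsProbabilityMeasure μ] {H K : ℝ} {X : ℝ → Ω → ℝ}

lemma cov_dom (hH : 0 < H) (hH1 : H < 1) (hK : 0 < K) (hK1 : K ≤ 1) {η : ℝ} (hη : 0 < η)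
    (hη' : 2 * η ≤ 8 - 2 * 2 ^ (2 * H * K)) {M N : ℕ} (hM : 4 ≤ M) (hM2 : 192 / (M:ℝ) ^ 2 ≤ η / 2)
    (hN : 1 ≤ N) (hMN : 24000 / ((M:ℝ) * N) ≤ η / 2) {δ : ℝ} (hδ : δ = 1 / ((M:ℝ) * N)) (a : Fin N → ℝ) :
    2 ^ (-K) * δ ^ (2 * H * K) * η * ∑ i, a i ^ 2 ≤
      qf (fun i j : Fin N => sd δ (fun s => sd δ (fun t => Rbif H K s t) (1 + (j:ℕ) / (N:ℝ))) (1 + (i:ℕ) / (N:ℝ))) a := by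
  have N0 : (1:ℝ) ≤ N := by exact_mod_cast hN
  have M0 : (4:ℝ) ≤ M := by exact_mod_cast hM
  have hHK : 0 < H * K := by positivity
  have hHK1 : H * K < 1 := by nlinarith
  set w := 2 * H * K with hw
  have w0 : 0 < w := by positivity
  have w2 : w ≤ 2 := by nlinarith
  have MN : (4:ℝ) ≤ (M:ℝ) * N := by nlinarith
  have d0 : 0 < δ := by rw [hδ]; positivity
  have d1 : δ ≤ 1 / 4 := by rw [hδ]; gcongr
  have Nd : N * δ ≤ 1 := by
    rw [hδ]; field_simp; linarith
  have dw : 0 < δ ^ w := Real.rpow_pos_of_pos d0 _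
  have dw2 : δ ^ 2 ≤ δ ^ w := by
    rw [← Real.rpow_natCast]
    exact Real.rpow_le_rpow_of_exponent_ge d0 (by linarith) (by simpa using w2)
  have p0 : (0:ℝ) < 2 ^ (-K) := by positivity
  have tpos : ∀ i : Fin N, (1:ℝ) ≤ 1 + (i:ℕ) / (N:ℝ) := fun i => le_add_of_nonneg_right (by positivity)
  have tle : ∀ i : Fin N, 1 + (i:ℕ) / (N:ℝ) + 2 * δ ≤ 3 := fun i => by
    have : ((i:ℕ):ℝ) / (N:ℝ) ≤ 1 := by
      rw [div_le_one (by linarith)]; exact_mod_cast i.2.le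
    linarith
  set S : Fin N → Fin N → ℝ := fun i j => sd δ (fun s => sd δ (fun t => (t ^ (2 * H) + s ^ (2 * H)) ^ K) (1 + (j:ℕ) / (N:ℝ))) (1 + (i:ℕ) / (N:ℝ)) with hS
  have Sb : ∀ i j, |S i j| ≤ 12000 * δ ^ 4 := fun i j =>
    smooth_sd d0.le (tpos j) (tle j) (tpos i) (tle i) (by linarith) (by linarith) hK hK1
  have Ceq : ∀ i j : Fin N, sd δ (fun s => sd δ (fun t => Rbif H K s t) (1 + (j:ℕ) / (N:ℝ))) (1 + (i:ℕ) / (N:ℝ)) =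
      2 ^ (-K) * (S i j - δ ^ w * fd w (((j:ℝ) - i) * M)) := by
    intro i j
    rw [sdsd_R d0]
    congr 4
    rw [hδ]; field_simp; ring
  simp only [Ceq]
  refine diag_dom ?_ ?_ a
  · intro i j
    have e1 : S i j = S j i := by
      have : (fun s t : ℝ => (t ^ (2 * H) + s ^ (2 * H)) ^ K) = (fun s t : ℝ => (s ^ (2 * H) + t ^ (2 * H)) ^ K) := by
        ext s t; rw [add_comm]
      simp only [hS, sd]
      ring_nf
    rw [e1, show ((j:ℝ) - i) * M = -(((i:ℝ) - j) * M) by ring, fd_even]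
  · intro i
    have offd : ∀ j, (if i = j then 0 else |2 ^ (-K) * (S i j - δ ^ w * fd w (((j:ℝ) - i) * M))|) ≤
        2 ^ (-K) * (12000 * δ ^ 4 + δ ^ w * (48 / (M:ℝ) ^ 2) * (if i = j then (0:ℝ) else 1 / ((j:ℝ) - i) ^ 2)) := by
      intro j
      by_cases hij : i = j
      · simp only [hij, if_true]; positivity
      · simp only [hij, if_false]
        rw [abs_mul, abs_of_pos p0]
        have hz : (1:ℝ) ≤ |(j:ℝ) - i| := by
          have : (1:ℤ) ≤ |((j:ℕ):ℤ) - (i:ℕ)| := Int.one_le_abs (sub_ne_zero.2 fun h => hij (Fin.ext (by exact_mod_cast h.symm)))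
          exact_mod_cast this
        have fb := fd_bound w0 w2 (y := ((j:ℝ) - i) * M) (by
          rw [abs_mul, abs_of_nonneg (by linarith : (0:ℝ) ≤ M)]; nlinarith)
        have : |S i j - δ ^ w * fd w (((j:ℝ) - i) * M)| ≤ 12000 * δ ^ 4 + δ ^ w * (48 / (((j:ℝ) - i) * M) ^ 2) := by
          refine (abs_sub _ _).trans (add_le_add (Sb i j) ?_)
          rw [abs_mul, abs_of_pos dw]
          gcongr
        refine (mul_le_mul_of_nonneg_left this p0.le).trans (le_of_eq ?_)
        rw [mul_pow]; field_simp
    refine (Finset.sum_le_sum fun j _ => offd j).trans ?_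
    rw [← Finset.mul_sum, Finset.sum_add_distrib, Finset.sum_const, Finset.card_univ, Fintype.card_fin, nsmul_eq_mul, ← Finset.mul_sum]
    have s4 := sum_inv_sq N i
    have f0 : fd w (((i:ℝ) - i) * M) = 2 * 2 ^ w - 8 := by rw [sub_self, zero_mul, fd_zero w0]
    rw [f0]
    have key : N * (12000 * δ ^ 4) + δ ^ w * (48 / (M:ℝ) ^ 2) * ∑ j : Fin N, (if i = j then (0:ℝ) else 1 / ((j:ℝ) - i) ^ 2)
        ≤ S i i - δ ^ w * (2 * 2 ^ w - 8) - δ ^ w * η := by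
      have a1 : δ ^ w * (48 / (M:ℝ) ^ 2) * ∑ j : Fin N, (if i = j then (0:ℝ) else 1 / ((j:ℝ) - i) ^ 2) ≤ δ ^ w * (48 / (M:ℝ) ^ 2) * 4 := by
        gcongr
      have a2 : δ ^ w * (48 / (M:ℝ) ^ 2) * 4 ≤ δ ^ w * (η / 2) := by
        rw [mul_assoc]
        gcongr
        calc _ = 192 / (M:ℝ) ^ 2 := by ring
          _ ≤ _ := hM2
      have a3 := (abs_le.1 (Sb i i)).1
      have a4 : 24000 * N * δ ^ 4 ≤ δ ^ w * (η / 2) := by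
        calc 24000 * N * δ ^ 4 = (N * δ) * ((24000 * δ) * δ ^ 2) := by ring
          _ ≤ 1 * ((η / 2) * δ ^ w) := by
              gcongr
              rw [hδ]
              calc _ = 24000 / ((M:ℝ) * N) := by ring
                _ ≤ _ := hMN
          _ = _ := by ring
      have a5 : δ ^ w * (2 * η) ≤ δ ^ w * (8 - 2 * 2 ^ w) := by gcongr
      have a6 : δ ^ 4 ≤ N * δ ^ 4 := le_mul_of_one_le_left (by positivity) N0
      linarith
    calc _ ≤ 2 ^ (-K) * (S i i - δ ^ w * (2 * 2 ^ w - 8) - δ ^ w * η) := mul_le_mul_of_nonneg_left key p0.le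
      _ = _ := by ring

lemma small_ball_upper (hH : 0 < H) (hH1 : H < 1) (hK : 0 < K) (hK1 : K ≤ 1) :
    ∃ c0 : ℝ, 0 < c0 ∧ ∃ N0 : ℕ, ∀ X : ℝ → Ω → ℝ, IsX μ H K X → ∀ N : ℕ, N0 ≤ N →
      μ.real {ω | ∀ q : ℚ, 0 ≤ q → q ≤ 3 → |X q ω| ≤ c0 * (N:ℝ) ^ (-(H * K))} ≤ Real.exp (-(N:ℝ) / 2) := by
  have hHK : 0 < H * K := by positivity
  have hHK1 : H * K < 1 := by nlinarith
  obtain ⟨η, hη, hη'⟩ : ∃ η : ℝ, 0 < η ∧ 2 * η ≤ 8 - 2 * 2 ^ (2 * H * K) := by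
    refine ⟨4 - 2 ^ (2 * H * K), ?_, by linarith⟩
    have : (2:ℝ) ^ (2 * H * K) < 2 ^ (2:ℝ) := Real.rpow_lt_rpow_of_exponent_lt (by norm_num) (by linarith)
    norm_num at this
    linarith
  obtain ⟨M, hM⟩ := exists_nat_ge (max 4 (384 / η))
  have M4 : (4:ℝ) ≤ M := (le_max_left _ _).trans hM
  have M4' : 4 ≤ M := by exact_mod_cast M4
  have hM2 : 192 / (M:ℝ) ^ 2 ≤ η / 2 := by
    have h1 : 384 / η ≤ M := (le_max_right _ _).trans hM
    rw [div_le_iff₀ hη] at h1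
    rw [div_le_iff₀ (by positivity)]
    nlinarith [mul_nonneg hη.le (by nlinarith : (0:ℝ) ≤ (M:ℝ)^2 - M)]
  obtain ⟨N0, hN0⟩ := exists_nat_ge (max 1 (48000 / η))
  set c0 := Real.sqrt (2 ^ (-K) * η * (M:ℝ) ^ (-(2 * H * K)) / 128) with hc0
  have c0pos : 0 < c0 := Real.sqrt_pos.2 (by positivity)
  have c0sq : c0 ^ 2 = 2 ^ (-K) * η * (M:ℝ) ^ (-(2 * H * K)) / 128 := Real.sq_sqrt (by positivity)
  refine ⟨c0, c0pos, N0, fun X hX N hN => ?_⟩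
  have N1 : (1:ℝ) ≤ N := (le_max_left _ _).trans (hN0.trans (by exact_mod_cast hN))
  have N1' : 1 ≤ N := by exact_mod_cast N1
  have hMN : 24000 / ((M:ℝ) * N) ≤ η / 2 := by
    have h1 : 48000 / η ≤ N := (le_max_right _ _).trans (hN0.trans (by exact_mod_cast hN))
    rw [div_le_iff₀ hη] at h1
    rw [div_le_iff₀ (by positivity)]
    nlinarith [mul_nonneg hη.le (by nlinarith : (0:ℝ) ≤ (M:ℝ) * N - N)]
  set δ := 1 / ((M:ℝ) * N) with hδ
  have d0 : 0 < δ := by positivity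
  have gv := hX.sd_gv (fun i : Fin N => 1 + (i:ℕ) / (N:ℝ)) (fun i => by positivity) d0.le
  have ε0 : 0 < 4 * (c0 * (N:ℝ) ^ (-(H * K))) := by positivity
  have := gv_small gv ε0 (fun a => by
    refine le_trans (le_of_eq ?_) (cov_dom hH hH1 hK hK1 hη hη' M4' hM2 N1' hMN hδ a)
    congr 1
    have n2 : ((N:ℝ) ^ (-(H * K))) ^ 2 = (N:ℝ) ^ (-(2 * H * K)) := by
      rw [← Real.rpow_natCast, ← Real.rpow_mul (by positivity)]
      congr 1; push_cast; ring
    have m2 : δ ^ (2 * H * K) = (M:ℝ) ^ (-(2 * H * K)) * (N:ℝ) ^ (-(2 * H * K)) := by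
      rw [hδ, one_div, Real.inv_rpow (by positivity), ← Real.rpow_neg (by positivity), Real.mul_rpow (by positivity) (by positivity)]
    rw [mul_pow, mul_pow, c0sq, n2, m2]
    ring)
  rw [Fintype.card_fin] at this
  refine le_trans (measureReal_mono ?_) this
  intro ω hω
  have h' : ∀ q : ℚ, 0 ≤ q → q ≤ 3 → |X q ω| ≤ c0 * (N:ℝ) ^ (-(H * K)) := hω
  intro i
  have iN : ((i:ℕ):ℚ) / N ≤ 1 := by
    rw [div_le_one (by exact_mod_cast N1')]; exact_mod_cast i.2.le
  have dq : (1:ℚ) / (M * N) ≤ 1 / 4 := by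
    have : (4:ℚ) ≤ M * N := by exact_mod_cast (by nlinarith : 4 ≤ M * N)
    gcongr
  have q0 := h' (1 + (i:ℕ) / N) (by positivity) (by linarith)
  have q1 := h' (1 + (i:ℕ) / N + 1 / (M * N)) (by positivity) (by linarith)
  have q2 := h' (1 + (i:ℕ) / N + 2 * (1 / (M * N))) (by positivity) (by linarith)
  push_cast at q0 q1 q2
  rw [← hδ] at q1 q2
  unfold sd
  beta_reduce
  rw [abs_le] at q0 q1 q2 ⊢
  constructor <;> linarith [q0.1, q0.2, q1.1, q1.2, q2.1, q2.2]
end BifChung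

namespace BifChung

noncomputable def phi (h r : ℝ) : ℝ := r ^ h / Real.log (Real.log (1 / r)) ^ h

lemma phi_comp {h : ℝ} (hh : 0 < h) : ∀ᶠ n : ℕ in atTop, ∀ r : ℝ, 3 * (1/2:ℝ) ^ n ≤ r → r < 6 * (1/2:ℝ) ^ n →
    (60:ℝ) ^ (-h) * phi h r ≤ ((1/2:ℝ) ^ n) ^ h * ((⌈4 * Real.log n⌉₊ : ℕ) : ℝ) ^ (-h) := by
  filter_upwards [eventually_ge_atTop 100] with n hn r hr1 hr2
  have n0 : (100:ℝ) ≤ n := by exact_mod_cast hn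
  have p0 : (0:ℝ) < (1/2:ℝ) ^ n := by positivity
  have r0 : 0 < r := by linarith
  have l2 := Real.log_two_gt_d9
  have hlog : Real.sqrt n ≤ Real.log (1 / r) := by
    have h1 : Real.log (1 / (6 * (1/2:ℝ) ^ n)) ≤ Real.log (1 / r) := by
      apply Real.log_le_log (by positivity)
      gcongr
    have h2 : Real.log (1 / (6 * (1/2:ℝ) ^ n)) = n * Real.log 2 - Real.log 6 := by
      rw [Real.log_div (by norm_num) (by positivity), Real.log_mul (by norm_num) (by positivity), Real.log_pow, Real.log_div (by norm_num) (by norm_num)]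
      simp
      ring
    have h3 : Real.log 6 ≤ 5 := by
      have := Real.log_le_sub_one_of_pos (show (0:ℝ) < 6 by norm_num)
      linarith
    have h4 : Real.sqrt n ≤ n / 2 := by
      rw [Real.sqrt_le_left (by positivity)]
      nlinarith
    nlinarith
  have sq1 : 1 < Real.sqrt n := by
    rw [Real.lt_sqrt (by norm_num)]; linarith
  have hll : Real.log n / 2 ≤ Real.log (Real.log (1 / r)) := by
    rw [← Real.log_sqrt (by positivity)]
    exact Real.log_le_log (by linarith) hlog
  have ln1 : 1 ≤ Real.log n := by
    rw [Real.le_log_iff_exp_le (by linarith)]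
    linarith [Real.exp_one_lt_three]
  have ll0 : 0 < Real.log (Real.log (1 / r)) := by linarith
  have c1 : ((⌈4 * Real.log n⌉₊ : ℕ) : ℝ) ≤ 10 * Real.log (Real.log (1 / r)) := by
    have := Nat.ceil_lt_add_one (show 0 ≤ 4 * Real.log n by linarith)
    linarith
  have c0 : 0 < ((⌈4 * Real.log n⌉₊ : ℕ) : ℝ) := by
    exact_mod_cast Nat.ceil_pos.2 (by linarith)
  unfold phi
  rw [Real.rpow_neg (by norm_num), Real.rpow_neg c0.le, ← div_eq_mul_inv, ← Real.inv_rpow (by norm_num)]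
  rw [← Real.div_rpow r0.le ll0.le, ← Real.div_rpow p0.le c0.le, ← Real.mul_rpow (by norm_num) (by positivity)]
  refine Real.rpow_le_rpow (by positivity) ?_ hh.le
  rw [inv_mul_le_iff₀ (by norm_num), div_le_iff₀ ll0]
  rw [← mul_div_assoc, div_mul_eq_mul_div, le_div_iff₀ c0]
  nlinarith

variable {Ω : Type*} [MeasurableSpace Ω] {μ : Measure Ω} [IsProbabilityMeasure μ] {H K : ℝ}

lemma bc {E : ℕ → Set Ω} {f : ℕ → ℝ} (hf : Summable f) (h : ∀ᶠ n in atTop, μ.real (E n) ≤ f n) :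
    ∀ᵐ ω ∂μ, ∀ᶠ n in atTop, ω ∉ E n := by
  obtain ⟨n0, hn0⟩ := eventually_atTop.1 h
  have : ∑' n, μ (E (n + n0)) ≠ ⊤ := by
    have hs : Summable fun n => f (n + n0) := (summable_nat_add_iff n0).2 hf
    have f0 : ∀ n, 0 ≤ f (n + n0) := fun n => measureReal_nonneg.trans (hn0 _ (by omega))
    refine ne_top_of_le_ne_top hs.tsum_ofReal_ne_top (ENNReal.tsum_le_tsum fun n => ?_)
    rw [← ofReal_measureReal]
    exact ENNReal.ofReal_le_ofReal (hn0 _ (by omega))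
  filter_upwards [ae_eventually_notMem this] with ω hω
  obtain ⟨n1, h1⟩ := eventually_atTop.1 hω
  refine eventually_atTop.2 ⟨n1 + n0, fun n hn => ?_⟩
  have := h1 (n - n0) (by omega)
  rwa [Nat.sub_add_cancel (by omega)] at this

lemma lower_ae (hH : 0 < H) (hH1 : H < 1) (hK : 0 < K) (hK1 : K ≤ 1) :
    ∃ κ : ℝ, 0 < κ ∧ ∀ X : ℝ → Ω → ℝ, IsX μ H K X → ∀ᵐ ω ∂μ, ∀ᶠ r in 𝓝[>] (0:ℝ),
      ∃ q : ℚ, 0 ≤ q ∧ (q:ℝ) ≤ r ∧ κ * phi (H * K) r < |X q ω| := by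
  obtain ⟨c0, c0pos, N0, hc⟩ := small_ball_upper (μ := μ) hH hH1 hK hK1
  have hHK : 0 < H * K := by positivity
  refine ⟨c0 * 60 ^ (-(H * K)), by positivity, fun X hX => ?_⟩
  have bc1 := bc (μ := μ) (E := fun n : ℕ => {ω | ∀ q : ℚ, 0 ≤ q → q ≤ 3 →
      |((1/2:ℝ) ^ n) ^ (-(H * K)) * X ((1/2:ℝ) ^ n * q) ω| ≤ c0 * ((⌈4 * Real.log n⌉₊ : ℕ) : ℝ) ^ (-(H * K))})
      (f := fun n : ℕ => 1 / (n:ℝ) ^ 2) (Real.summable_one_div_nat_pow.2 (by norm_num)) ?_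
  · filter_upwards [bc1] with ω hω
    obtain ⟨n0, hn0⟩ := eventually_atTop.1 (hω.and (phi_comp hHK))
    have : Set.Ioo (0:ℝ) (3 * (1/2:ℝ) ^ n0) ∈ 𝓝[>] (0:ℝ) := Ioo_mem_nhdsGT (by positivity)
    filter_upwards [this] with r hr
    have ex : ∃ n : ℕ, 3 * (1/2:ℝ) ^ n ≤ r := by
      obtain ⟨n, hn⟩ := exists_pow_lt_of_lt_one (show 0 < r / 3 by linarith [hr.1]) (show (1/2:ℝ) < 1 by norm_num)
      exact ⟨n, by linarith⟩
    classical
    set n := Nat.find ex with hn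
    have n1 : 3 * (1/2:ℝ) ^ n ≤ r := Nat.find_spec ex
    have n2 : n0 < n := by
      by_contra hlt
      have : (1/2:ℝ) ^ n0 ≤ (1/2:ℝ) ^ n := pow_le_pow_of_le_one (by norm_num) (by norm_num) (by omega)
      linarith [hr.2]
    have n3 : r < 6 * (1/2:ℝ) ^ n := by
      have := Nat.find_min ex (show n - 1 < n by omega)
      push Not at this
      have e : (1/2:ℝ) ^ (n - 1) = 2 * (1/2:ℝ) ^ n := by
        conv_rhs => rw [show n = (n - 1) + 1 by omega, pow_succ]
        ring
      rw [e] at this; linarith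
    obtain ⟨h1, h2⟩ := hn0 n n2.le
    have h3 := h2 r n1 n3
    have p0 : (0:ℝ) < (1/2:ℝ) ^ n := by positivity
    have h1' : ¬ ∀ q : ℚ, 0 ≤ q → q ≤ 3 →
      |((1/2:ℝ) ^ n) ^ (-(H * K)) * X ((1/2:ℝ) ^ n * q) ω| ≤ c0 * ((⌈4 * Real.log n⌉₊ : ℕ) : ℝ) ^ (-(H * K)) := h1
    push Not at h1'
    obtain ⟨q, q0, q3, hq⟩ := h1'
    have q3' : (q:ℝ) ≤ 3 := by exact_mod_cast q3
    refine ⟨(1/2) ^ n * q, by positivity, ?_, ?_⟩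
    · push_cast
      nlinarith
    · push_cast
      rw [abs_mul, abs_of_pos (Real.rpow_pos_of_pos p0 _), Real.rpow_neg p0.le, ← div_eq_inv_mul, lt_div_iff₀ (Real.rpow_pos_of_pos p0 _)] at hq
      refine lt_of_le_of_lt ?_ hq
      rw [mul_assoc]
      calc c0 * (60 ^ (-(H * K)) * phi (H * K) r) ≤ c0 * (((1/2:ℝ) ^ n) ^ (H * K) * ((⌈4 * Real.log n⌉₊ : ℕ) : ℝ) ^ (-(H * K))) := by gcongr
        _ = _ := by ring
  · have tl : Tendsto (fun n : ℕ => 4 * Real.log n) atTop atTop :=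
      (Real.tendsto_log_atTop.comp tendsto_natCast_atTop_atTop).const_mul_atTop (by norm_num)
    filter_upwards [tl.eventually_ge_atTop (N0:ℝ), eventually_ge_atTop 1] with n hn n1
    have p0 : (0:ℝ) < (1/2:ℝ) ^ n := by positivity
    have n1' : (1:ℝ) ≤ n := by exact_mod_cast n1
    refine (hc _ (hX.scaled p0) ⌈4 * Real.log n⌉₊ (by exact_mod_cast hn.trans (Nat.le_ceil _))).trans ?_
    rw [one_div, ← Real.exp_log (show 0 < (n:ℝ) ^ 2 by positivity), ← Real.exp_neg, Real.log_pow]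
    refine Real.exp_le_exp.2 ?_
    have := Nat.le_ceil (4 * Real.log n)
    push_cast; linarith
end BifChung

namespace BifChung

lemma chain {f : ℝ → ℝ} {β : ℕ → ℝ} {A : ℝ} {n0 : ℕ} (hβ : ∀ k, 0 ≤ β k)
    (h0 : ∀ j : ℕ, j ≤ 2 ^ n0 → |f (j / 2 ^ n0)| ≤ A) (d : ℕ)
    (h : ∀ k, n0 < k → k ≤ n0 + d → ∀ j : ℕ, j < 2 ^ k → |f ((2 * j + 1) / 2 ^ k) - f (2 * j / 2 ^ k)| ≤ β k) :
    ∀ j : ℕ, j ≤ 2 ^ (n0 + d) → |f (j / 2 ^ (n0 + d))| ≤ A + ∑ k ∈ Finset.Ioc n0 (n0 + d), β k := by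
  induction d with
  | zero => simpa using h0
  | succ d ih =>
    have ih' := ih fun k h1 h2 => h k h1 (by omega)
    have e : Finset.Ioc n0 (n0 + (d + 1)) = insert (n0 + (d + 1)) (Finset.Ioc n0 (n0 + d)) := by
      ext x; simp; omega
    rw [e, Finset.sum_insert (by simp)]
    intro j hj
    have b0 := hβ (n0 + (d + 1))
    have half : ∀ i : ℕ, (2 * (i:ℝ)) / 2 ^ (n0 + (d + 1)) = i / 2 ^ (n0 + d) := by
      intro i; rw [← add_assoc, pow_succ]; field_simp
    obtain ⟨i, rfl | rfl⟩ := Nat.even_or_odd' j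
    · have := ih' i (by rw [← add_assoc, pow_succ] at hj; omega)
      push_cast
      rw [half]; linarith
    · have hi : i < 2 ^ (n0 + d) := by rw [← add_assoc, pow_succ] at hj; omega
      have h1 := ih' i hi.le
      have h2 := h (n0 + (d + 1)) (by omega) le_rfl i (by omega)
      rw [half] at h2
      push_cast
      have := abs_sub_abs_le_abs_sub (f ((2 * (i:ℝ) + 1) / 2 ^ (n0 + (d + 1)))) (f ((i:ℝ) / 2 ^ (n0 + d)))
      linarith

lemma updown {a b : ℕ → ℝ} (ha : Summable a) (hb : Summable b) (a0 : ∀ i, 0 ≤ a i) (b0 : ∀ i, 0 ≤ b i) (m n : ℕ) :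
    ∑ k ∈ Finset.range n, (if k ≤ m then a (m - k) else b (k - m)) ≤ ∑' i, a i + ∑' i, b i := by
  rw [Finset.sum_ite]
  refine add_le_add ?_ ?_
  · rw [← Finset.sum_image (s := (Finset.range n).filter fun k => k ≤ m) (g := fun k => m - k) (f := a)]
    · exact ha.sum_le_tsum _ fun i _ => a0 i
    · intro x hx y hy hxy
      simp only [Finset.coe_filter, Set.mem_ofPred_eq] at hx hy
      simp only at hxy; omega
  · rw [← Finset.sum_image (s := (Finset.range n).filter fun k => ¬ k ≤ m) (g := fun k => k - m) (f := b)]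
    · exact hb.sum_le_tsum _ fun i _ => b0 i
    · intro x hx y hy hxy
      simp only [Finset.coe_filter, Set.mem_ofPred_eq] at hx hy
      simp only at hxy; omega

variable {Ω : Type*} [MeasurableSpace Ω] {μ : Measure Ω} [IsProbabilityMeasure μ] {H K : ℝ} {X : ℝ → Ω → ℝ}

lemma IsX.incr_gv (h : IsX μ H K X) {ι : Type} [Fintype ι] (s t : ι → ℝ) (hs : ∀ i, 0 ≤ s i) (ht : ∀ i, 0 ≤ t i) :
    ∃ C : ι → ι → ℝ, IsGV μ (fun i ω => X (t i) ω - X (s i) ω) C ∧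
      ∀ i, C i i = Rbif H K (t i) (t i) + Rbif H K (s i) (s i) - 2 * Rbif H K (s i) (t i) := by
  have := (h.gv (fun p : ι × Fin 2 => if p.2 = 0 then t p.1 else s p.1) fun p => by
    split_ifs; exacts [ht _, hs _]).blk ![1, -1]
  refine ⟨fun i j => ∑ e : Fin 2, ∑ f : Fin 2, ![(1:ℝ), -1] e * ![(1:ℝ), -1] f *
    Rbif H K (if e = 0 then t i else s i) (if f = 0 then t j else s j), ?_, ?_⟩
  · convert! this using 3 with i ω
    simp [Fin.sum_univ_two]; ring
  · intro i
    simp [Fin.sum_univ_two]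
    rw [R_symm _ _ (t i) (s i)]; ring

lemma IsX.zero_ae (h : IsX μ H K X) (hH : 0 < H) (hK : 0 < K) : ∀ᵐ ω ∂μ, X 0 ω = 0 := by
  have h1 := (h.gv (fun _ : Fin 1 => (0:ℝ)) fun _ => le_rfl).marg 0
  have e : Rbif H K 0 0 = 0 := by
    rw [R_diag hH hK le_rfl, Real.zero_rpow (by positivity)]
  simp only [e, Real.toNNReal_zero, gaussianReal_zero_var] at h1
  have := ae_of_ae_map (p := fun x => x = 0) (h.1 0).aemeasurable (by rw [h1.1]; simp [ae_dirac_eq])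
  exact this
/-- level-`k` standard deviation bound -/
noncomputable def sg (h : ℝ) (k : ℕ) : ℝ := Real.sqrt 2 * ((1/2:ℝ) ^ h) ^ k

lemma sg_pos (h : ℝ) (k : ℕ) : 0 < sg h k := by unfold sg; positivity

lemma dy_var (hH : 0 < H) (hK : 0 < K) (hK1 : K ≤ 1) (k j : ℕ) :
    Rbif H K ((2 * j + 1) / 2 ^ k) ((2 * j + 1) / 2 ^ k) + Rbif H K (2 * j / 2 ^ k) (2 * j / 2 ^ k) -
      2 * Rbif H K (2 * j / 2 ^ k) ((2 * j + 1) / 2 ^ k) ≤ sg (H * K) k ^ 2 := by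
  refine (R_incr hH hK hK1 (by positivity) (by positivity)).trans (le_of_eq ?_)
  rw [show (2 * (j:ℝ) + 1) / 2 ^ k - 2 * j / 2 ^ k = (1/2) ^ k by rw [one_div, inv_pow]; field_simp; ring,
    abs_of_pos (by positivity), sg, mul_pow, Real.sq_sqrt (by norm_num), ← pow_mul, ← Real.rpow_natCast, ← Real.rpow_natCast,
    ← Real.rpow_mul (by norm_num), ← Real.rpow_mul (by norm_num)]
  congr 2
  push_cast; ring

/-- all dyadic increments up to level `n` -/
lemma IsX.dy_gv (h : IsX μ H K X) (hH : 0 < H) (hK : 0 < K) (hK1 : K ≤ 1) (s : Finset ℕ) :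
    ∃ C, IsGV μ (fun (p : (Σ k : s, Fin (2 ^ (k:ℕ)))) ω =>
      X ((2 * (p.2:ℕ) + 1) / 2 ^ (p.1:ℕ)) ω - X (2 * (p.2:ℕ) / 2 ^ (p.1:ℕ)) ω) C ∧
      ∀ p, C p p ≤ sg (H * K) p.1 ^ 2 := by
  obtain ⟨C, h1, h2⟩ := h.incr_gv (fun (p : (Σ k : s, Fin (2 ^ (k:ℕ)))) => 2 * (p.2:ℕ) / 2 ^ (p.1:ℕ))
    (fun p => (2 * (p.2:ℕ) + 1) / 2 ^ (p.1:ℕ)) (fun p => by positivity) (fun p => by positivity)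
  refine ⟨C, h1, fun p => ?_⟩
  rw [h2]
  exact dy_var hH hK hK1 _ _

lemma zeta_lt {h : ℝ} (hh : 0 < h) (hh1 : h < 1) : 1/2 < (1/2:ℝ) ^ h ∧ (1/2:ℝ) ^ h < 1 := by
  constructor
  · calc (1/2:ℝ) = (1/2:ℝ) ^ (1:ℝ) := by simp
      _ < _ := Real.rpow_lt_rpow_of_exponent_gt (by norm_num) (by norm_num) hh1
  · exact Real.rpow_lt_one (by norm_num) (by norm_num) hh

lemma small_ball_lower (hH : 0 < H) (hH1 : H < 1) (hK : 0 < K) (hK1 : K ≤ 1) :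
    ∃ C1 C2 : ℝ, 0 < C1 ∧ 0 < C2 ∧ ∀ X : ℝ → Ω → ℝ, IsX μ H K X → ∀ n m : ℕ,
      Real.exp (-C2 * 2 ^ m) ≤ μ.real {ω | ∀ j : ℕ, j ≤ 2 ^ n → |X (j / 2 ^ n) ω| ≤ C1 * ((1/2:ℝ) ^ (H * K)) ^ m} := by
  have hHK : 0 < H * K := by positivity
  have hHK1 : H * K < 1 := by nlinarith
  obtain ⟨z1, z2⟩ := zeta_lt hHK hHK1
  set z := (1/2:ℝ) ^ (H * K) with hz
  have z0 : 0 < z := by linarith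
  have sa : Summable fun i : ℕ => Real.log 4 * (i + 1) * (1/2:ℝ) ^ i := by
    have := (summable_pow_mul_geometric_of_norm_lt_one 1 (r := (1/2:ℝ)) (by norm_num)).add
      (summable_geometric_of_norm_lt_one (x := (1/2:ℝ)) (by norm_num))
    refine (this.mul_left (Real.log 4)).congr fun i => ?_
    simp; ring
  have sb : Summable fun i : ℕ => (1/2:ℝ) ^ i := summable_geometric_of_norm_lt_one (by norm_num)
  have sa' : Summable fun i : ℕ => (z⁻¹ / 4) ^ i := by
    refine summable_geometric_of_norm_lt_one ?_
    rw [Real.norm_of_nonneg (by positivity), div_lt_one (by norm_num), inv_lt_iff_one_lt_mul₀ z0]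
    linarith
  have sb' : Summable fun i : ℕ => (2 * (i:ℝ) + 2) * z ^ i := by
    have zn : ‖z‖ < 1 := by rwa [Real.norm_of_nonneg z0.le]
    have := (summable_pow_mul_geometric_of_norm_lt_one 1 (r := z) zn).add (summable_geometric_of_norm_lt_one zn)
    refine (this.mul_left 2).congr fun i => ?_
    simp; ring
  have l4 : 0 < Real.log 4 := Real.log_pos (by norm_num)
  have A0 : 0 ≤ ∑' i : ℕ, Real.log 4 * (i + 1) * (1/2:ℝ) ^ i := tsum_nonneg fun i => by positivity
  have B0 : 0 ≤ ∑' i : ℕ, (1/2:ℝ) ^ i := tsum_nonneg fun i => by positivity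
  have A0' : 0 ≤ ∑' i : ℕ, (z⁻¹ / 4) ^ i := tsum_nonneg fun i => by positivity
  have B0' : 0 ≤ ∑' i : ℕ, (2 * (i:ℝ) + 2) * z ^ i := tsum_nonneg fun i => by positivity
  refine ⟨Real.sqrt 2 * (∑' i : ℕ, (z⁻¹ / 4) ^ i + ∑' i : ℕ, (2 * (i:ℝ) + 2) * z ^ i) + 1,
    ∑' i : ℕ, Real.log 4 * (i + 1) * (1/2:ℝ) ^ i + ∑' i : ℕ, (1/2:ℝ) ^ i + 1, by positivity, by positivity, fun X hX n m => ?_⟩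
  set x : ℕ → ℝ := fun k => if k ≤ m then (1/4) ^ (m - k) else 2 * ((k - m : ℕ) : ℝ) + 2 with hx
  set u : ℕ → ℝ := fun k => if k ≤ m then Real.log 4 * ((m - k : ℕ) + 1) else (1/4) ^ (k - m) with hu
  have x0 : ∀ k, 0 ≤ x k := fun k => by simp only [hx]; split_ifs <;> positivity
  have u0 : ∀ k, 0 ≤ u k := fun k => by simp only [hu]; split_ifs <;> positivity
  obtain ⟨C, gv, hC⟩ := hX.dy_gv hH hK hK1 (Finset.range (n + 1))
  have sid := sidak gv (fun p => sg (H * K) p.1 * x p.1) Finset.univ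
  have pl : ∀ p : (Σ k : Finset.range (n + 1), Fin (2 ^ (k:ℕ))), Real.exp (-u p.1) ≤
      μ.real {ω | |X ((2 * (p.2:ℕ) + 1) / 2 ^ (p.1:ℕ)) ω - X (2 * (p.2:ℕ) / 2 ^ (p.1:ℕ)) ω| ≤ sg (H * K) p.1 * x p.1} := by
    intro p
    by_cases hk : (p.1 : ℕ) ≤ m
    · refine le_trans (le_of_eq ?_) (gv.small p (sg_pos _ _) (hC p) (x0 p.1) ?_)
      · simp only [hu, hx, hk, if_true]
        rw [show -(Real.log 4 * (((m - (p.1:ℕ) : ℕ) : ℝ) + 1)) = -((((m - (p.1:ℕ) + 1 : ℕ)) : ℝ) * Real.log 4) by push_cast; ring,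
          ← Real.log_pow, Real.exp_neg, Real.exp_log (by positivity), pow_succ, one_div, inv_pow, mul_inv]
        rfl
      · simp only [hx, hk, if_true]
        exact pow_le_one₀ (by norm_num) (by norm_num)
    · have tl := gv.tail p (sg_pos _ _) (hC p) (x0 p.1)
      have e : {ω | |X ((2 * (p.2:ℕ) + 1) / 2 ^ (p.1:ℕ)) ω - X (2 * (p.2:ℕ) / 2 ^ (p.1:ℕ)) ω| ≤ sg (H * K) p.1 * x p.1} =
          {ω | sg (H * K) p.1 * x p.1 < |X ((2 * (p.2:ℕ) + 1) / 2 ^ (p.1:ℕ)) ω - X (2 * (p.2:ℕ) / 2 ^ (p.1:ℕ)) ω|}ᶜ := by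
        ext ω; simp
      have ms : MeasurableSet {ω | sg (H * K) p.1 * x p.1 < |X ((2 * (p.2:ℕ) + 1) / 2 ^ (p.1:ℕ)) ω - X (2 * (p.2:ℕ) / 2 ^ (p.1:ℕ)) ω|} :=
        measurableSet_lt measurable_const (gv.1 p).abs
      rw [e, probReal_compl_eq_one_sub ms]
      have hb : 4 * Real.exp (-(x p.1) ^ 2 / 2) ≤ u p.1 := by
        simp only [hu, hx, hk, if_false]
        set i := (p.1:ℕ) - m
        have h1 : (4:ℝ) ^ (i + 1) ≤ Real.exp ((2 * (i:ℝ) + 2) ^ 2 / 2) := by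
          have : (4:ℝ) ≤ Real.exp 2 := by
            have := Real.add_one_le_exp 1
            rw [show (2:ℝ) = 1 + 1 by norm_num, Real.exp_add]; nlinarith
          calc (4:ℝ) ^ (i + 1) ≤ Real.exp 2 ^ (i + 1) := by gcongr
            _ = Real.exp (((i + 1 : ℕ):ℝ) * 2) := by rw [Real.exp_nat_mul]
            _ ≤ _ := by
                refine Real.exp_le_exp.2 ?_
                push_cast; nlinarith [(Nat.cast_nonneg i : (0:ℝ) ≤ i)]
        rw [neg_div, Real.exp_neg, one_div, inv_pow, ← div_eq_mul_inv, div_le_iff₀ (Real.exp_pos _), ← div_eq_inv_mul, le_div_iff₀ (by positivity)]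
        rw [pow_succ] at h1; linarith
      have ul : u p.1 ≤ 1 / 4 := by
        simp only [hu, hk, if_false]
        calc (1/4:ℝ) ^ ((p.1:ℕ) - m) ≤ (1/4) ^ 1 := pow_le_pow_of_le_one (by norm_num) (by norm_num) (by omega)
          _ = _ := by norm_num
      have ee : Real.exp (-u p.1) ≤ 1 - u p.1 / 2 := by
        have h1 := Real.add_one_le_exp (u p.1)
        have h2 := u0 p.1
        rw [Real.exp_neg, inv_le_iff_one_le_mul₀ (Real.exp_pos _)]
        nlinarith
      linarith
  have prod : Real.exp (-(∑' i : ℕ, Real.log 4 * (i + 1) * (1/2:ℝ) ^ i + ∑' i : ℕ, (1/2:ℝ) ^ i + 1) * 2 ^ m) ≤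
      ∏ p : (Σ k : Finset.range (n + 1), Fin (2 ^ (k:ℕ))),
      μ.real {ω | |X ((2 * (p.2:ℕ) + 1) / 2 ^ (p.1:ℕ)) ω - X (2 * (p.2:ℕ) / 2 ^ (p.1:ℕ)) ω| ≤ sg (H * K) p.1 * x p.1} := by
    refine le_trans ?_ (Finset.prod_le_prod (fun p _ => (Real.exp_pos _).le) fun p _ => pl p)
    rw [← Real.exp_sum]
    refine Real.exp_le_exp.2 ?_
    rw [Finset.sum_neg_distrib, neg_mul, neg_le_neg_iff, Fintype.sum_sigma]
    simp only [Finset.sum_const, Finset.card_univ, Fintype.card_fin, nsmul_eq_mul]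
    rw [Finset.sum_coe_sort (Finset.range (n + 1)) (fun k => ((2 ^ k : ℕ) : ℝ) * u k)]
    have ud := updown sa sb (fun i => by positivity) (fun i => by positivity) m (n + 1)
    have : ∀ k, ((2 ^ k : ℕ) : ℝ) * u k = 2 ^ m * (if k ≤ m then Real.log 4 * ((m - k : ℕ) + 1) * (1/2:ℝ) ^ (m - k) else (1/2:ℝ) ^ (k - m)) := by
      intro k
      simp only [hu]
      split_ifs with hk
      · have : (2:ℝ) ^ m = 2 ^ k * 2 ^ (m - k) := by rw [← pow_add]; congr 1; omega
        rw [this, one_div, inv_pow]; push_cast; field_simp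
      · have : (2:ℝ) ^ k = 2 ^ m * 2 ^ (k - m) := by rw [← pow_add]; congr 1; omega
        push_cast
        rw [this, mul_assoc, ← mul_pow]; norm_num
    simp only [this]
    rw [← Finset.mul_sum]
    have := mul_le_mul_of_nonneg_left ud (show (0:ℝ) ≤ 2 ^ m by positivity)
    nlinarith [show (0:ℝ) < 2 ^ m by positivity]
  refine (prod.trans sid).trans ?_
  have zae := hX.zero_ae hH hK
  refine ENNReal.toReal_mono (measure_ne_top _ _) (measure_mono_ae ?_)
  filter_upwards [zae] with ω hz0 hω
  have h' : ∀ p ∈ (Finset.univ : Finset (Σ k : Finset.range (n + 1), Fin (2 ^ (k:ℕ)))),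
    |X ((2 * (p.2:ℕ) + 1) / 2 ^ (p.1:ℕ)) ω - X (2 * (p.2:ℕ) / 2 ^ (p.1:ℕ)) ω| ≤ sg (H * K) p.1 * x p.1 := hω
  have lev : ∀ k, k ≤ n → ∀ j : ℕ, j < 2 ^ k → |X ((2 * j + 1) / 2 ^ k) ω - X (2 * j / 2 ^ k) ω| ≤ sg (H * K) k * x k := by
    intro k hk j hj
    exact h' ⟨⟨k, Finset.mem_range.2 (by omega)⟩, ⟨j, hj⟩⟩ (Finset.mem_univ _)
  have b0 : ∀ k, 0 ≤ sg (H * K) k * x k := fun k => mul_nonneg (sg_pos _ _).le (x0 k)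
  intro j hj
  have ch := chain (f := fun t => X t ω) (A := sg (H * K) 0 * x 0) (n0 := 0) b0 ?_ n (fun k _ hk => lev k (by omega)) j (by simpa using hj)
  · rw [zero_add] at ch
    refine ch.trans ?_
    have e : sg (H * K) 0 * x 0 + ∑ k ∈ Finset.Ioc 0 n, sg (H * K) k * x k = ∑ k ∈ Finset.range (n + 1), sg (H * K) k * x k := by
      rw [Finset.sum_range_succ', add_comm]
      congr 1
      rw [Finset.range_eq_Ico, Finset.sum_Ico_add' (fun k => sg (H * K) k * x k) 0 n 1]
      rfl
    rw [e]
    have ud := updown sa' sb' (fun i => by positivity) (fun i => by positivity) m (n + 1)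
    have : ∀ k, sg (H * K) k * x k = (Real.sqrt 2 * z ^ m) * (if k ≤ m then (z⁻¹ / 4) ^ (m - k) else (2 * ((k - m : ℕ) : ℝ) + 2) * z ^ (k - m)) := by
      intro k
      simp only [hx, sg, ← hz]
      split_ifs with hk
      · have : z ^ m = z ^ k * z ^ (m - k) := by rw [← pow_add]; congr 1; omega
        rw [this, div_pow, div_pow, inv_pow, one_pow]; field_simp
      · have : z ^ k = z ^ m * z ^ (k - m) := by rw [← pow_add]; congr 1; omega
        rw [this]; ring
    simp only [this]
    rw [← Finset.mul_sum]
    have := mul_le_mul_of_nonneg_left ud (show 0 ≤ Real.sqrt 2 * z ^ m by positivity)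
    nlinarith [show 0 < z ^ m by positivity]
  · intro j hj
    have := lev 0 (by omega) 0 (by norm_num)
    simp at this
    rw [hz0, sub_zero] at this
    rcases (by simp at hj; omega : j = 0 ∨ j = 1) with rfl | rfl
    · simp [hz0]; exact b0 0
    · simpa using this
end BifChung

namespace BifChung
variable {Ω : Type*} [MeasurableSpace Ω] {μ : Measure Ω} [IsProbabilityMeasure μ] {ι ν : Type} [Fintype ι]
  [Fintype ν] [DecidableEq ν]

lemma IsGV.copies {Y : ι → Ω → ℝ} {C : ι → ι → ℝ} (h : IsGV μ Y C) (b : ι → ν) (hb : ∀ i j, b i ≠ b j → C i j = 0) :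
    IsGV (Measure.pi fun _ : ν => μ) (fun i w => Y i (w (b i))) C := by
  refine ⟨fun i => (h.1 i).comp (measurable_pi_apply _), h.2.1, fun a => ?_⟩
  have e : ∀ w : ν → Ω, Complex.exp (((∑ i, a i * Y i (w (b i)) : ℝ) : ℂ) * Complex.I)
      = ∏ n, Complex.exp (((∑ i, (if b i = n then a i else 0) * Y i (w n) : ℝ) : ℂ) * Complex.I) := by
    intro w
    rw [← Complex.exp_sum, ← Finset.sum_mul, ← Complex.ofReal_sum, Finset.sum_comm]
    congr 3
    refine Finset.sum_congr rfl fun i _ => ?_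
    simp
  simp only [e]
  rw [integral_fintype_prod_eq_prod (fun n x => Complex.exp (((∑ i, (if b i = n then a i else 0) * Y i x : ℝ) : ℂ) * Complex.I))]
  have e2 : ∀ n, ∫ x, Complex.exp (((∑ i, (if b i = n then a i else 0) * Y i x : ℝ) : ℂ) * Complex.I) ∂μ =
    ((Real.exp (-(qf C fun i => if b i = n then a i else 0) / 2) : ℝ) : ℂ) := fun n => h.2.2 _
  simp only [e2]
  rw [← Complex.ofReal_prod, ← Real.exp_sum, ← Finset.sum_div, Finset.sum_neg_distrib]
  congr 4
  simp only [qf]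
  rw [Finset.sum_comm]
  refine Finset.sum_congr rfl fun i _ => ?_
  rw [Finset.sum_comm]
  refine Finset.sum_congr rfl fun j _ => ?_
  by_cases hij : b i = b j
  · simp [hij]
  · rw [hb i j hij]; simp

lemma block_indep {Y : ι → Ω → ℝ} {C : ι → ι → ℝ} (h : IsGV μ Y C) (b : ι → ν) (hb : ∀ i j, b i ≠ b j → C i j = 0)
    (t : ν → ℝ) : μ.real {ω | ∀ n, ∃ i, b i = n ∧ t n < |Y i ω|} = ∏ n, μ.real {ω | ∃ i, b i = n ∧ t n < |Y i ω|} := by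
  have mS : MeasurableSet {y : ι → ℝ | ∀ n, ∃ i, b i = n ∧ t n < |y i|} := by
    rw [Set.setOf_forall]
    refine MeasurableSet.iInter fun n => ?_
    rw [Set.setOf_exists]
    refine MeasurableSet.iUnion fun i => ?_
    by_cases hi : b i = n
    · simp only [hi, true_and]
      exact measurableSet_lt measurable_const (measurable_pi_apply i).abs
    · simp [hi]
  have := h.prob (h.copies b hb) mS
  refine (Eq.trans ?_ this).trans ?_
  · rfl
  · have e : {w : ν → Ω | (fun i => Y i (w (b i))) ∈ {y : ι → ℝ | ∀ n, ∃ i, b i = n ∧ t n < |y i|}} =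
      Set.pi Set.univ fun n => {ω | ∃ i, b i = n ∧ t n < |Y i ω|} := by
      ext w
      simp only [Set.mem_ofPred_eq, Set.mem_pi, Set.mem_univ, true_implies]
      refine forall_congr' fun n => exists_congr fun i => and_congr_right fun hi => by rw [hi]
    rw [e, Measure.real, Measure.pi_pi, ENNReal.toReal_prod]
    rfl

/-- realisation of a psd covariance -/
lemma exists_gv {C : ι → ι → ℝ} (hs : ∀ i j, C i j = C j i) (hC : ∀ a, 0 ≤ qf C a) :
    ∃ Y : ι → (Fin (Fintype.card ι) → ℝ) → ℝ, IsGV (Measure.pi fun _ => gaussianReal 0 1) Y C := by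
  obtain ⟨B, hB⟩ := psd_decomp hs hC
  refine ⟨fun i x => ∑ k, B i k * x k, ?_⟩
  have := (isGV_pi (ι := Fin (Fintype.card ι))).lin B
  convert! this using 3 with i j
  rw [hB]; simp

lemma union_bd {s : Finset ι} {P : ι → Ω → Prop} {q : ℝ} (h : ∀ i ∈ s, μ.real {ω | P i ω} ≤ q) :
    μ.real {ω | ∃ i ∈ s, P i ω} ≤ s.card * q := by
  have e : {ω | ∃ i ∈ s, P i ω} = ⋃ i ∈ s, {ω | P i ω} := by ext; simp
  rw [e]
  refine (measureReal_biUnion_finset_le _ _).trans ?_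
  refine (Finset.sum_le_sum h).trans ?_
  simp

lemma noise_bound {Y : ι → Ω → ℝ} {C : ι → ι → ℝ} (h : IsGV μ Y C) (b : ι → ν) {ε σ : ν → ℝ} (hε : ∀ n, 0 < ε n)
    (hσ : ∀ n, 0 < σ n) (hC : ∀ i, ∑ j, (if b i = b j then 0 else |C i j|) ≤ σ (b i) ^ 2) :
    μ.real {ω | ∀ n, ∃ i, b i = n ∧ 3 * ε n < |Y i ω|} ≤
      Real.exp (-∑ n, (μ.real {ω | ∀ i, b i = n → |Y i ω| ≤ ε n} -
        (Finset.univ.filter fun i => b i = n).card * (2 * Real.exp (-(ε n / σ n) ^ 2 / 2)))) +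
      ∑ n, (Finset.univ.filter fun i => b i = n).card * (2 * Real.exp (-(ε n / σ n) ^ 2 / 2)) := by
  classical
  set q : ν → ℝ := fun n => (Finset.univ.filter fun i => b i = n).card * (2 * Real.exp (-(ε n / σ n) ^ 2 / 2)) with hq
  set E : ι → ι → ℝ := fun i j => if b i = b j then (if i = j then ∑ j, (if b i = b j then 0 else |C i j|) else 0) else - C i j with hE
  have Es : ∀ i j, E i j = E j i := by
    intro i j
    simp only [hE]
    by_cases h1 : b i = b j
    · by_cases h2 : i = j
      · rw [h2]
      · simp [h1, h2, Ne.symm h2]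
    · simp [h1, Ne.symm h1, h.2.1 i j]
  have Epsd : ∀ a, 0 ≤ qf E a := by
    intro a
    have := diag_dom Es (κ := 0) (fun i => ?_) a
    · simpa using this
    · rw [sub_zero]
      have : E i i = ∑ j, (if b i = b j then 0 else |C i j|) := by simp [hE]
      rw [this]
      refine Finset.sum_le_sum fun j _ => ?_
      simp only [hE]
      by_cases h1 : b i = b j
      · by_cases h2 : i = j <;> simp [h1, h2]
      · have : i ≠ j := fun h2 => h1 (by rw [h2])
        simp [h1, this]
  obtain ⟨ξ, hξ⟩ := exists_gv Es Epsd
  set P : Measure (Fin (Fintype.card ι) → ℝ) := Measure.pi fun _ => gaussianReal 0 1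
  have gv := h.prodAdd hξ
  -- noise is small
  have nz : ∀ n, P.real {x | ∃ i, b i = n ∧ ε n < |ξ i x|} ≤ q n := by
    intro n
    have := union_bd (μ := P) (s := Finset.univ.filter fun i => b i = n) (P := fun i x => ε n < |ξ i x|)
      (q := 2 * Real.exp (-(ε n / σ n) ^ 2 / 2)) (fun i hi => by
        have hi' : b i = n := by simpa using hi
        have := hξ.tail i (σ := σ n) (x := ε n / σ n) (hσ n) (by
          have := hC i
          rw [hi'] at this
          simpa [hE, hi'] using this) (div_nonneg (hε n).le (hσ n).le)
        rwa [mul_div_cancel₀ _ (hσ n).ne'] at this)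
    simpa using this
  have mY : ∀ n, MeasurableSet {ω | ∃ i, b i = n ∧ ε n < |Y i ω|} := by
    intro n
    rw [Set.setOf_exists]
    refine MeasurableSet.iUnion fun i => ?_
    by_cases hi : b i = n
    · simp only [hi, true_and]
      exact measurableSet_lt measurable_const (h.1 i).abs
    · simp [hi]
  have fstr : ∀ S : Set Ω, (μ.prod P).real (Prod.fst ⁻¹' S) = μ.real S := by
    intro S
    have : (Prod.fst ⁻¹' S : Set (Ω × (Fin (Fintype.card ι) → ℝ))) = S ×ˢ Set.univ := by ext; simp
    rw [this, measureReal_prod_prod]; simp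
  have sndr : ∀ S : Set (Fin (Fintype.card ι) → ℝ), (μ.prod P).real (Prod.snd ⁻¹' S) = P.real S := by
    intro S
    have : (Prod.snd ⁻¹' S : Set (Ω × (Fin (Fintype.card ι) → ℝ))) = Set.univ ×ˢ S := by ext; simp
    rw [this, measureReal_prod_prod]; simp
  -- main inclusion
  have step1 : μ.real {ω | ∀ n, ∃ i, b i = n ∧ 3 * ε n < |Y i ω|} ≤
      (μ.prod P).real {p | ∀ n, ∃ i, b i = n ∧ 2 * ε n < |Y i p.1 + ξ i p.2|} + ∑ n, q n := by
    rw [← fstr]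
    have sub : (Prod.fst ⁻¹' {ω | ∀ n, ∃ i, b i = n ∧ 3 * ε n < |Y i ω|} : Set (Ω × (Fin (Fintype.card ι) → ℝ))) ⊆
        {p | ∀ n, ∃ i, b i = n ∧ 2 * ε n < |Y i p.1 + ξ i p.2|} ∪ ⋃ n ∈ (Finset.univ : Finset ν), Prod.snd ⁻¹' {x | ∃ i, b i = n ∧ ε n < |ξ i x|} := by
      intro p hp
      have hp' : ∀ n, ∃ i, b i = n ∧ 3 * ε n < |Y i p.1| := hp
      by_cases hx : ∃ n, ∃ i, b i = n ∧ ε n < |ξ i p.2|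
      · right
        simpa using hx
      · left
        push Not at hx
        intro n
        obtain ⟨i, hi, hi'⟩ := hp' n
        refine ⟨i, hi, ?_⟩
        have h1 := hx n i hi
        have h2 := abs_sub_abs_le_abs_sub (Y i p.1) (-ξ i p.2)
        rw [abs_neg, sub_neg_eq_add] at h2
        linarith
    refine (measureReal_mono sub).trans ((measureReal_union_le _ _).trans ?_)
    gcongr
    refine (measureReal_biUnion_finset_le _ _).trans (Finset.sum_le_sum fun n _ => ?_)
    rw [sndr]; exact nz n
  refine step1.trans ?_
  gcongr
  rw [block_indep gv b (fun i j hij => by simp [hE, hij]) fun n => 2 * ε n, ← Finset.sum_neg_distrib, Real.exp_sum]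
  refine Finset.prod_le_prod (fun n _ => measureReal_nonneg) fun n _ => ?_
  have step2 : (μ.prod P).real {p | ∃ i, b i = n ∧ 2 * ε n < |Y i p.1 + ξ i p.2|} ≤
      μ.real {ω | ∃ i, b i = n ∧ ε n < |Y i ω|} + q n := by
    have sub : {p : Ω × (Fin (Fintype.card ι) → ℝ) | ∃ i, b i = n ∧ 2 * ε n < |Y i p.1 + ξ i p.2|} ⊆
        Prod.fst ⁻¹' {ω | ∃ i, b i = n ∧ ε n < |Y i ω|} ∪ Prod.snd ⁻¹' {x | ∃ i, b i = n ∧ ε n < |ξ i x|} := by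
      rintro p ⟨i, hi, hi'⟩
      by_cases hx : ε n < |ξ i p.2|
      · right; exact ⟨i, hi, hx⟩
      · left
        refine ⟨i, hi, ?_⟩
        have := abs_add_le (Y i p.1) (ξ i p.2)
        linarith
    refine (measureReal_mono sub).trans ((measureReal_union_le _ _).trans ?_)
    rw [fstr, sndr]
    linarith [nz n]
  refine step2.trans ?_
  have cp : {ω | ∀ i, b i = n → |Y i ω| ≤ ε n} = {ω | ∃ i, b i = n ∧ ε n < |Y i ω|}ᶜ := by
    ext ω; simp
  rw [cp, probReal_compl_eq_one_sub (mY n)]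
  have := Real.add_one_le_exp (-(1 - μ.real {ω | ∃ i, b i = n ∧ ε n < |Y i ω|} - q n))
  linarith
end BifChung

namespace BifChung
variable {Ω : Type*} [MeasurableSpace Ω] {μ : Measure Ω} [IsProbabilityMeasure μ] {H K : ℝ} {X : ℝ → Ω → ℝ}

lemma IsGV.smuli {ι : Type} [Fintype ι] {Y : ι → Ω → ℝ} {C : ι → ι → ℝ} (h : IsGV μ Y C) (c : ι → ℝ) :
    IsGV μ (fun i ω => c i * Y i ω) (fun i j => c i * c j * C i j) := by
  refine ⟨fun i => (h.1 i).const_mul _, fun i j => by beta_reduce; rw [h.2.1]; ring, fun a => ?_⟩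
  have := h.2.2 fun i => a i * c i
  simp only [mul_assoc] at this ⊢
  rw [this]
  congr 4
  simp only [qf]
  refine Finset.sum_congr rfl fun i _ => Finset.sum_congr rfl fun j _ => ?_
  ring

lemma sum8 {t : ℝ} (t0 : 0 < t) (t1 : t < 1) : Summable fun n : ℕ => (8:ℝ) ^ n * t ^ (n ^ 2) := by
  have h1 := (tendsto_pow_atTop_nhds_zero_of_lt_one t0.le t1).eventually (gt_mem_nhds (show (0:ℝ) < 1/16 by norm_num))
  refine Summable.of_norm_bounded_eventually_nat (g := fun n : ℕ => (1/2:ℝ) ^ n)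
    (summable_geometric_of_norm_lt_one (by norm_num)) ?_
  filter_upwards [h1] with n hn
  rw [Real.norm_of_nonneg (by positivity), sq, pow_mul, ← mul_pow]
  have : 0 < t ^ n := by positivity
  gcongr
  linarith

/-- the scales -/
noncomputable def rn (n : ℕ) : ℝ := (1/2:ℝ) ^ (n ^ 3)

lemma rn_pos (n : ℕ) : 0 < rn n := by unfold rn; positivity

lemma cross_cov (hH : 0 < H) (hH1 : H < 1) (hK : 0 < K) (hK1 : K ≤ 1) :
    ∃ t : ℝ, 0 < t ∧ t < 1 ∧ ∀ n m : ℕ, n ≠ m → ∀ u v : ℝ, 0 ≤ u → u ≤ 1 → 0 ≤ v → v ≤ 1 →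
      |rn n ^ (-(H * K)) * rn m ^ (-(H * K)) * Rbif H K (rn n * u) (rn m * v)| ≤ 3 * t ^ (n ^ 2 + m ^ 2) := by
  have hHK : 0 < H * K := by positivity
  have hHK1 : H * K < 1 := by nlinarith
  obtain ⟨g, hg⟩ : ∃ g, g = min (2 * (H * K)) 1 := ⟨_, rfl⟩
  have g0 : 0 < g := by rw [hg]; exact lt_min (by positivity) one_pos
  have g1 : g ≤ 1 := by rw [hg]; exact min_le_right _ _
  have g2 : g ≤ 2 * (H * K) := by rw [hg]; exact min_le_left _ _
  have g3 : 0 < g - H * K := by rw [hg, sub_pos]; exact lt_min (by linarith) hHK1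
  refine ⟨(1/2:ℝ) ^ (g - H * K), by positivity, Real.rpow_lt_one (by norm_num) (by norm_num) g3, ?_⟩
  have key : ∀ n m : ℕ, n < m → ∀ u v : ℝ, 0 ≤ u → u ≤ 1 → 0 ≤ v → v ≤ 1 →
      |rn n ^ (-(H * K)) * rn m ^ (-(H * K)) * Rbif H K (rn n * u) (rn m * v)| ≤ 3 * ((1/2:ℝ) ^ (g - H * K)) ^ (n ^ 2 + m ^ 2) := by
    intro n m hnm u v u0 u1 v0 v1
    have rn0 := rn_pos n
    have rm0 := rn_pos m
    have hle : rn m ≤ rn n := pow_le_pow_of_le_one (by norm_num) (by norm_num) (by gcongr)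
    have := R_decay hH hH1 hK hK1 (x := rn m * v) (y := rn n * u) rm0 hle (by positivity) (by nlinarith) (by positivity) (by nlinarith) g0 g1 g2
    rw [R_symm, abs_mul, abs_of_pos (by positivity)]
    calc rn n ^ (-(H * K)) * rn m ^ (-(H * K)) * |Rbif H K (rn m * v) (rn n * u)|
        ≤ rn n ^ (-(H * K)) * rn m ^ (-(H * K)) * (3 * rn m ^ g * rn n ^ (2 * (H * K) - g)) := by gcongr
      _ = 3 * (rn m ^ (-(H * K)) * rn m ^ g) * (rn n ^ (-(H * K)) * rn n ^ (2 * (H * K) - g)) := by ring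
      _ = 3 * (rn m / rn n) ^ (g - H * K) := by
          rw [← Real.rpow_add rn0, ← Real.rpow_add rm0, Real.div_rpow rm0.le rn0.le,
            show -(H * K) + (2 * (H * K) - g) = -(g - H * K) by ring, Real.rpow_neg rn0.le]
          ring_nf
      _ ≤ 3 * ((1/2:ℝ) ^ (n ^ 2 + m ^ 2)) ^ (g - H * K) := by
          gcongr
          rw [div_le_iff₀ rn0]
          unfold rn
          rw [← pow_add]
          refine pow_le_pow_of_le_one (by norm_num) (by norm_num) ?_
          obtain ⟨d, rfl⟩ : ∃ d, m = n + 1 + d := ⟨m - (n + 1), by omega⟩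
          nlinarith [Nat.zero_le d, Nat.zero_le n, Nat.zero_le (d * n), Nat.zero_le (d * n * n), Nat.zero_le (d * d * n), Nat.zero_le (d * d * d), Nat.zero_le (d*d), Nat.zero_le (n * n)]
      _ = _ := by
          rw [← Real.rpow_natCast, ← Real.rpow_natCast, ← Real.rpow_mul (by norm_num), ← Real.rpow_mul (by norm_num), mul_comm (g - H * K)]
  intro n m hnm u v u0 u1 v0 v1
  rcases lt_or_gt_of_ne hnm with h | h
  · exact key n m h u v u0 u1 v0 v1
  · have := key m n h v u v0 v1 u0 u1
    rw [R_symm, mul_comm (rn n ^ _), add_comm (n ^ 2)]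
    exact this

lemma io_bound (hH : 0 < H) (hH1 : H < 1) (hK : 0 < K) (hK1 : K ≤ 1) {a : ℝ} (a0 : 0 < a) :
    ∃ q : ℕ → ℝ, Summable q ∧ ∀ (ε p : ℕ → ℝ) (X : ℝ → Ω → ℝ) (s : Finset ℕ), IsX μ H K X →
     (∀ n ∈ s, 1 ≤ n) → (∀ n ∈ s, a / n ≤ ε n) → (∀ n ∈ s, p n ≤ μ.real {ω | ∀ j : ℕ, j ≤ 2 ^ n →
        |rn n ^ (-(H * K)) * X (rn n * (j / 2 ^ n)) ω| ≤ ε n}) →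
      μ.real {ω | ∀ n ∈ s, ∃ j : ℕ, j ≤ 2 ^ n ∧ 3 * ε n < |rn n ^ (-(H * K)) * X (rn n * (j / 2 ^ n)) ω|} ≤
        Real.exp (-∑ n ∈ s, (p n - q n)) + ∑ n ∈ s, q n := by
  obtain ⟨t, t0, t1, hcov⟩ := cross_cov hH hH1 hK hK1
  have s8 := sum8 t0 t1
  obtain ⟨S, hS⟩ : ∃ S, S = ∑' n : ℕ, (8:ℝ) ^ n * t ^ (n ^ 2) := ⟨_, rfl⟩
  have S0 : 0 < S := by
    rw [hS]; exact s8.tsum_pos (fun n => by positivity) 0 (by simp)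
  refine ⟨fun n => 8 / a ^ 2 * (6 * S) * ((8:ℝ) ^ n * t ^ (n ^ 2)), s8.mul_left _, fun ε p X s hX s1 hε hp => ?_⟩
  have gv := (hX.gv (fun i : (Σ n : s, Fin (2 ^ (n:ℕ) + 1)) => rn i.1 * ((i.2:ℕ) / 2 ^ (i.1:ℕ)))
    (fun i => mul_nonneg (rn_pos _).le (by positivity))).smuli (fun i => rn i.1 ^ (-(H * K)))
  have ε0 : ∀ n : s, 0 < ε n := fun n => by
    have h1 := hε n n.2
    have h2 : (0:ℝ) < (n:ℕ) := by exact_mod_cast s1 n n.2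
    exact lt_of_lt_of_le (by positivity) h1
  have nb := noise_bound gv (fun i => i.1) (ε := fun n => ε n) (σ := fun n => Real.sqrt (6 * S * t ^ ((n:ℕ) ^ 2))) ε0
    (fun n => by positivity) ?_
  · have card : ∀ n : s, ((Finset.univ.filter fun i : (Σ n : s, Fin (2 ^ (n:ℕ) + 1)) => i.1 = n).card : ℝ) ≤ 2 * 2 ^ (n:ℕ) := by
      rintro ⟨n, hn⟩
      have hsub : (Finset.univ.filter fun i : (Σ n : s, Fin (2 ^ (n:ℕ) + 1)) => i.1 = ⟨n, hn⟩) ⊆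
          (Finset.univ : Finset (Fin (2 ^ n + 1))).image fun k => ⟨⟨n, hn⟩, k⟩ := by
        rintro ⟨m, k⟩ hm
        have hm' : m = ⟨n, hn⟩ := (Finset.mem_filter.1 hm).2
        subst hm'
        exact Finset.mem_image.2 ⟨k, Finset.mem_univ _, rfl⟩
      have hc := (Finset.card_le_card hsub).trans Finset.card_image_le
      rw [Finset.card_univ, Fintype.card_fin] at hc
      have hc' : ((Finset.univ.filter fun i : (Σ n : s, Fin (2 ^ (n:ℕ) + 1)) => i.1 = ⟨n, hn⟩).card : ℝ) ≤ 2 ^ n + 1 := by exact_mod_cast hc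
      have : (1:ℝ) ≤ 2 ^ n := one_le_pow₀ (by norm_num)
      linarith
    have qb : ∀ n : s, ((Finset.univ.filter fun i : (Σ n : s, Fin (2 ^ (n:ℕ) + 1)) => i.1 = n).card : ℝ) *
        (2 * Real.exp (-(ε n / Real.sqrt (6 * S * t ^ ((n:ℕ) ^ 2))) ^ 2 / 2)) ≤ 8 / a ^ 2 * (6 * S) * ((8:ℝ) ^ (n:ℕ) * t ^ ((n:ℕ) ^ 2)) := by
      intro n
      have h1 := hε n n.2
      have h2 : (0:ℝ) < (n:ℕ) := by exact_mod_cast s1 n n.2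
      have h3 : Real.exp (-(ε n / Real.sqrt (6 * S * t ^ ((n:ℕ) ^ 2))) ^ 2 / 2) ≤ 2 * (6 * S * t ^ ((n:ℕ) ^ 2)) * (((n:ℕ):ℝ) ^ 2 / a ^ 2) := by
        rw [neg_div, div_pow, Real.sq_sqrt (by positivity), Real.exp_neg]
        have h4 : a ^ 2 / ((n:ℕ):ℝ) ^ 2 ≤ ε n ^ 2 := by rw [← div_pow]; gcongr
        have h5 : a ^ 2 / ((n:ℕ):ℝ) ^ 2 / (6 * S * t ^ ((n:ℕ) ^ 2)) / 2 ≤ Real.exp (ε n ^ 2 / (6 * S * t ^ ((n:ℕ) ^ 2)) / 2) := by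
          refine le_trans ?_ ((le_add_of_nonneg_right zero_le_one).trans (Real.add_one_le_exp _))
          gcongr
        calc (Real.exp (ε n ^ 2 / (6 * S * t ^ ((n:ℕ) ^ 2)) / 2))⁻¹ ≤ (a ^ 2 / ((n:ℕ):ℝ) ^ 2 / (6 * S * t ^ ((n:ℕ) ^ 2)) / 2)⁻¹ := by gcongr
          _ = _ := by field_simp
      have h6 : ((n:ℕ):ℝ) ^ 2 ≤ 4 ^ (n:ℕ) := by
        have : ((n:ℕ):ℝ) ≤ 2 ^ (n:ℕ) := by exact_mod_cast (Nat.lt_two_pow_self).le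
        calc ((n:ℕ):ℝ) ^ 2 ≤ (2 ^ (n:ℕ)) ^ 2 := by gcongr
          _ = 4 ^ (n:ℕ) := by rw [← pow_mul, mul_comm, pow_mul]; norm_num
      calc _ ≤ (2 * 2 ^ (n:ℕ)) * (2 * (2 * (6 * S * t ^ ((n:ℕ) ^ 2)) * (4 ^ (n:ℕ) / a ^ 2))) := by
            refine mul_le_mul (card n) ?_ (by positivity) (by positivity)
            refine mul_le_mul_of_nonneg_left (h3.trans ?_) (by norm_num)
            gcongr
        _ = _ := by
            rw [show (8:ℝ) ^ (n:ℕ) = 2 ^ (n:ℕ) * 4 ^ (n:ℕ) by rw [← mul_pow]; norm_num]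
            ring
    rw [← Finset.sum_coe_sort s, ← Finset.sum_coe_sort s]
    refine le_trans (le_of_eq ?_) (nb.trans (add_le_add (Real.exp_le_exp.2 (neg_le_neg (Finset.sum_le_sum fun n _ => ?_))) (Finset.sum_le_sum fun n _ => qb n)))
    · congr 1
      ext ω
      simp only [Set.mem_ofPred_eq, Subtype.forall]
      refine forall_congr' fun n => forall_congr' fun hn => ⟨?_, ?_⟩
      · rintro ⟨j, hj, h⟩
        exact ⟨⟨⟨n, hn⟩, ⟨j, Nat.lt_succ_of_le hj⟩⟩, rfl, h⟩
      · rintro ⟨⟨m, j⟩, rfl, h⟩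
        exact ⟨j, Nat.le_of_lt_succ j.2, h⟩
    · refine sub_le_sub ?_ (qb n)
      refine (hp n n.2).trans (le_of_eq ?_)
      congr 1
      ext ω
      simp only [Set.mem_ofPred_eq]
      constructor
      · rintro h ⟨m, j⟩ rfl
        exact h j (Nat.le_of_lt_succ j.2)
      · rintro h j hj
        exact h ⟨n, ⟨j, Nat.lt_succ_of_le hj⟩⟩ rfl
  · rintro ⟨n, k⟩
    rw [Real.sq_sqrt (by positivity), Fintype.sum_sigma]
    have hu : ∀ (n : ℕ) (k : Fin (2 ^ n + 1)), 0 ≤ ((k:ℕ):ℝ) / 2 ^ n ∧ ((k:ℕ):ℝ) / 2 ^ n ≤ 1 := by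
      intro n k
      refine ⟨by positivity, div_le_one_of_le₀ ?_ (by positivity)⟩
      have := k.2
      exact_mod_cast (show (k:ℕ) ≤ 2 ^ n by omega)
    calc _ ≤ ∑ m : s, ∑ l : Fin (2 ^ (m:ℕ) + 1), 3 * t ^ ((n:ℕ) ^ 2 + (m:ℕ) ^ 2) := by
          refine Finset.sum_le_sum fun m _ => Finset.sum_le_sum fun l _ => ?_
          split_ifs with h
          · positivity
          · exact hcov n m (fun e => h (Subtype.ext e)) _ _ (hu _ _).1 (hu _ _).2 (hu _ _).1 (hu _ _).2
      _ ≤ ∑ m : s, 6 * t ^ ((n:ℕ) ^ 2) * (8 ^ (m:ℕ) * t ^ ((m:ℕ) ^ 2)) := by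
          refine Finset.sum_le_sum fun m _ => ?_
          rw [Finset.sum_const, Finset.card_univ, Fintype.card_fin, nsmul_eq_mul, pow_add]
          push_cast
          have h1 : (1:ℝ) ≤ 8 ^ (m:ℕ) := one_le_pow₀ (by norm_num)
          have h2 : (2:ℝ) ^ (m:ℕ) ≤ 8 ^ (m:ℕ) := by gcongr; norm_num
          have h3 : 0 < t ^ ((n:ℕ) ^ 2) * t ^ ((m:ℕ) ^ 2) := by positivity
          nlinarith
      _ = 6 * t ^ ((n:ℕ) ^ 2) * ∑ m ∈ s, (8 ^ m * t ^ (m ^ 2)) := by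
          rw [← Finset.mul_sum, Finset.sum_coe_sort s fun m => (8:ℝ) ^ m * t ^ (m ^ 2)]
      _ ≤ 6 * t ^ ((n:ℕ) ^ 2) * S := by
          rw [hS]
          gcongr
          exact s8.sum_le_tsum _ fun m _ => by positivity
      _ = _ := by ring
end BifChung

namespace BifChung
variable {Ω : Type*} [MeasurableSpace Ω] {μ : Measure Ω} [IsProbabilityMeasure μ] {H K : ℝ} {X : ℝ → Ω → ℝ}

lemma io_ae (hH : 0 < H) (hH1 : H < 1) (hK : 0 < K) (hK1 : K ≤ 1) {a : ℝ} (a0 : 0 < a) {ε : ℕ → ℝ}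
    (h1 : ∀ᶠ n : ℕ in atTop, a / n ≤ ε n) (hX : IsX μ H K X)
    (h2 : ∀ᶠ n : ℕ in atTop, 1 / (n:ℝ) ≤ μ.real {ω | ∀ j : ℕ, j ≤ 2 ^ n →
        |rn n ^ (-(H * K)) * X (rn n * (j / 2 ^ n)) ω| ≤ ε n}) :
    ∀ᵐ ω ∂μ, ∃ᶠ n in atTop, ∀ j : ℕ, j ≤ 2 ^ n → |rn n ^ (-(H * K)) * X (rn n * (j / 2 ^ n)) ω| ≤ 3 * ε n := by
  obtain ⟨q, sq, hq⟩ := io_bound (μ := μ) hH hH1 hK hK1 a0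
  obtain ⟨N0, hN0⟩ := eventually_atTop.1 (h1.and h2)
  have key : ∀ N : ℕ, ∀ᵐ ω ∂μ, ∃ n, N ≤ n ∧ ∀ j : ℕ, j ≤ 2 ^ n → |rn n ^ (-(H * K)) * X (rn n * (j / 2 ^ n)) ω| ≤ 3 * ε n := by
    intro N
    rw [ae_iff]
    set G := {ω | ¬ ∃ n, N ≤ n ∧ ∀ j : ℕ, j ≤ 2 ^ n → |rn n ^ (-(H * K)) * X (rn n * (j / 2 ^ n)) ω| ≤ 3 * ε n} with hG
    suffices h : μ.real G = 0 by
      rwa [measureReal_eq_zero_iff] at h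
    refine le_antisymm (le_of_forall_pos_le_add fun e he => ?_) measureReal_nonneg
    obtain ⟨s, hs⟩ := summable_iff_vanishing_norm.1 sq (e / 2) (by positivity)
    obtain ⟨N1, hN1⟩ : ∃ N1, N1 = s.sup id + N + N0 + 1 := ⟨_, rfl⟩
    have sd : ∀ M, ∑ n ∈ Finset.Ico N1 M, q n ≤ e / 2 := by
      intro M
      refine (le_abs_self _).trans (hs _ ?_).le
      rw [Finset.disjoint_left]
      intro n hn hns
      have h3 : n ≤ s.sup id := Finset.le_sup (f := id) hns
      have h4 := (Finset.mem_Ico.1 hn).1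
      omega
    have dv := (not_summable_iff_tendsto_nat_atTop_of_nonneg (fun n : ℕ => by positivity)).1 Real.not_summable_one_div_natCast
    obtain ⟨M, hM, hMN⟩ := ((dv.eventually_ge_atTop (∑ n ∈ Finset.range N1, 1 / (n:ℝ) + e / 2 - Real.log (e / 2))).and (eventually_ge_atTop N1)).exists
    have b := hq ε (fun n => 1 / (n:ℝ)) X (Finset.Ico N1 M) hX
      (fun n hn => by have := (Finset.mem_Ico.1 hn).1; omega)
      (fun n hn => (hN0 n (by have := (Finset.mem_Ico.1 hn).1; omega)).1)
      (fun n hn => (hN0 n (by have := (Finset.mem_Ico.1 hn).1; omega)).2)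
    have mono : μ.real G ≤ μ.real {ω | ∀ n ∈ Finset.Ico N1 M, ∃ j : ℕ, j ≤ 2 ^ n ∧ 3 * ε n < |rn n ^ (-(H * K)) * X (rn n * (j / 2 ^ n)) ω|} := by
      refine measureReal_mono fun ω hω n hn => ?_
      have h' : ¬ ∃ n, N ≤ n ∧ ∀ j : ℕ, j ≤ 2 ^ n → |rn n ^ (-(H * K)) * X (rn n * (j / 2 ^ n)) ω| ≤ 3 * ε n := hω
      push Not at h'
      exact h' n (by have := (Finset.mem_Ico.1 hn).1; omega)
    have ee : Real.exp (-∑ n ∈ Finset.Ico N1 M, (1 / (n:ℝ) - q n)) ≤ e / 2 := by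
      rw [← Real.le_log_iff_exp_le (by positivity), Finset.sum_sub_distrib]
      rw [Finset.sum_Ico_eq_sub _ hMN]
      have := sd M
      linarith
    have := sd M
    linarith
  filter_upwards [ae_all_iff.2 key] with ω hω
  exact frequently_atTop.2 fun N => by
    obtain ⟨n, h1, h2⟩ := hω N
    exact ⟨n, h1, h2⟩

lemma union_bd2 {ι : Type} {s : Finset ι} {P : ι → Ω → Prop} {q : ℝ} (h : ∀ i ∈ s, μ.real {ω | P i ω} ≤ q) :
    μ.real {ω | ∃ i ∈ s, P i ω} ≤ s.card * q := by
  have e : {ω | ∃ i ∈ s, P i ω} = ⋃ i ∈ s, {ω | P i ω} := by ext; simp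
  rw [e]
  refine (measureReal_biUnion_finset_le _ _).trans ?_
  refine (Finset.sum_le_sum h).trans ?_
  simp

lemma osc_ae (hH : 0 < H) (hK : 0 < K) (hK1 : K ≤ 1) (hX : IsX μ H K X) :
    ∀ᵐ ω ∂μ, ∀ᶠ n in atTop, ∀ k, n < k → ∀ j : ℕ, j < 2 ^ k →
      |rn n ^ (-(H * K)) * X (rn n * ((2 * j + 1) / 2 ^ k)) ω - rn n ^ (-(H * K)) * X (rn n * (2 * j / 2 ^ k)) ω| ≤
        sg (H * K) k * (2 * k) := by
  have b := bc (μ := μ) (E := fun k : ℕ => {ω | ∃ i ∈ Finset.range k ×ˢ Finset.range (2 ^ k),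
      sg (H * K) k * (2 * k) < |rn i.1 ^ (-(H * K)) * X (rn i.1 * ((2 * i.2 + 1) / 2 ^ k)) ω - rn i.1 ^ (-(H * K)) * X (rn i.1 * (2 * i.2 / 2 ^ k)) ω|})
      (f := fun k : ℕ => 2 * ((8:ℝ) ^ k * (Real.exp (-2)) ^ (k ^ 2)))
      ((sum8 (Real.exp_pos _) (Real.exp_lt_one_iff.2 (by norm_num))).mul_left 2) (Eventually.of_forall fun k => ?_)
  · filter_upwards [b] with ω hω
    obtain ⟨k0, hk0⟩ := eventually_atTop.1 hω
    refine eventually_atTop.2 ⟨k0, fun n hn k hk j hj => ?_⟩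
    have h' : ¬ ∃ i ∈ Finset.range k ×ˢ Finset.range (2 ^ k),
      sg (H * K) k * (2 * k) < |rn i.1 ^ (-(H * K)) * X (rn i.1 * ((2 * i.2 + 1) / 2 ^ k)) ω - rn i.1 ^ (-(H * K)) * X (rn i.1 * (2 * i.2 / 2 ^ k)) ω| := hk0 k (by omega)
    push Not at h'
    exact h' (n, j) (by simp [hk, hj])
  · refine (union_bd2 (q := 2 * Real.exp (-(2 * k:ℝ) ^ 2 / 2)) fun i hi => ?_).trans ?_
    · obtain ⟨C, gv, hC⟩ := (hX.scaled (rn_pos i.1)).dy_gv hH hK hK1 {k}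
      rw [Finset.mem_product, Finset.mem_range, Finset.mem_range] at hi
      exact gv.tail ⟨⟨k, by simp⟩, ⟨i.2, hi.2⟩⟩ (sg_pos _ _) (hC _) (by positivity)
    · rw [Finset.card_product, Finset.card_range, Finset.card_range, ← Real.exp_nat_mul]
      push_cast
      rw [show -(2 * (k:ℝ)) ^ 2 / 2 = k ^ 2 * -2 by ring]
      have h1 : (k:ℝ) ≤ 4 ^ k := by
        have h2 : (k:ℝ) ≤ 2 ^ k := by exact_mod_cast (Nat.lt_two_pow_self).le
        have h3 : (2:ℝ) ^ k ≤ 4 ^ k := by gcongr; norm_num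
        linarith
      calc (k:ℝ) * 2 ^ k * (2 * Real.exp (k ^ 2 * -2)) ≤ 4 ^ k * 2 ^ k * (2 * Real.exp (k ^ 2 * -2)) := by gcongr
        _ = _ := by rw [← mul_pow]; norm_num; ring

lemma sg_tail {h : ℝ} (hh : 0 < h) : ∃ B : ℝ, 0 < B ∧ ∀ n d : ℕ, 1 ≤ n →
    ∑ k ∈ Finset.Ioc n (n + d), sg h k * (2 * k) ≤ B / n := by
  have z1 : (1/2:ℝ) ^ h < 1 := Real.rpow_lt_one (by norm_num) (by norm_num) hh
  have s : Summable fun k : ℕ => Real.sqrt 2 * 2 * ((k:ℝ) ^ 2 * ((1/2:ℝ) ^ h) ^ k) :=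
    (summable_pow_mul_geometric_of_norm_lt_one 2 (r := (1/2:ℝ) ^ h) (by rwa [Real.norm_of_nonneg (by positivity)])).mul_left _
  refine ⟨∑' k : ℕ, Real.sqrt 2 * 2 * ((k:ℝ) ^ 2 * ((1/2:ℝ) ^ h) ^ k) + 1,
    add_pos_of_nonneg_of_pos (tsum_nonneg fun k => by positivity) one_pos, fun n d hn => ?_⟩
  have n0 : (0:ℝ) < n := by exact_mod_cast hn
  rw [le_div_iff₀ n0, Finset.sum_mul]
  calc _ ≤ ∑ k ∈ Finset.Ioc n (n + d), Real.sqrt 2 * 2 * ((k:ℝ) ^ 2 * ((1/2:ℝ) ^ h) ^ k) := by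
        refine Finset.sum_le_sum fun k hk => ?_
        have : (n:ℝ) ≤ k := by exact_mod_cast (Finset.mem_Ioc.1 hk).1.le
        unfold sg
        calc Real.sqrt 2 * ((1/2:ℝ) ^ h) ^ k * (2 * k) * n ≤ Real.sqrt 2 * ((1/2:ℝ) ^ h) ^ k * (2 * k) * k := by gcongr
          _ = _ := by ring
    _ ≤ _ := s.sum_le_tsum _ fun m _ => by positivity
    _ ≤ _ := by linarith

lemma upper_ae (hH : 0 < H) (hH1 : H < 1) (hK : 0 < K) (hK1 : K ≤ 1) :
    ∃ C : ℝ, 0 < C ∧ ∀ X : ℝ → Ω → ℝ, IsX μ H K X → ∀ᵐ ω ∂μ, ∃ᶠ n in atTop, ∀ d j : ℕ, j ≤ 2 ^ d →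
      |X (rn n * (j / 2 ^ d)) ω| ≤ C * phi (H * K) (rn n) := by
  have hHK : 0 < H * K := by positivity
  have hHK1 : H * K < 1 := by nlinarith
  obtain ⟨C1, C2, C10, C20, sb⟩ := small_ball_lower (μ := μ) hH hH1 hK hK1
  obtain ⟨B, B0, hB⟩ := sg_tail hHK
  set m : ℕ → ℕ := fun n => Nat.log 2 ⌊Real.log n / C2⌋₊ with hm
  set ε : ℕ → ℝ := fun n => C1 * ((1/2:ℝ) ^ (H * K)) ^ (m n) with hε
  have tl : Tendsto (fun n : ℕ => Real.log n) atTop atTop :=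
      (Real.tendsto_log_atTop.comp tendsto_natCast_atTop_atTop)
  have ev1 : ∀ᶠ n : ℕ in atTop, (2:ℝ) ^ m n ≤ Real.log n / C2 ∧ Real.log n / C2 ≤ 2 * 2 ^ m n ∧ 1 ≤ Real.log n / C2 := by
    filter_upwards [(tl.atTop_div_const C20).eventually_ge_atTop 1] with n hn
    have h1 : ⌊Real.log n / C2⌋₊ ≠ 0 := by
      have := Nat.floor_pos.2 hn; omega
    refine ⟨?_, ?_, hn⟩
    · have := Nat.pow_log_le_self 2 h1
      calc (2:ℝ) ^ m n ≤ ((⌊Real.log n / C2⌋₊ : ℕ) : ℝ) := by exact_mod_cast this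
        _ ≤ _ := Nat.floor_le (by linarith)
    · have := Nat.lt_pow_succ_log_self (b := 2) (by norm_num) ⌊Real.log n / C2⌋₊
      have h2 : ((⌊Real.log n / C2⌋₊ : ℕ) : ℝ) + 1 ≤ 2 * 2 ^ m n := by
        rw [← pow_succ']; exact_mod_cast this
      linarith [Nat.lt_floor_add_one (Real.log n / C2)]
  have ze : ∀ n, ((1/2:ℝ) ^ (H * K)) ^ (m n) = ((2:ℝ) ^ m n) ^ (-(H * K)) := by
    intro n
    rw [← Real.rpow_natCast, ← Real.rpow_natCast, ← Real.rpow_mul (by norm_num), ← Real.rpow_mul (by norm_num), one_div, Real.inv_rpow (by norm_num), ← Real.rpow_neg (by norm_num)]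
    congr 1; ring
  have lo : ∀ᶠ n : ℕ in atTop, B / n ≤ ε n := by
    have := (Real.isLittleO_log_id_atTop.comp_tendsto tendsto_natCast_atTop_atTop).bound (show 0 < C1 * C2 / B by positivity)
    filter_upwards [ev1, this, eventually_ge_atTop 1] with n ⟨h1, h2, h3⟩ h4 h5
    have n0 : (0:ℝ) < n := by exact_mod_cast h5
    have l0 : 0 < Real.log n := by
      rw [le_div_iff₀ C20] at h3; linarith
    simp only [Function.comp, id, Real.norm_eq_abs, abs_of_pos n0, abs_of_pos l0] at h4
    simp only [hε, ze]
    have h6 : (Real.log n / C2)⁻¹ ≤ ((2:ℝ) ^ m n) ^ (-(H * K)) := by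
      rw [Real.rpow_neg (by positivity)]
      gcongr
      calc ((2:ℝ) ^ m n) ^ (H * K) ≤ (Real.log n / C2) ^ (H * K) := by gcongr
        _ ≤ (Real.log n / C2) ^ (1:ℝ) := Real.rpow_le_rpow_of_exponent_le h3 hHK1.le
        _ = _ := Real.rpow_one _
    refine le_trans ?_ (mul_le_mul_of_nonneg_left h6 C10.le)
    rw [inv_div, ← mul_div_assoc, div_le_div_iff₀ n0 l0]
    rw [div_mul_eq_mul_div, le_div_iff₀ B0] at h4
    linarith
  refine ⟨4 * C1 * (6 * C2) ^ (H * K), by positivity, fun X hX => ?_⟩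
  have io := io_ae hH hH1 hK hK1 B0 lo hX ?_
  · filter_upwards [io, osc_ae hH hK hK1 hX] with ω h1 h2
    refine (h1.and_eventually (h2.and (lo.and (ev1.and (eventually_ge_atTop 3))))).mono ?_
    rintro n ⟨g1, g2, g3, ⟨g4, g5, g6⟩, g7⟩ d j hj
    have n3 : (3:ℝ) ≤ n := by exact_mod_cast g7
    have r0 := rn_pos n
    have ch := chain (f := fun u => rn n ^ (-(H * K)) * X (rn n * u) ω) (β := fun k => sg (H * K) k * (2 * k))
      (fun k => mul_nonneg (sg_pos _ _).le (by positivity)) g1 d (fun k hk _ j hj => g2 k hk j hj) (j * 2 ^ n)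
      (by rw [pow_add, mul_comm]; gcongr)
    beta_reduce at ch
    have e1 : ((j * 2 ^ n : ℕ) : ℝ) / 2 ^ (n + d) = j / 2 ^ d := by
      push_cast; rw [pow_add]; field_simp
    rw [e1, abs_mul, abs_of_pos (Real.rpow_pos_of_pos r0 _), Real.rpow_neg r0.le, ← div_eq_inv_mul, div_le_iff₀ (Real.rpow_pos_of_pos r0 _)] at ch
    refine ch.trans ?_
    have h4 : 3 * ε n + ∑ k ∈ Finset.Ioc n (n + d), sg (H * K) k * (2 * k) ≤ 4 * ε n := by
      linarith [hB n d (by omega)]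
    have l1 : 1 < Real.log n := by
      rw [Real.lt_log_iff_exp_lt (by linarith)]
      linarith [Real.exp_one_lt_three]
    have ll : Real.log (1 / rn n) = n ^ 3 * Real.log 2 := by
      unfold rn
      rw [one_div, Real.log_inv, Real.log_pow, one_div, Real.log_inv]; push_cast; ring
    have l2 := Real.log_two_gt_d9
    have l2' := Real.log_two_lt_d9
    have lg : 1 < Real.log (1 / rn n) := by
      rw [ll]
      have : (27:ℝ) ≤ n ^ 3 := by
        calc (27:ℝ) = 3 ^ 3 := by norm_num
          _ ≤ _ := by gcongr
      nlinarith
    have L0 : 0 < Real.log (Real.log (1 / rn n)) := Real.log_pos lg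
    have L1 : Real.log (Real.log (1 / rn n)) ≤ 3 * Real.log n := by
      rw [show 3 * Real.log n = Real.log ((n:ℝ) ^ 3) by rw [Real.log_pow]; norm_num]
      refine Real.log_le_log (by linarith) ?_
      rw [ll]
      have : (0:ℝ) < n ^ 3 := by positivity
      nlinarith
    refine (mul_le_mul_of_nonneg_right h4 (by positivity)).trans ?_
    have h5 : ((2:ℝ) ^ m n) ^ (-(H * K)) ≤ (6 * C2) ^ (H * K) / Real.log (Real.log (1 / rn n)) ^ (H * K) := by
      rw [Real.rpow_neg (by positivity), ← Real.div_rpow (by positivity) L0.le, ← Real.inv_rpow (by positivity)]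
      refine Real.rpow_le_rpow (by positivity) ?_ hHK.le
      rw [inv_le_iff_one_le_mul₀ (by positivity), div_mul_eq_mul_div, le_div_iff₀ L0]
      rw [div_le_iff₀ C20] at g5
      linarith
    simp only [hε, ze, phi]
    calc 4 * (C1 * ((2:ℝ) ^ m n) ^ (-(H * K))) * rn n ^ (H * K) ≤ 4 * (C1 * ((6 * C2) ^ (H * K) / Real.log (Real.log (1 / rn n)) ^ (H * K))) * rn n ^ (H * K) := by gcongr
      _ = _ := by ring
  · filter_upwards [ev1, eventually_ge_atTop 1] with n ⟨h1, h2, h3⟩ h5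
    have n0 : (0:ℝ) < n := by exact_mod_cast h5
    refine le_trans ?_ (sb _ (hX.scaled (rn_pos n)) n (m n))
    rw [one_div, ← Real.exp_log n0, ← Real.exp_neg]
    refine Real.exp_le_exp.2 ?_
    rw [le_div_iff₀ C20] at h1
    linarith
end BifChung

namespace BifChung
section
variable {Ω : Type*} [MeasurableSpace Ω] {μ : Measure Ω} [IsProbabilityMeasure μ] {H K : ℝ} {X : ℝ → Ω → ℝ}
  {ι : Type} [Fintype ι]

lemma IsGV.cos {Y : ι → Ω → ℝ} {C : ι → ι → ℝ} (h : IsGV μ Y C) (a : ι → ℝ) :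
    ∫ ω, Real.cos (∑ i, a i * Y i ω) ∂μ = Real.exp (-(qf C a) / 2) := by
  have h1 := congrArg Complex.re (h.2.2 a)
  have hm : Measurable fun ω => ∑ i, a i * Y i ω := Finset.measurable_sum _ fun i _ => (h.1 i).const_mul _
  have h2 := integral_re (𝕜 := ℂ) (exp_integrable (μ := μ) hm)
  simp only [RCLike.re_to_complex] at h2
  rw [Complex.ofReal_re, ← h2] at h1
  rw [← h1]
  congr 1
  ext ω
  rw [Complex.exp_ofReal_mul_I_re]

lemma IsGV.cos_sub {Y : ι → Ω → ℝ} {C : ι → ι → ℝ} (h : IsGV μ Y C) (i j : ι) :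
    ∫ ω, Real.cos (Y i ω - Y j ω) ∂μ = Real.exp (-(C i i + C j j - 2 * C i j) / 2) := by
  have := (h.reindex ![i, j]).cos ![1, -1]
  simp only [qf, Fin.sum_univ_two, Matrix.cons_val_zero, Matrix.cons_val_one, one_mul, neg_mul, mul_neg, neg_neg, ← sub_eq_add_neg] at this
  rw [this, h.2.1 j i]
  congr 2; ring

lemma IsGV.cos_one {Y : ι → Ω → ℝ} {C : ι → ι → ℝ} (h : IsGV μ Y C) (i : ι) :
    ∫ ω, Real.cos (Y i ω) ∂μ = Real.exp (-(C i i) / 2) := by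
  have := (h.reindex ![i]).cos ![1]
  simpa [qf] using this

lemma cos_integrable {f : Ω → ℝ} (hf : Measurable f) : Integrable (fun ω => Real.cos (f ω)) μ :=
  Integrable.of_bound (C := 1) (Real.measurable_cos.comp hf).aestronglyMeasurable (ae_of_all _ fun ω => Real.abs_cos_le_one _)

lemma sin_integrable {f : Ω → ℝ} (hf : Measurable f) : Integrable (fun ω => Real.sin (f ω)) μ :=
  Integrable.of_bound (C := 1) (Real.measurable_sin.comp hf).aestronglyMeasurable (ae_of_all _ fun ω => Real.abs_sin_le_one _)

lemma sq_expand (θ : ι → ℝ) (m : ℝ) : (∑ i, (Real.cos (θ i) - m)) ^ 2 + (∑ i, Real.sin (θ i)) ^ 2 =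
    ∑ i, ∑ j, (Real.cos (θ i - θ j) - m * Real.cos (θ i) - m * Real.cos (θ j) + m ^ 2) := by
  rw [sq, sq, Finset.sum_mul_sum, Finset.sum_mul_sum, ← Finset.sum_add_distrib]
  refine Finset.sum_congr rfl fun i _ => ?_
  rw [← Finset.sum_add_distrib]
  refine Finset.sum_congr rfl fun j _ => ?_
  rw [Real.cos_sub]; ring

lemma gv_avg {U : ι → Ω → ℝ} {C : ι → ι → ℝ} (h : IsGV μ U C) {q δ : ℝ} (hq0 : 0 ≤ q) (hq : ∀ i, C i i = q)
    (hδ1 : δ ≤ 1) (hC : ∀ i j, i ≠ j → |C i j| ≤ δ) (hδ : 0 ≤ δ) :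
    ∫ ω, ((∑ i, (Real.cos (U i ω) - Real.exp (-q / 2))) ^ 2 + (∑ i, Real.sin (U i ω)) ^ 2) ∂μ ≤
      Fintype.card ι + (Fintype.card ι : ℝ) ^ 2 * (2 * δ) := by
  classical
  simp only [sq_expand]
  obtain ⟨m, hm⟩ : ∃ m, m = Real.exp (-q / 2) := ⟨_, rfl⟩
  rw [← hm]
  have m2 : m ^ 2 = Real.exp (-q) := by rw [hm, sq, ← Real.exp_add]; congr 1; ring
  have hi : ∀ i j, Integrable (fun ω => Real.cos (U i ω - U j ω) - m * Real.cos (U i ω) - m * Real.cos (U j ω) + m ^ 2) μ :=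
    fun i j => (((cos_integrable ((h.1 i).sub (h.1 j))).sub ((cos_integrable (h.1 i)).const_mul _)).sub ((cos_integrable (h.1 j)).const_mul _)).add (integrable_const _)
  rw [integral_finsetSum _ fun i _ => integrable_finsetSum _ fun j _ => hi i j]
  have val : ∀ i j, ∫ ω, (Real.cos (U i ω - U j ω) - m * Real.cos (U i ω) - m * Real.cos (U j ω) + m ^ 2) ∂μ ≤
      (if i = j then 1 else 0) + 2 * δ := by
    intro i j
    have e1 : ∫ ω, (Real.cos (U i ω - U j ω) - m * Real.cos (U i ω) - m * Real.cos (U j ω) + m ^ 2) ∂μ =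
        Real.exp (-q) * (Real.exp (C i j) - 1) := by
      have i1 : Integrable (fun ω => Real.cos (U i ω - U j ω)) μ := cos_integrable ((h.1 i).sub (h.1 j))
      have i2 : ∀ i, Integrable (fun ω => m * Real.cos (U i ω)) μ := fun i => (cos_integrable (h.1 i)).const_mul _
      have i3 : Integrable (fun ω => Real.cos (U i ω - U j ω) - m * Real.cos (U i ω)) μ := i1.sub (i2 i)
      have i4 : Integrable (fun ω => Real.cos (U i ω - U j ω) - m * Real.cos (U i ω) - m * Real.cos (U j ω)) μ := i3.sub (i2 j)
      rw [integral_add i4 (integrable_const _), integral_sub i3 (i2 j), integral_sub i1 (i2 i),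
        integral_const_mul, integral_const_mul, h.cos_one, h.cos_one, h.cos_sub, hq, hq, integral_const, ← hm, ← sq, m2]
      simp only [probReal_univ, one_smul]
      rw [mul_sub, ← Real.exp_add, show -(q + q - 2 * C i j) / 2 = -q + C i j by ring]
      ring
    rw [e1]
    split_ifs with hij
    · subst hij
      rw [hq, mul_sub, ← Real.exp_add]
      simp
      linarith [Real.exp_pos (-q)]
    · have h1 := hC i j hij
      have h2 := Real.abs_exp_sub_one_le (h1.trans hδ1)
      have h3 : Real.exp (-q) ≤ 1 := Real.exp_le_one_iff.2 (by linarith)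
      have h4 := Real.exp_pos (-q)
      calc Real.exp (-q) * (Real.exp (C i j) - 1) ≤ Real.exp (-q) * |Real.exp (C i j) - 1| := by gcongr; exact le_abs_self _
        _ ≤ 1 * (2 * δ) := by
            gcongr
            linarith
        _ = _ := by ring
  calc _ ≤ ∑ i : ι, ∑ j : ι, ((if i = j then 1 else 0) + 2 * δ) := by
        refine Finset.sum_le_sum fun i _ => ?_
        rw [integral_finsetSum _ fun j _ => hi i j]
        exact Finset.sum_le_sum fun j _ => val i j
    _ = _ := by
        simp [Finset.sum_add_distrib]
        ring
end
end BifChung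

namespace BifChung
open scoped NNRat
variable {ν : Measure (ℚ≥0 → ℝ)} [IsProbabilityMeasure ν] {H K : ℝ}

/-- law of bifractional Brownian motion on rational times -/
def IsP (ν : Measure (ℚ≥0 → ℝ)) (H K : ℝ) : Prop :=
  ∀ {ι : Type} [Fintype ι] (f : ι → ℚ≥0), IsGV ν (fun i x => x (f i)) (fun i j => Rbif H K (f i) (f j))

noncomputable def Tn (h : ℝ) (n : ℕ) (x : ℚ≥0 → ℝ) : ℚ≥0 → ℝ := fun q => ((2:ℝ) ^ n) ^ (-h) * x (2 ^ n * q)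

lemma Tn_meas (h : ℝ) (n : ℕ) : Measurable (Tn h n) :=
  measurable_pi_lambda _ fun q => (measurable_pi_apply _).const_mul _

lemma sc_cov (n : ℕ) (s t : ℚ≥0) :
    ((2:ℝ) ^ n) ^ (-(H * K)) * ((2:ℝ) ^ n) ^ (-(H * K)) * Rbif H K ((2 ^ n * s : ℚ≥0) : ℝ) ((2 ^ n * t : ℚ≥0) : ℝ) = Rbif H K s t := by
  push_cast
  have h2 : (0:ℝ) < 2 ^ n := by positivity
  rw [R_scale h2 (by positivity) (by positivity), ← mul_assoc, ← Real.rpow_add h2, ← Real.rpow_add h2]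
  rw [show -(H * K) + -(H * K) + 2 * H * K = 0 by ring, Real.rpow_zero, one_mul]

lemma Tn_map (hP : IsP ν H K) (n : ℕ) : ν.map (Tn (H * K) n) = ν := by
  have : IsProbabilityMeasure (ν.map (Tn (H * K) n)) := Measure.isProbabilityMeasure_map (Tn_meas _ _).aemeasurable
  refine IsProjectiveLimit.unique (P := fun J : Finset ℚ≥0 => ν.map J.restrict) (fun J => ?_) (fun J => rfl)
  rw [Measure.map_map (by fun_prop) (Tn_meas _ _)]
  have h1 := hP (fun i : J => (i : ℚ≥0))
  have h2 := ((hP (fun i : J => 2 ^ n * (i : ℚ≥0))).smuli (fun _ => ((2:ℝ) ^ n) ^ (-(H * K)))).congrC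
    (fun i j => sc_cov n i j)
  exact h2.law h1

lemma sc_decay (hH : 0 < H) (hH1 : H < 1) (hK : 0 < K) (hK1 : K ≤ 1) : ∃ ρ : ℝ, 0 < ρ ∧ ρ < 1 ∧
    ∀ (M : ℝ), 0 < M → ∀ n k : ℕ, ∀ d : ℕ, n + d ≤ k ∨ k + d ≤ n → ∀ s t : ℚ≥0, (s:ℝ) ≤ M → (t:ℝ) ≤ M →
    |((2:ℝ) ^ n) ^ (-(H * K)) * ((2:ℝ) ^ k) ^ (-(H * K)) * Rbif H K ((2 ^ n * s : ℚ≥0) : ℝ) ((2 ^ k * t : ℚ≥0) : ℝ)| ≤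
      3 * M ^ (2 * (H * K)) * ρ ^ d := by
  have hHK : 0 < H * K := by positivity
  have hHK1 : H * K < 1 := by nlinarith
  obtain ⟨g, hg⟩ : ∃ g, g = min (2 * (H * K)) 1 := ⟨_, rfl⟩
  have g0 : 0 < g := by rw [hg]; exact lt_min (by positivity) one_pos
  have g1 : g ≤ 1 := by rw [hg]; exact min_le_right _ _
  have g2 : g ≤ 2 * (H * K) := by rw [hg]; exact min_le_left _ _
  have g3 : 0 < g - H * K := by rw [hg, sub_pos]; exact lt_min (by linarith) hHK1
  refine ⟨(1/2:ℝ) ^ (g - H * K), by positivity, Real.rpow_lt_one (by norm_num) (by norm_num) g3, fun M M0 => ?_⟩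
  have key : ∀ n k d : ℕ, n + d ≤ k → ∀ s t : ℚ≥0, (s:ℝ) ≤ M → (t:ℝ) ≤ M →
      |((2:ℝ) ^ n) ^ (-(H * K)) * ((2:ℝ) ^ k) ^ (-(H * K)) * Rbif H K ((2 ^ n * s : ℚ≥0) : ℝ) ((2 ^ k * t : ℚ≥0) : ℝ)| ≤
      3 * M ^ (2 * (H * K)) * ((1/2:ℝ) ^ (g - H * K)) ^ d := by
    intro n k d hd s t hs ht
    push_cast
    have s0 : (0:ℝ) ≤ s := by positivity
    have t0 : (0:ℝ) ≤ t := by positivity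
    have a0 : (0:ℝ) < 2 ^ n := by positivity
    have b0 : (0:ℝ) < 2 ^ k := by positivity
    have hle : (2:ℝ) ^ n ≤ 2 ^ k := pow_le_pow_right₀ (by norm_num) (by omega)
    have := R_decay hH hH1 hK hK1 (x := 2 ^ n * s) (y := 2 ^ k * t) (a := 2 ^ n * M) (b := 2 ^ k * M) (by positivity) (by gcongr) (by positivity) (by gcongr) (by positivity) (by gcongr) g0 g1 g2
    rw [abs_mul, abs_of_pos (by positivity)]
    calc ((2:ℝ) ^ n) ^ (-(H * K)) * ((2:ℝ) ^ k) ^ (-(H * K)) * |Rbif H K (2 ^ n * s) (2 ^ k * t)|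
        ≤ ((2:ℝ) ^ n) ^ (-(H * K)) * ((2:ℝ) ^ k) ^ (-(H * K)) * (3 * (2 ^ n * M) ^ g * (2 ^ k * M) ^ (2 * (H * K) - g)) := by gcongr
      _ = 3 * (M ^ g * M ^ (2 * (H * K) - g)) * (((2:ℝ) ^ n) ^ (-(H * K)) * ((2:ℝ) ^ n) ^ g) * (((2:ℝ) ^ k) ^ (-(H * K)) * ((2:ℝ) ^ k) ^ (2 * (H * K) - g)) := by
          rw [Real.mul_rpow a0.le M0.le, Real.mul_rpow b0.le M0.le]; ring
      _ = 3 * M ^ (2 * (H * K)) * ((2:ℝ) ^ n / 2 ^ k) ^ (g - H * K) := by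
          rw [← Real.rpow_add M0, ← Real.rpow_add a0, ← Real.rpow_add b0, Real.div_rpow a0.le b0.le,
            show -(H * K) + (2 * (H * K) - g) = -(g - H * K) by ring, Real.rpow_neg b0.le]
          ring_nf
      _ ≤ 3 * M ^ (2 * (H * K)) * ((1/2:ℝ) ^ d) ^ (g - H * K) := by
          gcongr
          rw [div_le_iff₀ b0, one_div, inv_pow, ← div_eq_inv_mul, le_div_iff₀ (by positivity), ← pow_add]
          exact pow_le_pow_right₀ (by norm_num) hd
      _ = _ := by
          rw [← Real.rpow_natCast, ← Real.rpow_natCast, ← Real.rpow_mul (by norm_num), ← Real.rpow_mul (by norm_num), mul_comm (g - H * K)]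
  intro n k d hd s t hs ht
  rcases hd with hd | hd
  · exact key n k d hd s t hs ht
  · rw [R_symm, mul_comm (((2:ℝ) ^ n) ^ _)]
    exact key k n d hd t s ht hs

lemma avg_step {Ω : Type*} [MeasurableSpace Ω] {μ : Measure Ω} [IsProbabilityMeasure μ] {A : Set Ω} {N : ℕ} {η : ℝ}
    (η0 : 0 < η) (hN : 2 / η ^ 2 < N) (V : Fin N → Ω → ℝ) (hV : ∀ l, Integrable (V l) μ) {c : ℝ}
    (hc : ∀ l, ∫ x in A, V l x ∂μ = c) {Q : Ω → ℝ} (hQi : Integrable Q μ) (hQ : ∀ ω, (∑ l, V l ω) ^ 2 ≤ Q ω)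
    (hb : ∫ ω, Q ω ∂μ ≤ N + (N:ℝ) ^ 2 * (2 * (η ^ 2 / 4))) : |c| ≤ η := by
  have N0 : (0:ℝ) < N := lt_trans (by positivity) hN
  have e1 : ∫ x in A, ∑ l, V l x ∂μ = N * c := by
    rw [integral_finsetSum _ fun l _ => (hV l).integrableOn]
    simp [hc]
  have hi : Integrable (fun x => ∑ l, V l x) μ := integrable_finsetSum _ fun l _ => hV l
  have e2 : |(N:ℝ) * c| ≤ ∫ x, |∑ l, V l x| ∂μ := by
    rw [← e1]
    refine (abs_integral_le_integral_abs).trans ?_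
    exact setIntegral_le_integral hi.abs (ae_of_all _ fun x => abs_nonneg _)
  have e3 : ∫ x, |∑ l, V l x| ∂μ ≤ ∫ x, (N * η / 2 + Q x / (2 * (N * η))) ∂μ := by
    refine integral_mono hi.abs ((integrable_const _).add (hQi.div_const _)) fun x => ?_
    have h1 := hQ x
    rw [← sq_abs] at h1
    beta_reduce
    rw [← sub_nonneg]
    have : 0 < N * η := by positivity
    have h2 : N * η / 2 + Q x / (2 * (N * η)) - |∑ l, V l x| = ((N * η) ^ 2 + Q x - 2 * (N * η) * |∑ l, V l x|) / (2 * (N * η)) := by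
      field_simp
    rw [h2]
    apply div_nonneg _ (by positivity)
    nlinarith [sq_nonneg (N * η - |∑ l, V l x|)]
  have e4 : ∫ x, (N * η / 2 + Q x / (2 * (N * η))) ∂μ = N * η / 2 + (∫ x, Q x ∂μ) / (2 * (N * η)) := by
    rw [integral_add (integrable_const _) (hQi.div_const _), integral_const]
    simp only [probReal_univ, one_smul]
    rw [integral_div]
  have e5 : (∫ x, Q x ∂μ) / (2 * (N * η)) ≤ N * η / 2 := by
    rw [div_le_iff₀ (by positivity)]
    rw [div_lt_iff₀ (by positivity)] at hN
    nlinarith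
  rw [abs_mul, abs_of_pos N0] at e2
  have : (N:ℝ) * |c| ≤ N * η := by linarith
  exact le_of_mul_le_mul_left this N0

lemma inv_int (hP : IsP ν H K) {A : Set (ℚ≥0 → ℝ)} (mA : MeasurableSet A) {n : ℕ}
    (hA : Tn (H * K) n ⁻¹' A =ᵐ[ν] A) {g : (ℚ≥0 → ℝ) → ℝ} (hg : Measurable g) :
    ∫ x in A, g (Tn (H * K) n x) ∂ν = ∫ x in A, g x ∂ν := by
  rw [← setIntegral_congr_set hA]
  conv_rhs => rw [← Tn_map hP n]
  rw [setIntegral_map mA hg.aestronglyMeasurable (Tn_meas _ _).aemeasurable]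

/-- key decorrelation estimate -/
lemma inv_cf (hH : 0 < H) (hH1 : H < 1) (hK : 0 < K) (hK1 : K ≤ 1) (hP : IsP ν H K) {A : Set (ℚ≥0 → ℝ)}
    (mA : MeasurableSet A) (hA : ∀ n, Tn (H * K) n ⁻¹' A =ᵐ[ν] A) (J : Finset ℚ≥0) (a : J → ℝ) {η : ℝ} (η0 : 0 < η) (η1 : η ≤ 1) :
    |∫ x in A, (Real.cos (∑ i, a i * x i) - Real.exp (-(qf (fun i j : J => Rbif H K i j) a) / 2)) ∂ν| ≤ η ∧
    |∫ x in A, Real.sin (∑ i, a i * x i) ∂ν| ≤ η := by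
  obtain ⟨ρ, ρ0, ρ1, dec⟩ := sc_decay hH hH1 hK hK1
  obtain ⟨q, hq⟩ : ∃ q, q = qf (fun i j : J => Rbif H K i j) a := ⟨_, rfl⟩
  rw [← hq]
  have q0 : 0 ≤ q := by rw [hq]; exact (hP (fun i : J => (i : ℚ≥0))).nonneg a
  obtain ⟨M, M0, hM⟩ : ∃ M : ℝ, 0 < M ∧ ∀ i : J, ((i : ℚ≥0) : ℝ) ≤ M := by
    refine ⟨∑ j : J, ((j : ℚ≥0) : ℝ) + 1, by positivity, fun i => ?_⟩
    have := Finset.single_le_sum (f := fun j : J => ((j : ℚ≥0) : ℝ)) (fun j _ => by positivity) (Finset.mem_univ i)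
    linarith
  obtain ⟨S, hS⟩ : ∃ S, S = ∑ e : J, ∑ f : J, |a e * a f| := ⟨_, rfl⟩
  have S0 : 0 ≤ S := by rw [hS]; positivity
  obtain ⟨D, hD⟩ : ∃ D, D = S * (3 * M ^ (2 * (H * K))) := ⟨_, rfl⟩
  obtain ⟨d, hd⟩ : ∃ d : ℕ, D * ρ ^ d ≤ η ^ 2 / 4 := by
    have := ((tendsto_pow_atTop_nhds_zero_of_lt_one ρ0.le ρ1).const_mul D).eventually (ge_mem_nhds (show D * 0 < η ^ 2 / 4 by rw [mul_zero]; positivity))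
    exact this.exists
  obtain ⟨N, hN⟩ : ∃ N : ℕ, 2 / η ^ 2 < N := exists_nat_gt _
  have N0 : (0:ℝ) < N := lt_trans (by positivity) hN
  have gv := ((hP (fun p : Fin N × J => 2 ^ ((p.1 : ℕ) * d) * (p.2 : ℚ≥0))).smuli
    (fun p => ((2:ℝ) ^ ((p.1 : ℕ) * d)) ^ (-(H * K)))).blk a
  set U : (ℚ≥0 → ℝ) → ℝ := fun x => ∑ i, a i * x i with hU
  have mU : Measurable U := Finset.measurable_sum _ fun i _ => (measurable_pi_apply _).const_mul _
  have gv' : IsGV ν (fun (l : Fin N) x => U (Tn (H * K) (l * d) x)) _ := gv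
  have avg := gv_avg gv' q0 (δ := η ^ 2 / 4) ?_ ?_ ?_ (by positivity)
  · rw [Fintype.card_fin] at avg
    have mUl : ∀ l : Fin N, Measurable fun x => U (Tn (H * K) (l * d) x) := fun l => mU.comp (Tn_meas _ _)
    have iC : ∀ l : Fin N, Integrable (fun x => Real.cos (U (Tn (H * K) (l * d) x)) - Real.exp (-q / 2)) ν :=
      fun l => (cos_integrable (mUl l)).sub (integrable_const _)
    have iS : ∀ l : Fin N, Integrable (fun x => Real.sin (U (Tn (H * K) (l * d) x))) ν :=
      fun l => sin_integrable (mUl l)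
    have hQi : Integrable (fun x => (∑ l : Fin N, (Real.cos (U (Tn (H * K) (l * d) x)) - Real.exp (-q / 2))) ^ 2 + (∑ l : Fin N, Real.sin (U (Tn (H * K) (l * d) x))) ^ 2) ν := by
      simp only [sq_expand]
      exact integrable_finsetSum _ fun i _ => integrable_finsetSum _ fun j _ =>
        (((cos_integrable ((mUl i).sub (mUl j))).sub ((cos_integrable (mUl i)).const_mul _)).sub ((cos_integrable (mUl j)).const_mul _)).add (integrable_const _)
    constructor
    · refine avg_step η0 hN (A := A) _ iC (fun l => ?_) hQi (fun x => le_add_of_nonneg_right (sq_nonneg _)) avg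
      exact inv_int hP mA (hA _) ((Real.measurable_cos.comp mU).sub_const _)
    · refine avg_step η0 hN (A := A) _ iS (fun l => ?_) hQi (fun x => le_add_of_nonneg_left (sq_nonneg _)) avg
      exact inv_int hP mA (hA _) (Real.measurable_sin.comp mU)
  · intro l
    rw [hq]
    simp only [sc_cov]
    rfl
  · nlinarith
  · intro l k hlk
    refine le_trans ?_ hd
    rw [hD, hS, Finset.sum_mul, Finset.sum_mul]
    refine (Finset.abs_sum_le_sum_abs _ _).trans (Finset.sum_le_sum fun e _ => ?_)
    rw [Finset.sum_mul, Finset.sum_mul]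
    refine (Finset.abs_sum_le_sum_abs _ _).trans (Finset.sum_le_sum fun f _ => ?_)
    rw [abs_mul, mul_assoc |a e * a f|]
    refine mul_le_mul_of_nonneg_left (dec M M0 _ _ d ?_ _ _ (hM e) (hM f)) (abs_nonneg _)
    rcases lt_or_gt_of_ne (fun h => hlk (Fin.ext h) : (l:ℕ) ≠ k) with h | h
    · left; nlinarith
    · right; nlinarith

lemma zero_one (hH : 0 < H) (hH1 : H < 1) (hK : 0 < K) (hK1 : K ≤ 1) (hP : IsP ν H K) {A : Set (ℚ≥0 → ℝ)}
    (mA : MeasurableSet A) (hA : ∀ n, Tn (H * K) n ⁻¹' A =ᵐ[ν] A) : ν A = 0 ∨ ν A = 1 := by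
  have key : ν.restrict A = (ν A) • ν := by
    have : IsFiniteMeasure ((ν A) • ν) := ⟨by
      rw [Measure.smul_apply, smul_eq_mul]
      exact ENNReal.mul_lt_top (measure_lt_top _ _) (measure_lt_top _ _)⟩
    refine IsProjectiveLimit.unique (P := fun J : Finset ℚ≥0 => ((ν A) • ν).map J.restrict) (fun J => ?_) (fun J => rfl)
    refine ext_cf fun a => ?_
    have mr : Measurable (J.restrict : (ℚ≥0 → ℝ) → (J → ℝ)) := by fun_prop
    have mc : ∀ m : Measure (J → ℝ), AEStronglyMeasurable (fun x : J → ℝ => Complex.exp (((∑ i, a i * x i : ℝ) : ℂ) * Complex.I)) m := by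
      intro m
      refine Continuous.aestronglyMeasurable ?_
      fun_prop
    rw [integral_map mr.aemeasurable (mc _), integral_map mr.aemeasurable (mc _), integral_smul_measure]
    have h2 := (hP (fun i : J => (i : ℚ≥0))).2.2 a
    have mU : Measurable fun x : ℚ≥0 → ℝ => ∑ i : J, a i * x i := Finset.measurable_sum _ fun i _ => (measurable_pi_apply _).const_mul _
    simp only [Finset.restrict]
    rw [h2]
    have hc : ∫ x in A, Real.cos (∑ i : J, a i * x i) ∂ν = (ν.real A) * Real.exp (-(qf (fun i j : J => Rbif H K (i:ℚ≥0) (j:ℚ≥0)) a) / 2) := by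
      rw [← sub_eq_zero, ← abs_nonpos_iff]
      refine le_of_forall_pos_le_add fun η η0 => ?_
      have := (inv_cf hH hH1 hK hK1 hP mA hA J a (η := min η 1) (by positivity) (min_le_right _ _)).1
      rw [integral_sub (cos_integrable mU).integrableOn (integrable_const _)] at this
      simp only [integral_const, measureReal_restrict_apply_univ, smul_eq_mul] at this
      rw [zero_add]
      exact this.trans (min_le_left _ _)
    have hs : ∫ x in A, Real.sin (∑ i : J, a i * x i) ∂ν = 0 := by
      rw [← abs_nonpos_iff]
      refine le_of_forall_pos_le_add fun η η0 => ?_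
      have := (inv_cf hH hH1 hK hK1 hP mA hA J a (η := min η 1) (by positivity) (min_le_right _ _)).2
      rw [zero_add]
      exact this.trans (min_le_left _ _)
    have ei := (exp_integrable (μ := ν) mU).integrableOn (s := A)
    have r1 := integral_re (𝕜 := ℂ) ei
    have r2 := integral_im (𝕜 := ℂ) ei
    simp only [RCLike.re_to_complex, RCLike.im_to_complex, Complex.exp_ofReal_mul_I_re, Complex.exp_ofReal_mul_I_im] at r1 r2
    apply Complex.ext
    · rw [← r1, hc, Complex.real_smul, Complex.re_ofReal_mul, Complex.ofReal_re]; rfl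
    · rw [← r2, hs, Complex.real_smul, Complex.im_ofReal_mul, Complex.ofReal_im, mul_zero]
  have := congrArg (fun m => m A) key
  simp only [Measure.restrict_apply_self, Measure.smul_apply, smul_eq_mul] at this
  by_cases h0 : ν A = 0
  · exact Or.inl h0
  · right
    have h3 : ν A * 1 = ν A * ν A := by rw [mul_one]; exact this
    exact ((ENNReal.mul_right_inj h0 (measure_ne_top _ _)).1 h3).symm
end BifChung

namespace BifChung
open scoped NNRat
section
variable {Ω : Type*} [MeasurableSpace Ω] {μ : Measure Ω} [IsProbabilityMeasure μ] {H K : ℝ} {X : ℝ → Ω → ℝ}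

lemma ll_pos {r : ℝ} (r0 : 0 < r) (r1 : r ≤ 1/3) : 1 < Real.log (1 / r) ∧ 0 < Real.log (Real.log (1 / r)) := by
  have h1 : 1 < Real.log (1 / r) := by
    rw [Real.lt_log_iff_exp_lt (by positivity)]
    have : 3 ≤ 1 / r := by rw [le_div_iff₀ r0]; linarith
    linarith [Real.exp_one_lt_three]
  exact ⟨h1, Real.log_pos h1⟩

lemma phi_pos {h r : ℝ} (r0 : 0 < r) (r1 : r ≤ 1/3) : 0 < phi h r := by
  have := (ll_pos r0 r1).2
  unfold phi; positivity

lemma phi_scale {h r s : ℝ} (hh : 0 < h) (r0 : 0 < r) (hs : 1 ≤ s) (r1 : s * r ≤ 1/3) : s ^ h * phi h r ≤ phi h (s * r) := by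
  have s0 : 0 < s := by linarith
  have a := ll_pos (mul_pos s0 r0) r1
  unfold phi
  rw [Real.mul_rpow s0.le r0.le, ← mul_div_assoc]
  have := a.1
  have := a.2
  gcongr
  nlinarith

lemma phi_cont {h r : ℝ} (r0 : 0 < r) (r1 : r ≤ 1/3) : ContinuousAt (phi h) r := by
  have a := ll_pos r0 r1
  unfold phi
  refine ContinuousAt.div ?_ ?_ ?_
  · exact Real.continuousAt_rpow_const _ _ (Or.inl r0.ne')
  · refine ContinuousAt.rpow_const ?_ (Or.inl a.2.ne')
    refine ContinuousAt.log (ContinuousAt.log ?_ (by positivity)) (by linarith [a.1])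
    exact continuousAt_const.div continuousAt_id r0.ne'
  · have := a.2; positivity

/-- the event that the process is small infinitely often -/
def Ec (h c : ℝ) : Set (ℚ≥0 → ℝ) :=
  {x | ∀ N : ℕ, ∃ r : ℚ≥0, 0 < r ∧ (r:ℝ) < 1 / (N + 1) ∧ ∀ q, q ≤ r → |x q| ≤ c * phi h r}

lemma Ec_meas (h c : ℝ) : MeasurableSet (Ec h c) := by
  unfold Ec
  have : {x : ℚ≥0 → ℝ | ∀ N : ℕ, ∃ r : ℚ≥0, 0 < r ∧ (r:ℝ) < 1 / (N + 1) ∧ ∀ q, q ≤ r → |x q| ≤ c * phi h r} =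
    ⋂ N : ℕ, ⋃ r : ℚ≥0, ⋃ (_ : 0 < r), ⋃ (_ : (r:ℝ) < 1 / (N + 1)), ⋂ q : ℚ≥0, ⋂ (_ : q ≤ r), {x | |x q| ≤ c * phi h r} := by
    ext x; simp [and_left_comm]
  rw [this]
  refine MeasurableSet.iInter fun N => MeasurableSet.iUnion fun r => MeasurableSet.iUnion fun _ => MeasurableSet.iUnion fun _ =>
    MeasurableSet.iInter fun q => MeasurableSet.iInter fun _ => ?_
  exact measurableSet_le (measurable_pi_apply q).abs measurable_const

lemma Ec_mono {h c c' : ℝ} (hc : c ≤ c') : Ec h c ⊆ Ec h c' := by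
  intro x hx N
  obtain ⟨r, r0, r1, hr⟩ := hx (N + 2)
  have r0' : (0:ℝ) < r := by exact_mod_cast r0
  have h1 : (r:ℝ) ≤ 1/3 := r1.le.trans (by push_cast; apply one_div_le_one_div_of_le (by norm_num); linarith [(Nat.cast_nonneg N : (0:ℝ) ≤ N)])
  refine ⟨r, r0, r1.trans_le (by push_cast; apply one_div_le_one_div_of_le (by positivity); linarith), fun q hq => (hr q hq).trans ?_⟩
  have := phi_pos (h := h) r0' h1
  gcongr

lemma Ec_inv {h c : ℝ} (hh : 0 < h) (hc : 0 ≤ c) (n : ℕ) : Tn h n ⁻¹' Ec h c ⊆ Ec h c := by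
  intro x hx N
  have p0 : (0:ℝ) < 2 ^ n := by positivity
  obtain ⟨r, r0, r1, hr⟩ := (show Tn h n x ∈ Ec h c from hx) (2 ^ n * (N + 3))
  have r0' : (0:ℝ) < r := by exact_mod_cast r0
  have N0 : (0:ℝ) ≤ N := Nat.cast_nonneg N
  have h2 : (2:ℝ) ^ n * r < 1 / (N + 3) := by
    rw [lt_div_iff₀ (by positivity)] at r1 ⊢
    push_cast at r1
    nlinarith
  have h3 : (1:ℝ) / (N + 3) ≤ 1 / 3 := by apply one_div_le_one_div_of_le (by norm_num); linarith
  have h4 : (1:ℝ) / (N + 3) ≤ 1 / (N + 1) := by apply one_div_le_one_div_of_le (by positivity); linarith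
  refine ⟨2 ^ n * r, by positivity, by push_cast; linarith, fun q hq => ?_⟩
  have h5 := hr (q / 2 ^ n) (by rw [div_le_iff₀ (by positivity), mul_comm]; exact hq)
  unfold Tn at h5
  rw [mul_div_cancel₀ _ (by positivity), abs_mul, abs_of_pos (Real.rpow_pos_of_pos p0 _), Real.rpow_neg p0.le, ← div_eq_inv_mul, div_le_iff₀ (Real.rpow_pos_of_pos p0 _)] at h5
  refine h5.trans ?_
  push_cast
  have := phi_scale hh r0' (one_le_pow₀ (by norm_num) : (1:ℝ) ≤ 2 ^ n) (by linarith)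
  calc c * phi h r * (2 ^ n) ^ h = c * ((2 ^ n) ^ h * phi h r) := by ring
    _ ≤ _ := by gcongr

lemma Ec_01 (hH : 0 < H) (hH1 : H < 1) (hK : 0 < K) (hK1 : K ≤ 1) (hX : IsX μ H K X) {c : ℝ} (hc : 0 ≤ c) :
    (∀ᵐ ω ∂μ, (fun q : ℚ≥0 => X q ω) ∈ Ec (H * K) c) ∨ (∀ᵐ ω ∂μ, (fun q : ℚ≥0 => X q ω) ∉ Ec (H * K) c) := by
  have hHK : 0 < H * K := by positivity
  have mZ : Measurable fun ω => fun q : ℚ≥0 => X q ω := measurable_pi_lambda _ fun q => hX.1 q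
  have : IsProbabilityMeasure (μ.map fun ω => fun q : ℚ≥0 => X q ω) := Measure.isProbabilityMeasure_map mZ.aemeasurable
  have hP : IsP (μ.map fun ω => fun q : ℚ≥0 => X q ω) H K := by
    intro ι _ f
    have g := hX.gv (fun i => (f i : ℝ)) (fun i => by positivity)
    refine ⟨fun i => measurable_pi_apply _, g.2.1, fun a => ?_⟩
    rw [integral_map mZ.aemeasurable]
    · exact g.2.2 a
    · exact (exp_integrable (Finset.measurable_sum _ fun i _ => (show Measurable fun x : ℚ≥0 → ℝ => a i * x (f i) by fun_prop))).aestronglyMeasurable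
  have zo := zero_one hH hH1 hK hK1 hP (Ec_meas (H * K) c) fun n => by
    refine ae_eq_of_subset_of_measure_ge (Ec_inv hHK hc n) ?_ ((Tn_meas _ _) (Ec_meas _ _)).nullMeasurableSet (measure_ne_top _ _)
    conv_lhs => rw [← Tn_map hP n]
    rw [Measure.map_apply (Tn_meas _ _) (Ec_meas _ _)]
  rw [Measure.map_apply mZ (Ec_meas _ _)] at zo
  rcases zo with h | h
  · right
    rw [ae_iff]
    simp only [not_not]; exact h
  · left
    exact (prob_compl_eq_zero_iff (mZ (Ec_meas _ _))).2 h
end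

lemma sup_facts {b : ℝ → ℝ} (hb : ContinuousOn b (Set.Ici 0)) {r : ℝ} (_hr : 0 ≤ r) :
    BddAbove (Set.range fun t : Set.Icc (0:ℝ) r => |b t|) := by
  have h1 : IsCompact ((fun t => |b t|) '' Set.Icc 0 r) :=
    isCompact_Icc.image_of_continuousOn ((hb.mono fun t ht => ht.1).abs)
  obtain ⟨M, hM⟩ := h1.bddAbove
  refine ⟨M, ?_⟩
  rintro _ ⟨t, rfl⟩
  exact hM ⟨t, t.2, rfl⟩

lemma dens {b : ℝ → ℝ} (hb : ContinuousOn b (Set.Ici 0)) {r M : ℝ} (hr : 0 < r)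
    (h : ∀ d j : ℕ, j ≤ 2 ^ d → |b (r * (j / 2 ^ d))| ≤ M) : ∀ t, 0 ≤ t → t ≤ r → |b t| ≤ M := by
  intro t t0 tr
  have u0 : 0 ≤ t / r := by positivity
  have h1 := (tendsto_nat_floor_mul_div_atTop (R := ℝ) u0).comp (tendsto_pow_atTop_atTop_of_one_lt (show (1:ℝ) < 2 by norm_num))
  have h2 : Tendsto (fun d : ℕ => r * ((⌊t / r * 2 ^ d⌋₊ : ℕ) / 2 ^ d : ℝ)) atTop (𝓝[Set.Ici 0] t) := by
    refine tendsto_nhdsWithin_iff.2 ⟨?_, Eventually.of_forall fun d => ?_⟩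
    · have := h1.const_mul r
      rwa [mul_div_cancel₀ _ hr.ne'] at this
    · show (0:ℝ) ≤ _
      positivity
  have h3 := ((hb t t0).tendsto.comp h2).abs
  refine le_of_tendsto h3 (Eventually.of_forall fun d => h d _ ?_)
  have : t / r * 2 ^ d ≤ ((2 ^ d : ℕ) : ℝ) := by
    push_cast
    have : t / r ≤ 1 := div_le_one_of_le₀ tr hr.le
    nlinarith [show (0:ℝ) < 2 ^ d by positivity]
  exact Nat.floor_le_of_le this

lemma det {b : ℝ → ℝ} (hb : ContinuousOn b (Set.Ici 0)) {h c : ℝ} (hc : 0 < c)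
    (h1 : ∀ a : ℚ, 0 ≤ a → (a:ℝ) < c → (fun q : ℚ≥0 => b q) ∉ Ec h a)
    (h2 : ∀ a : ℚ, c < (a:ℝ) → (fun q : ℚ≥0 => b q) ∈ Ec h a) :
    Filter.liminf (fun r : ℝ => (⨆ t : Set.Icc (0:ℝ) r, |b t|) / (r ^ h / Real.log (Real.log (1 / r)) ^ h)) (𝓝[>] 0) = c := by
  change Filter.liminf (fun r : ℝ => (⨆ t : Set.Icc (0:ℝ) r, |b t|) / phi h r) (𝓝[>] 0) = c
  rw [Filter.liminf_eq]
  have low : ∀ a : ℚ, 0 ≤ a → (a:ℝ) < c → ∀ᶠ r in 𝓝[>] (0:ℝ), (a:ℝ) ≤ (⨆ t : Set.Icc (0:ℝ) r, |b t|) / phi h r := by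
    intro a a0 ac
    have h3 : ¬ ∀ N : ℕ, ∃ r : ℚ≥0, 0 < r ∧ (r:ℝ) < 1 / (N + 1) ∧ ∀ q : ℚ≥0, q ≤ r → |b q| ≤ a * phi h r := h1 a a0 ac
    push Not at h3
    obtain ⟨N, hN⟩ := h3
    filter_upwards [Ioo_mem_nhdsGT (show (0:ℝ) < min (1/3:ℝ) (1 / ((N:ℝ) + 1)) by positivity)] with r ⟨r0, r1⟩
    have r3 : r ≤ 1/3 := r1.le.trans (min_le_left _ _)
    have rN : r < 1 / (N + 1) := r1.trans_le (min_le_right _ _)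
    rw [le_div_iff₀ (phi_pos r0 r3)]
    by_contra hlt
    push Not at hlt
    have ev := ((phi_cont (h := h) r0 r3).const_mul (a:ℝ)).eventually (lt_mem_nhds hlt)
    obtain ⟨δ, δ0, hδ⟩ := Metric.eventually_nhds_iff.1 ev
    obtain ⟨s, s1, s2⟩ := exists_rat_btwn (show max (r - δ) 0 < r from max_lt (by linarith) r0)
    have s0 : (0:ℝ) < s := (le_max_right _ _).trans_lt s1
    have s0' : 0 < s := by exact_mod_cast s0
    have s3 : r - δ < s := (le_max_left _ _).trans_lt s1
    lift s to ℚ≥0 using s0'.le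
    have s2' : (s:ℝ) < r := by exact_mod_cast s2
    obtain ⟨q, q1, q2⟩ := hN s (by exact_mod_cast s0') (s2'.trans rN)
    have q3 : (q:ℝ) ≤ s := by exact_mod_cast q1
    have h4 := hδ (y := (s:ℝ)) (by
      rw [Real.dist_eq, abs_lt]
      have : r - δ < (s:ℝ) := by exact_mod_cast s3
      constructor <;> linarith)
    have h5 : |b q| ≤ ⨆ t : Set.Icc (0:ℝ) r, |b t| :=
      le_ciSup (sup_facts hb r0.le) (⟨q, by positivity, by linarith⟩ : Set.Icc (0:ℝ) r)
    linarith
  refine IsLUB.csSup_eq ⟨?_, ?_⟩ ⟨((0:ℚ):ℝ), low 0 le_rfl (by simpa using hc)⟩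
  · intro a ha
    by_contra hlt
    push Not at hlt
    obtain ⟨e, e1, e2⟩ := exists_rat_btwn hlt
    have ha' : ∀ᶠ r in 𝓝[>] (0:ℝ), a ≤ (⨆ t : Set.Icc (0:ℝ) r, |b t|) / phi h r := ha
    obtain ⟨δ, δ0, hδ⟩ := (mem_nhdsGT_iff_exists_Ioo_subset).1 ha'
    have δ0' : (0:ℝ) < δ := δ0
    obtain ⟨N, hN⟩ := exists_nat_one_div_lt δ0'
    obtain ⟨r, r0, r1, hr⟩ := h2 e e1 (N + 3)
    have r0' : (0:ℝ) < r := by exact_mod_cast r0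
    have N0 : (0:ℝ) ≤ N := Nat.cast_nonneg N
    push_cast at r1
    have h3 : (1:ℝ) / (N + 3 + 1) ≤ 1 / 3 := by apply one_div_le_one_div_of_le (by norm_num); linarith
    have h4 : (1:ℝ) / (N + 3 + 1) ≤ 1 / (N + 1) := by apply one_div_le_one_div_of_le (by positivity); linarith
    have h5 : a ≤ (⨆ t : Set.Icc (0:ℝ) (r:ℝ), |b t|) / phi h r := hδ ⟨r0', by linarith⟩
    have pp := phi_pos (h := h) r0' (by linarith)
    rw [le_div_iff₀ pp] at h5
    have : Nonempty (Set.Icc (0:ℝ) (r:ℝ)) := ⟨⟨0, le_rfl, r0'.le⟩⟩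
    have h6 : (⨆ t : Set.Icc (0:ℝ) (r:ℝ), |b t|) ≤ e * phi h r := by
      refine ciSup_le fun t => dens hb r0' (fun d j hj => ?_) t t.2.1 t.2.2
      have := hr (r * (j / 2 ^ d)) (mul_le_of_le_one_right (by positivity) (div_le_one_of_le₀ (by exact_mod_cast hj) (by positivity)))
      push_cast at this
      exact this
    nlinarith
  · intro a ha
    refine le_of_forall_lt_imp_le_of_dense fun e he => ?_
    obtain ⟨f, f1, f2⟩ := exists_rat_btwn (show max e 0 < c from max_lt he hc)
    have f0 : (0:ℝ) < f := (le_max_right _ _).trans_lt f1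
    exact ((le_max_left _ _).trans f1.le).trans (ha (low f (by exact_mod_cast f0.le) f2))

theorem main {Ω : Type*} [MeasurableSpace Ω] (μ : Measure Ω) [IsProbabilityMeasure μ] (H K : ℝ) (hH : 0 < H) (hH1 : H < 1) (hK : 0 < K) (hK1 : K ≤ 1)
    (B : ℝ → Ω → ℝ) (hB : IsBifBM μ H K B) : ∃ c : ℝ, 0 < c ∧ ∀ᵐ ω ∂μ,
    Filter.liminf (fun r : ℝ => (⨆ t : Set.Icc (0:ℝ) r, |B t ω|) / (r ^ (H * K) / Real.log (Real.log (1 / r)) ^ (H * K))) (𝓝[>] 0) = c := by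
  obtain ⟨X, hX, hXB⟩ := exists_version hH hK hB
  have hcont : ∀ᵐ ω ∂μ, ContinuousOn (fun t => B t ω) (Set.Ici 0) := hB.1
  obtain ⟨κ, κ0, hκ⟩ := lower_ae (μ := μ) hH hH1 hK hK1
  obtain ⟨C, C0, hC⟩ := upper_ae (μ := μ) hH hH1 hK hK1
  have eq : ∀ᵐ ω ∂μ, ∀ q : ℚ≥0, X q ω = B q ω := ae_all_iff.2 fun q => hXB q (by positivity)
  obtain ⟨S, hS⟩ : ∃ S : Set ℝ, S = {c | 0 ≤ c ∧ ∀ᵐ ω ∂μ, (fun q : ℚ≥0 => X q ω) ∉ Ec (H * K) c} := ⟨_, rfl⟩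
  have κS : κ ∈ S := by
    rw [hS]
    refine ⟨κ0.le, ?_⟩
    filter_upwards [hκ X hX] with ω hω hE
    obtain ⟨δ, δ0, hδ⟩ := (mem_nhdsGT_iff_exists_Ioo_subset).1 hω
    have δ0' : (0:ℝ) < δ := δ0
    obtain ⟨N, hN⟩ := exists_nat_one_div_lt δ0'
    obtain ⟨r, r0, r1, hr⟩ := hE N
    have r0' : (0:ℝ) < r := by exact_mod_cast r0
    obtain ⟨q, q0, q1, q2⟩ := hδ ⟨r0', r1.trans hN⟩
    lift q to ℚ≥0 using q0
    have q1' : (q:ℝ) ≤ r := by exact_mod_cast q1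
    have := hr q (by exact_mod_cast q1')
    have e : (((q:ℚ≥0):ℚ):ℝ) = (q:ℝ) := by norm_cast
    rw [e] at q2
    linarith
  have hCE : ∀ᵐ ω ∂μ, (fun q : ℚ≥0 => X q ω) ∈ Ec (H * K) C := by
    filter_upwards [hC X hX, hcont, eq] with ω h1 h2 h3 N
    have tz : Tendsto rn atTop (𝓝 0) := by
      have := (tendsto_pow_atTop_nhds_zero_of_lt_one (show (0:ℝ) ≤ 1/2 by norm_num) (by norm_num)).comp (tendsto_pow_atTop (α := ℕ) (n := 3) (by norm_num))
      exact this
    obtain ⟨n, hn, hn2⟩ := (h1.and_eventually (tz.eventually (gt_mem_nhds (show (0:ℝ) < 1 / (N + 1) by positivity)))).exists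
    have ern : (((1/2) ^ (n ^ 3) : ℚ≥0) : ℝ) = rn n := by push_cast; rfl
    refine ⟨(1/2) ^ (n ^ 3), by positivity, by rw [ern]; exact hn2, fun q hq => ?_⟩
    rw [ern]
    have hq' : (q:ℝ) ≤ rn n := by rw [← ern]; exact_mod_cast hq
    beta_reduce
    rw [h3 q]
    refine dens h2 (rn_pos n) (fun d j hj => ?_) q (by positivity) hq'
    have := h3 ((1/2) ^ (n ^ 3) * (j / 2 ^ d))
    have e : (((1/2) ^ (n ^ 3) * (j / 2 ^ d) : ℚ≥0) : ℝ) = rn n * (j / 2 ^ d) := by push_cast; rfl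
    rw [e] at this
    beta_reduce
    rw [← this]
    exact hn d j hj
  have SC : ∀ c ∈ S, c ≤ C := by
    intro c hc
    rw [hS] at hc
    by_contra hlt
    push Not at hlt
    obtain ⟨ω, h1, h2⟩ := (hCE.and hc.2).exists
    exact h2 (Ec_mono hlt.le h1)
  have Sb : BddAbove S := ⟨C, SC⟩
  refine ⟨sSup S, κ0.trans_le (le_csSup Sb κS), ?_⟩
  have a1 : ∀ a : ℚ, ∀ᵐ ω ∂μ, 0 ≤ a → (a:ℝ) < sSup S → (fun q : ℚ≥0 => X q ω) ∉ Ec (H * K) a := by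
    intro a
    by_cases h : (a:ℝ) < sSup S
    · obtain ⟨c, cS, hc⟩ := exists_lt_of_lt_csSup ⟨κ, κS⟩ h
      rw [hS] at cS
      filter_upwards [cS.2] with ω h1 _ _ h2
      exact h1 (Ec_mono hc.le h2)
    · exact ae_of_all _ fun ω _ h' => absurd h' h
  have a2 : ∀ a : ℚ, ∀ᵐ ω ∂μ, sSup S < (a:ℝ) → (fun q : ℚ≥0 => X q ω) ∈ Ec (H * K) a := by
    intro a
    by_cases h : sSup S < (a:ℝ)
    · have a0 : (0:ℝ) ≤ a := (κ0.le.trans (le_csSup Sb κS)).trans h.le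
      rcases Ec_01 hH hH1 hK hK1 hX a0 with h1 | h1
      · filter_upwards [h1] with ω h2 _ using h2
      · exact absurd (le_csSup Sb (show (a:ℝ) ∈ S by rw [hS]; exact ⟨a0, h1⟩)) (not_le.2 h)
    · exact ae_of_all _ fun ω h' => absurd h' h
  filter_upwards [hcont, eq, ae_all_iff.2 a1, ae_all_iff.2 a2] with ω g1 g2 g3 g4
  simp only [g2] at g3 g4
  exact det (b := fun t => B t ω) g1 (κ0.trans_le (le_csSup Sb κS)) g3 g4
end BifChung

/-- Theorem 3.1, Chung's law of the iterated logarithm: there is a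
constant `c ∈ (0,∞)` such that almost surely
`liminf_{r→0⁺} max_{t∈[0,r]} |B₀^{H,K}(t)| / (r^{HK} (log log(1/r))^{-HK}) = c`. -/
theorem bifBM_chung_LIL {Ω : Type*} [MeasurableSpace Ω] (μ : Measure Ω)
    [IsProbabilityMeasure μ] (H K : ℝ) (hH : H ∈ Set.Ioo (0:ℝ) 1)
    (hK : K ∈ Set.Ioc (0:ℝ) 1) (B : ℝ → Ω → ℝ) (hB : IsBifBM μ H K B) :
    ∃ c : ℝ, 0 < c ∧ ∀ᵐ ω ∂μ,
      Filter.liminf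
        (fun r : ℝ =>
          (⨆ t : Set.Icc (0:ℝ) r, |B t ω|) /
            (r ^ (H * K) / Real.log (Real.log (1 / r)) ^ (H * K)))
        (𝓝[>] 0) = c := by
  exact BifChung.main μ H K hH.1 hH.2 hK.1 hK.2 B hB
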